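/- Let K be a congruence function field over 𝔽₂ with genus g_K = 4 and class number h_K = 1. Then K has exactly one prime divisor of degree 4, no prime divisors of degree 1, 2 or 3, and exactly three prime divisors of degree 5. -/

import Mathlib

set_option synthInstance.maxHeartbeats 1000000
set_option maxHeartbeats 1000000

open scoped Classical

noncomputable section

namespace CFF

variable (F : Type*) [Field F]

/-- `K` is a (congruence) function field in one variable over `F`: a finitely
generated field extension of transcendence degree one. -/
def IsFunctionField (K : Type*) [Field K] [Algebra F K] : Prop :=
  ∃ x : K, Transcendental F x ∧
    FiniteDimensional (IntermediateField.adjoin F {x}) K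

/-- The exact field of constants of `K` is `F`: every element of `K` algebraic
over `F` already lies in `F`. -/
def HasExactConstants (K : Type*) [Field K] [Algebra F K] : Prop :=
  ∀ a : K, IsAlgebraic F a → a ∈ (algebraMap F K).range

variable (K : Type*) [Field K] [Algebra F K]

/-- A place of the function field `K/F`: a proper valuation subring of `K`
containing the constants. -/
def IsPlace (O : ValuationSubring K) : Prop :=
  O ≠ ⊤ ∧ ∀ c : F, algebraMap F K c ∈ O

/-- The type of places (prime divisors) of `K/F`. -/
def Place := {O : ValuationSubring K // IsPlace F K O}

variable {K}

/-- `𝔪`-adic order of an element of a valuation subring. -/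
def ordAux (O : ValuationSubring K) (x : O) : ℕ :=
  sSup {n : ℕ | x ∈ IsLocalRing.maximalIdeal O ^ n}

/-- The order (normalized valuation) of `f ∈ K` at a valuation subring `O`. -/
def ordAt (O : ValuationSubring K) (f : K) : ℤ :=
  if h : f ∈ O then (ordAux O ⟨f, h⟩ : ℤ)
  else -(ordAux O ⟨f⁻¹, (O.mem_or_inv_mem f).resolve_left h⟩ : ℤ)

/-- The constants embed into (the valuation ring of) any place. -/
def constHom (p : Place F K) : F →+* p.1 :=
  (algebraMap F K).codRestrict p.1.toSubring fun c => p.2.2 c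

/-- The map from the constants to the residue field of a place. -/
def residueHom (p : Place F K) : F →+* IsLocalRing.ResidueField p.1 :=
  (IsLocalRing.residue (p.1 : ValuationSubring K)).comp (constHom F p)

/-- The degree of a place: the dimension of its residue field over the
constants. -/
def placeDegree (p : Place F K) : ℕ :=
  letI := (residueHom F p).toAlgebra
  Module.finrank F (IsLocalRing.ResidueField p.1)

variable (K)

/-- The group of divisors of `K/F`. -/
abbrev Divisor := Place F K →₀ ℤ

/-- The degree homomorphism on divisors. -/
def degHom : Divisor F K →+ ℤ :=
  Finsupp.liftAddHom fun p => AddMonoidHom.mulRight (placeDegree F p : ℤ)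

variable {K}

/-- The Riemann-Roch space `L(D)` of a divisor `D` (the span coincides with the
set of `f` with `div f ≥ -D`, which is an `F`-subspace). -/
def RRspace (D : Divisor F K) : Submodule F K :=
  Submodule.span F {f : K | ∀ p : Place F K, 0 ≤ D p + ordAt p.1 f}

/-- `ℓ(D)`, the dimension of the Riemann-Roch space of `D`. -/
def ell (D : Divisor F K) : ℕ := Module.finrank F (RRspace F D)

variable (K)

/-- The genus of `K/F`, via Riemann's theorem: `g = max_D (deg D + 1 - ℓ(D))`. -/
def genus : ℕ :=
  sSup {g : ℕ | ∃ D : Divisor F K, (g : ℤ) = degHom F K D + 1 - ell F D}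

/-- The subgroup of divisors of degree zero. -/
def zeroDivisors : AddSubgroup (Divisor F K) := (degHom F K).ker

/-- The subgroup of principal divisors. -/
def principalDivisors : AddSubgroup (Divisor F K) :=
  AddSubgroup.closure
    {D : Divisor F K | ∃ f : K, f ≠ 0 ∧ ∀ p : Place F K, D p = ordAt p.1 f}

/-- The group of divisor classes of degree zero of `K/F`. -/
def ClassGroup0 :=
  zeroDivisors F K ⧸ (principalDivisors F K).addSubgroupOf (zeroDivisors F K)

instance : AddGroup (ClassGroup0 F K) := by
  unfold ClassGroup0; infer_instance

/-- The class number of `K/F`: the order of the group of divisor classes of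
degree zero. -/
def classNumber : ℕ := Nat.card (ClassGroup0 F K)

section Extension

variable {k L : Type*} [Field k] [Field L] [Algebra F k] [Algebra F L] [Algebra k L]

/-- A place `P` of `L` lies over the place `p` of `k`. -/
def LiesOver (P : Place F L) (p : Place F k) : Prop :=
  P.1.comap (algebraMap k L) = p.1

variable (L)

/-- `p` is inert in `L/k`: there is a unique place of `L` above `p`, and its
degree is `[L:k] · deg p` (i.e. the residue degree is `[L:k]`, so `e = 1`). -/
def IsInert (p : Place F k) : Prop :=
  ∃ P : Place F L, LiesOver F P p ∧
    placeDegree F P = Module.finrank k L * placeDegree F p ∧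
    ∀ P' : Place F L, LiesOver F P' p → P' = P

/-- `p` splits completely in `L/k`: there are `[L:k]` places above `p`, each of
the same degree as `p`. -/
def SplitsCompletely (p : Place F k) : Prop :=
  Nat.card {P : Place F L // LiesOver F P p} = Module.finrank k L ∧
    ∀ P : Place F L, LiesOver F P p → placeDegree F P = placeDegree F p

/-- `p` is totally ramified in `L/k`: there is a unique place above `p`, of the
same degree (so `f = 1` and `e = [L:k]`). -/
def IsTotallyRamified (p : Place F k) : Prop :=
  ∃ P : Place F L, LiesOver F P p ∧ placeDegree F P = placeDegree F p ∧
    ∀ P' : Place F L, LiesOver F P' p → P' = P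

/-- `p` is unramified in `L/k`: at every place above `p` the orders of elements
of `k` are preserved (`e = 1`). -/
def IsUnramifiedAt (p : Place F k) : Prop :=
  ∀ P : Place F L, LiesOver F P p →
    ∀ x : k, ordAt P.1 (algebraMap k L x) = ordAt p.1 x

end Extension

section Rational

/-- The finite place of `𝔽₂(T)` corresponding to an irreducible polynomial `P`:
the place contains all polynomials and `P` lies in its maximal ideal. -/
def IsFinitePlaceOf (p : Place (ZMod 2) (RatFunc (ZMod 2)))
    (P : Polynomial (ZMod 2)) : Prop :=
  (∀ g : Polynomial (ZMod 2), algebraMap (Polynomial (ZMod 2)) (RatFunc (ZMod 2)) g ∈ p.1) ∧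
    (algebraMap (Polynomial (ZMod 2)) (RatFunc (ZMod 2)) P)⁻¹ ∉ p.1

/-- The infinite place `𝔭_∞` of `𝔽₂(T)`: the place where `T` has a pole. -/
def IsInfinitePlace (p : Place (ZMod 2) (RatFunc (ZMod 2))) : Prop :=
  RatFunc.X ∉ p.1

end Rational

end CFF

namespace CFF

open Polynomial

section Finiteness

variable {F K : Type} [Field F] [Field K] [Algebra F K]

/-- A function field is finite over the subfield generated by any transcendental element. -/
theorem IsFunctionField.finiteDimensional (h : IsFunctionField F K) {t : K}
    (ht : Transcendental F t) : FiniteDimensional (IntermediateField.adjoin F {t}) K := by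
  obtain ⟨x, hx, hfin⟩ := h
  have : Algebra.EssFiniteType F (IntermediateField.adjoin F {x}) := by
    rw [IntermediateField.essFiniteType_iff]
    exact ⟨{x}, by simp⟩
  have h1 : Algebra.EssFiniteType F K :=
    Algebra.EssFiniteType.comp F (IntermediateField.adjoin F {x}) K
  have h2 : Algebra.EssFiniteType (IntermediateField.adjoin F {t}) K :=
    Algebra.EssFiniteType.of_comp F _ K
  have h4 : Algebra.trdeg F K ≤ 1 := by
    have : Algebra.IsAlgebraic (Algebra.adjoin F ({x} : Set K)) K :=
      IntermediateField.isAlgebraic_adjoin_iff_top.1 inferInstance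
    simpa using Algebra.IsAlgebraic.trdeg_le_cardinalMk F ({x} : Set K)
  have h5 : IsTranscendenceBasis F (fun _ : Unit => t) := by
    apply AlgebraicIndependent.isTranscendenceBasis_of_lift_trdeg_le_of_finite
    · rwa [algebraicIndependent_unique_type_iff]
    · simpa using h4
  have h6 : Algebra.IsAlgebraic (IntermediateField.adjoin F {t}) K := by
    have := h5.isAlgebraic_field
    rwa [Set.range_const] at this
  exact Algebra.finite_of_essFiniteType_of_isAlgebraic

/-- A bound on the length of tuples without a relation over `F[t]` that is nontrivial
modulo `t`. -/
theorem IsFunctionField.exists_bound (h : IsFunctionField F K) {t : K}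
    (ht : Transcendental F t) : ∃ m : ℕ, ∀ (n : ℕ) (y : Fin n → K),
      (∀ p : Fin n → F[X], ∑ i, aeval t (p i) * y i = 0 → ∀ i, (p i).coeff 0 = 0) → n ≤ m := by
  have := h.finiteDimensional ht
  refine ⟨Module.finrank (IntermediateField.adjoin F {t}) K, fun n y hy => ?_⟩
  have ht0 : t ≠ 0 := by
    rintro rfl; exact ht (isAlgebraic_zero)
  have hdiv : ∀ (k : ℕ) (p : Fin n → F[X]), ∑ i, aeval t (p i) * y i = 0 →
      ∀ i, X ^ k ∣ p i := by
    intro k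
    induction k with
    | zero => intro p _ i; simp
    | succ k ih =>
      intro p hp i
      have hX : ∀ i, ∃ q, p i = X * q := fun i => X_dvd_iff.2 (hy p hp i)
      choose q hq using hX
      have : ∑ i, aeval t (q i) * y i = 0 := by
        have : t * ∑ i, aeval t (q i) * y i = 0 := by
          rw [Finset.mul_sum, ← hp]
          refine Finset.sum_congr rfl fun i _ => ?_
          rw [hq i]; simp [mul_assoc]
        exact (mul_eq_zero.1 this).resolve_left ht0
      rw [hq i, pow_succ']
      exact mul_dvd_mul_left _ (ih q this i)
  have hzero : ∀ p : Fin n → F[X], ∑ i, aeval t (p i) * y i = 0 → ∀ i, p i = 0 := by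
    intro p hp i
    by_contra hne
    have := natDegree_le_of_dvd (hdiv ((p i).natDegree + 1) p hp i) hne
    simp at this
  have hli : LinearIndependent (IntermediateField.adjoin F {t}) y := by
    rw [Fintype.linearIndependent_iff]
    intro c hc
    have hrs : ∀ i, ∃ r s : F[X], s ≠ 0 ∧ (c i : K) = aeval t r / aeval t s := by
      intro i
      obtain ⟨r, s, hrs⟩ := (IntermediateField.mem_adjoin_simple_iff F (c i : K)).1 (c i).2
      by_cases hs : s = 0
      · exact ⟨0, 1, one_ne_zero, by simp [hrs, hs]⟩
      · exact ⟨r, s, hs, hrs⟩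
    choose r s hs hrs using hrs
    have hs' : ∀ i, aeval t (s i) ≠ 0 := fun i h0 => hs i ((transcendental_iff.1 ht) _ h0)
    have key : ∑ i, aeval t (r i * ∏ j ∈ Finset.univ.erase i, s j) * y i = 0 := by
      have : (∏ j, aeval t (s j)) * ∑ i, c i • y i = 0 := by rw [hc, mul_zero]
      rw [← this, Finset.mul_sum]
      refine Finset.sum_congr rfl fun i _ => ?_
      rw [IntermediateField.smul_def, smul_eq_mul, hrs i,
        ← Finset.mul_prod_erase Finset.univ _ (Finset.mem_univ i)]
      have := hs' i
      rw [map_mul, map_prod]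
      field_simp
    intro i
    have h0 := hzero _ key i
    have : r i = 0 := (mul_eq_zero.1 h0).resolve_right (Finset.prod_ne_zero_iff.2 fun j _ => hs j)
    apply Subtype.ext
    rw [hrs i, this]; simp
  simpa using hli.fintype_card_le_finrank

end Finiteness
end CFF

namespace CFF

open Polynomial

/-- Function fields with exact field of constants `F`. -/
class IsFF (F K : Type) [Field F] [Field K] [Algebra F K] : Prop where
  ff : IsFunctionField F K
  const : HasExactConstants F K

section Places

variable {F K : Type} [Field F] [Field K] [Algebra F K]

theorem transcendental_of_notMem [IsFF F K] {t : K} (h : t ∉ (algebraMap F K).range) :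
    Transcendental F t := fun h' => h (IsFF.const t h')

namespace Place

variable (P : Place F K)

/-- The valuation attached to a place. -/
abbrev val : Valuation K P.1.ValueGroup := P.1.valuation

theorem val_le_one_iff {x : K} : P.val x ≤ 1 ↔ x ∈ P.1 := P.1.valuation_le_one_iff x

theorem val_const {c : F} (hc : c ≠ 0) : P.val (algebraMap F K c) = 1 := by
  apply le_antisymm
  · exact (P.val_le_one_iff).2 (P.2.2 c)
  · have h := (P.val_le_one_iff).2 (P.2.2 c⁻¹)
    have h2 : P.val (algebraMap F K c) * P.val (algebraMap F K c⁻¹) = 1 := by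
      rw [← map_mul, ← map_mul, mul_inv_cancel₀ hc]; simp
    rw [← h2]
    exact mul_le_of_le_one_right' h

theorem exists_val_lt_one : ∃ t : K, t ≠ 0 ∧ P.val t < 1 := by
  have h := P.2.1
  obtain ⟨f, hf⟩ : ∃ f, f ∉ P.1 := by
    by_contra hcon
    push Not at hcon
    exact h (eq_top_iff.2 fun x _ => hcon x)
  have hf0 : f ≠ 0 := by rintro rfl; exact hf P.1.zero_mem
  refine ⟨f⁻¹, inv_ne_zero hf0, ?_⟩
  rw [← P.val_le_one_iff, not_le] at hf
  rw [map_inv₀]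
  exact inv_lt_one_of_one_lt₀ hf

theorem transcendental_of_val_lt_one [IsFF F K] {t : K} (h0 : t ≠ 0) (h : P.val t < 1) :
    Transcendental F t := by
  apply transcendental_of_notMem
  rintro ⟨c, rfl⟩
  rw [P.val_const (by rintro rfl; simp at h0)] at h
  exact lt_irrefl _ h

theorem val_aeval_le {t : K} (h : P.val t ≤ 1) (p : F[X]) : P.val (aeval t p) ≤ 1 := by
  rw [P.val_le_one_iff] at h ⊢
  rw [aeval_eq_sum_range]
  refine sum_mem fun i _ => ?_
  rw [Algebra.smul_def]
  exact mul_mem (P.2.2 _) (pow_mem h _)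

theorem val_aeval_of_coeff_ne {t : K} (h : P.val t < 1) {p : F[X]} (hp : p.coeff 0 ≠ 0) :
    P.val (aeval t p) = 1 := by
  rw [← divX_mul_X_add p, map_add, map_mul, aeval_X, aeval_C, add_comm]
  rw [Valuation.map_add_eq_of_lt_left]
  · exact P.val_const hp
  · rw [P.val_const hp, map_mul]
    exact lt_of_le_of_lt (mul_le_of_le_one_left' (P.val_aeval_le h.le _)) h

theorem val_aeval_le_of_coeff_eq {t : K} (h : P.val t < 1) {p : F[X]} (hp : p.coeff 0 = 0) :
    P.val (aeval t p) ≤ P.val t := by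
  obtain ⟨q, rfl⟩ := X_dvd_iff.2 hp
  rw [map_mul, aeval_X, map_mul]
  exact mul_le_of_le_one_right' (P.val_aeval_le h.le _)

theorem finite_between [IsFF F K] {t : K} (h0 : t ≠ 0) (h : P.val t < 1) :
    {γ | P.val t ≤ γ ∧ γ < 1}.Finite := by
  obtain ⟨m, hm⟩ := (IsFF.ff (F := F) (K := K)).exists_bound (P.transcendental_of_val_lt_one h0 h)
  by_contra hinf
  obtain ⟨s, hs, hcard⟩ := Set.Infinite.exists_subset_card_eq hinf (m + 1)
  let e := s.orderEmbOfFin hcard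
  have he : ∀ i, P.val t ≤ e i ∧ e i < 1 := fun i => hs (s.orderEmbOfFin_mem hcard i)
  choose y hy using fun i => P.1.valuation_surjective (e i)
  have := hm (m + 1) y (by
    intro p hp
    by_contra! hcon
    let T := Finset.univ.filter fun i => (p i).coeff 0 ≠ 0
    have hT : T.Nonempty := by
      obtain ⟨i, hi⟩ := hcon
      exact ⟨i, by simp [T, hi]⟩
    set j := T.max' hT
    have hj : (p j).coeff 0 ≠ 0 := (Finset.mem_filter.1 (T.max'_mem hT)).2
    have hvj : P.val (aeval t (p j) * y j) = e j := by
      rw [map_mul, P.val_aeval_of_coeff_ne h hj, one_mul]; exact hy j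
    have hlt : P.val (∑ i ∈ Finset.univ.erase j, aeval t (p i) * y i) < e j := by
      apply Valuation.map_sum_lt
      · exact ((zero_lt_iff.2 ((P.val.ne_zero_iff).2 h0)).trans_le (he j).1).ne'
      · intro i hi
        have hij : i ≠ j := (Finset.mem_erase.1 hi).1
        rw [map_mul]
        have hyi : P.val (y i) = e i := hy i
        rw [hyi]
        by_cases hi0 : (p i).coeff 0 = 0
        · calc P.val (aeval t (p i)) * e i ≤ P.val t * e i := by
                gcongr; exact P.val_aeval_le_of_coeff_eq h hi0
            _ < P.val t * 1 := by
                apply mul_lt_mul_of_pos_left (he i).2 (zero_lt_iff.2 ((P.val.ne_zero_iff).2 h0))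
            _ ≤ e j := by rw [mul_one]; exact (he j).1
        · rw [P.val_aeval_of_coeff_ne h hi0, one_mul]
          exact e.lt_iff_lt.2 (lt_of_le_of_ne (T.le_max' i (by simp [T, hi0])) hij)
    have hsum := Finset.add_sum_erase Finset.univ (fun i => aeval t (p i) * y i)
      (Finset.mem_univ j)
    rw [hp] at hsum
    have : P.val (aeval t (p j) * y j) < e j := by
      rw [eq_neg_of_add_eq_zero_left hsum, Valuation.map_neg]
      exact hlt
    exact this.ne hvj)
  omega

theorem exists_uniformizer [IsFF F K] : ∃ π : K, π ≠ 0 ∧ P.val π < 1 ∧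
    ∀ x, x ≠ 0 → ∃ n : ℤ, P.val x = P.val π ^ n := by
  obtain ⟨t, ht0, ht⟩ := P.exists_val_lt_one
  obtain ⟨γ, hγ, hmax⟩ := Set.exists_max_image _ id (P.finite_between ht0 ht) ⟨P.val t, le_rfl, ht⟩
  obtain ⟨π, hπ⟩ := P.1.valuation_surjective γ
  have hπ' : P.val π = γ := hπ
  have htpos : 0 < P.val t := zero_lt_iff.2 ((P.val.ne_zero_iff).2 ht0)
  have hπ0 : π ≠ 0 := by
    rintro rfl
    rw [map_zero] at hπ'
    exact (htpos.trans_le hγ.1).ne hπ'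
  have hπpos : 0 < P.val π := zero_lt_iff.2 ((P.val.ne_zero_iff).2 hπ0)
  have hle : ∀ x, P.val x < 1 → P.val x ≤ P.val π := by
    intro x hx
    by_cases hxt : P.val t ≤ P.val x
    · rw [hπ']; exact hmax _ ⟨hxt, hx⟩
    · rw [hπ']; exact (not_le.1 hxt).le.trans hγ.1
  have hπ1 : P.val π < 1 := by rw [hπ']; exact hγ.2
  have main : ∀ x, x ≠ 0 → P.val x ≤ 1 → ∃ n : ℕ, P.val x = P.val π ^ n := by
    intro x hx0 hx
    have hxpos : 0 < P.val x := zero_lt_iff.2 ((P.val.ne_zero_iff).2 hx0)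
    rcases hx.lt_or_eq with hx1 | hx1
    · have hex : ∃ n : ℕ, P.val π ^ n < P.val x := by
        by_contra! hcon
        have hinj : Function.Injective fun n : ℕ => P.val π ^ (n + 1) := by
          apply StrictAnti.injective
          apply strictAnti_nat_of_succ_lt
          intro n
          rw [pow_succ _ (n + 1)]
          exact mul_lt_of_lt_one_right (pow_pos hπpos _) hπ1
        have hmem : ∀ n : ℕ, P.val π ^ (n + 1) ∈ {γ | P.val x ≤ γ ∧ γ < 1} := fun n =>
          ⟨hcon (n + 1), pow_lt_one₀ zero_le hπ1 (by omega)⟩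
        exact Set.infinite_of_injective_forall_mem hinj hmem (P.finite_between hx0 hx1)
      obtain ⟨n, hn, hmin⟩ : ∃ n : ℕ, P.val π ^ n < P.val x ∧ ∀ k < n, P.val x ≤ P.val π ^ k :=
        ⟨Nat.find hex, Nat.find_spec hex, fun k hk => not_lt.1 (Nat.find_min hex hk)⟩
      cases n with
      | zero => simp at hn; exact absurd hx (not_le.2 hn)
      | succ n =>
        refine ⟨n, le_antisymm (hmin n (by omega)) ?_⟩
        by_contra hcon
        push Not at hcon
        have h2 : P.val (x / π ^ n) < 1 := by
          rw [map_div₀, map_pow]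
          exact (div_lt_one₀ (pow_pos hπpos _)).2 hcon
        have h3 := hle _ h2
        rw [map_div₀, map_pow, div_le_iff₀ (pow_pos hπpos _), ← pow_succ'] at h3
        exact absurd hn (not_lt.2 h3)
    · exact ⟨0, by simpa using hx1⟩
  refine ⟨π, hπ0, hπ1, fun x hx => ?_⟩
  rcases le_total (P.val x) 1 with h | h
  · obtain ⟨n, hn⟩ := main x hx h
    exact ⟨n, by simpa using hn⟩
  · obtain ⟨n, hn⟩ := main x⁻¹ (inv_ne_zero hx) (by
      rw [map_inv₀]; exact inv_le_one_of_one_le₀ h)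
    refine ⟨-n, ?_⟩
    rw [map_inv₀] at hn
    rw [zpow_neg, zpow_natCast, ← hn, inv_inv]

theorem ordAt_eq [IsFF F K] {π : K} (hπ0 : π ≠ 0) (hπ1 : P.val π < 1)
    (hπ : ∀ x, x ≠ 0 → ∃ n : ℤ, P.val x = P.val π ^ n) {x : K} {n : ℤ}
    (h : P.val x = P.val π ^ n) : ordAt P.1 x = n := by
  have hπpos : 0 < P.val π := zero_lt_iff.2 ((P.val.ne_zero_iff).2 hπ0)
  have hanti : StrictAnti fun n : ℤ => P.val π ^ n := zpow_right_strictAnti₀ hπpos hπ1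
  have hmem : π ∈ P.1 := P.val_le_one_iff.1 hπ1.le
  have hmax : IsLocalRing.maximalIdeal P.1 = Ideal.span {⟨π, hmem⟩} := by
    ext a
    rw [P.1.valuation_lt_one_iff, Ideal.mem_span_singleton]
    constructor
    · intro ha
      by_cases ha0 : (a : K) = 0
      · have : a = 0 := Subtype.ext ha0
        rw [this]; exact dvd_zero _
      obtain ⟨k, hk⟩ := hπ a ha0
      have hk1 : 1 ≤ k := by
        by_contra hcon
        have h1 : P.val π ^ (0 : ℤ) ≤ P.val π ^ k := hanti.antitone (by omega)
        rw [← hk, zpow_zero] at h1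
        exact absurd ha (not_lt.2 h1)
      have h2 : P.val a ≤ P.val π := by
        have h1 : P.val π ^ k ≤ P.val π ^ (1 : ℤ) := hanti.antitone hk1
        rwa [← hk, zpow_one] at h1
      obtain ⟨b, hb⟩ := (P.1.valuation_le_iff _ _).1 h2
      exact ⟨b, Subtype.ext (by rw [← hb, mul_comm]; rfl)⟩
    · rintro ⟨b, rfl⟩
      have : P.val ((⟨π, hmem⟩ * b : P.1) : K) = P.val π * P.val b := map_mul P.val _ _
      exact lt_of_eq_of_lt this
        (lt_of_le_of_lt (mul_le_of_le_one_right' (P.val_le_one_iff.2 b.2)) hπ1)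
  have hpow : ∀ (a : P.1) (k : ℕ), a ∈ IsLocalRing.maximalIdeal P.1 ^ k ↔
      P.val a ≤ P.val π ^ k := by
    intro a k
    rw [hmax, Ideal.span_singleton_pow, Ideal.mem_span_singleton, ← map_pow]
    constructor
    · rintro ⟨b, rfl⟩
      have : P.val ((⟨π, hmem⟩ ^ k * b : P.1) : K) = P.val (π ^ k) * P.val b := map_mul P.val _ _
      exact le_of_eq_of_le this (mul_le_of_le_one_right' (P.val_le_one_iff.2 b.2))
    · intro h2
      obtain ⟨b, hb⟩ := (P.1.valuation_le_iff _ _).1 h2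
      exact ⟨b, Subtype.ext (by rw [← hb, mul_comm]; rfl)⟩
  have haux : ∀ (a : P.1) (k : ℕ), P.val a = P.val π ^ k → ordAux P.1 a = k := by
    intro a k hk
    have : {n : ℕ | a ∈ IsLocalRing.maximalIdeal P.1 ^ n} = Set.Iic k := by
      ext j
      rw [Set.mem_ofPred_eq, hpow, hk, Set.mem_Iic, ← zpow_natCast, ← zpow_natCast]
      rw [hanti.le_iff_ge]
      exact Int.ofNat_le
    rw [ordAux, this, csSup_Iic]
  unfold ordAt
  split_ifs with hxO
  · have hn : 0 ≤ n := by
      by_contra hcon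
      have h1 : P.val π ^ (0 : ℤ) < P.val π ^ n := hanti (by omega)
      rw [← h, zpow_zero] at h1
      exact absurd (P.val_le_one_iff.2 hxO) (not_le.2 h1)
    obtain ⟨k, rfl⟩ := Int.eq_ofNat_of_zero_le hn
    rw [haux ⟨x, hxO⟩ k (by simpa using h)]
  · have hn : n ≤ 0 := by
      by_contra hcon
      have h1 : P.val π ^ n < P.val π ^ (0 : ℤ) := hanti (by omega)
      rw [← h, zpow_zero] at h1
      exact hxO (P.val_le_one_iff.1 h1.le)
    obtain ⟨k, hk⟩ := Int.eq_ofNat_of_zero_le (neg_nonneg.2 hn)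
    rw [haux _ k]
    · omega
    · have : P.val x⁻¹ = P.val π ^ k := by
        rw [map_inv₀, h, ← zpow_neg, hk, zpow_natCast]
      exact this

/-- All that is needed about orders at a place. -/
theorem exists_ordAt [IsFF F K] : ∃ π : K, π ≠ 0 ∧ P.val π < 1 ∧
    ∀ x, x ≠ 0 → P.val x = P.val π ^ ordAt P.1 x := by
  obtain ⟨π, h0, h1, h⟩ := P.exists_uniformizer
  refine ⟨π, h0, h1, fun x hx => ?_⟩
  obtain ⟨n, hn⟩ := h x hx
  rw [P.ordAt_eq h0 h1 h hn, hn]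

theorem ordAt_zero : ordAt P.1 0 = 0 := by
  have h0 : (0 : K) ∈ P.1 := P.1.zero_mem
  unfold ordAt
  rw [dif_pos h0]
  have : {n : ℕ | (⟨0, h0⟩ : P.1) ∈ IsLocalRing.maximalIdeal P.1 ^ n} = Set.univ := by
    ext n
    simp only [Set.mem_ofPred_eq, Set.mem_univ, iff_true]
    exact (IsLocalRing.maximalIdeal P.1 ^ n).zero_mem
  rw [ordAux, this]
  simp

section ord

variable [IsFF F K]

theorem ordAt_le_iff {x y : K} (hx : x ≠ 0) (hy : y ≠ 0) :
    ordAt P.1 x ≤ ordAt P.1 y ↔ P.val y ≤ P.val x := by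
  obtain ⟨π, h0, h1, h⟩ := P.exists_ordAt
  have hanti : StrictAnti fun n : ℤ => P.val π ^ n :=
    zpow_right_strictAnti₀ (zero_lt_iff.2 ((P.val.ne_zero_iff).2 h0)) h1
  rw [h x hx, h y hy]
  exact hanti.le_iff_ge.symm

theorem ordAt_eq_iff {x y : K} (hx : x ≠ 0) (hy : y ≠ 0) :
    ordAt P.1 x = ordAt P.1 y ↔ P.val x = P.val y := by
  rw [le_antisymm_iff, le_antisymm_iff, ordAt_le_iff P hx hy, ordAt_le_iff P hy hx, and_comm]

theorem ordAt_mul {x y : K} (hx : x ≠ 0) (hy : y ≠ 0) :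
    ordAt P.1 (x * y) = ordAt P.1 x + ordAt P.1 y := by
  obtain ⟨π, h0, h1, h⟩ := P.exists_ordAt
  have hanti : StrictAnti fun n : ℤ => P.val π ^ n :=
    zpow_right_strictAnti₀ (zero_lt_iff.2 ((P.val.ne_zero_iff).2 h0)) h1
  apply hanti.injective
  show P.val π ^ _ = P.val π ^ _
  rw [zpow_add₀ ((P.val.ne_zero_iff).2 h0), ← h x hx, ← h y hy, ← h _ (mul_ne_zero hx hy), map_mul]

theorem ordAt_one : ordAt P.1 (1 : K) = 0 := by
  have := P.ordAt_mul (one_ne_zero (α := K)) one_ne_zero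
  rw [mul_one] at this
  omega

theorem ordAt_inv (x : K) : ordAt P.1 x⁻¹ = - ordAt P.1 x := by
  by_cases hx : x = 0
  · simp [hx, ordAt_zero]
  have := P.ordAt_mul hx (inv_ne_zero hx)
  rw [mul_inv_cancel₀ hx, ordAt_one] at this
  omega

theorem ordAt_pow (x : K) (n : ℕ) : ordAt P.1 (x ^ n) = n * ordAt P.1 x := by
  by_cases hx : x = 0
  · subst hx
    rcases Nat.eq_zero_or_pos n with rfl | hn
    · simp [ordAt_one]
    · simp [zero_pow hn.ne', ordAt_zero]
  induction n with
  | zero => simp [ordAt_one]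
  | succ n ih => rw [pow_succ, P.ordAt_mul (pow_ne_zero _ hx) hx, ih]; push_cast; ring

theorem ordAt_nonneg_iff {x : K} (hx : x ≠ 0) : 0 ≤ ordAt P.1 x ↔ x ∈ P.1 := by
  rw [← P.ordAt_one, P.ordAt_le_iff one_ne_zero hx, map_one, P.val_le_one_iff]

theorem ordAt_pos_iff {x : K} (hx : x ≠ 0) : 0 < ordAt P.1 x ↔ P.val x < 1 := by
  rw [← P.ordAt_one, ← not_le, P.ordAt_le_iff hx one_ne_zero, map_one, not_le]

theorem ordAt_eq_zero_iff {x : K} (hx : x ≠ 0) : ordAt P.1 x = 0 ↔ P.val x = 1 := by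
  rw [← P.ordAt_one, P.ordAt_eq_iff hx one_ne_zero, map_one]

theorem ordAt_const (c : F) : ordAt P.1 (algebraMap F K c) = 0 := by
  by_cases hc : c = 0
  · simp [hc, ordAt_zero]
  rw [P.ordAt_eq_zero_iff (by simpa using hc)]
  exact P.val_const hc

theorem exists_ordAt_eq_one : ∃ π : K, π ≠ 0 ∧ ordAt P.1 π = 1 := by
  obtain ⟨π, h0, h1, h⟩ := P.exists_uniformizer
  exact ⟨π, h0, P.ordAt_eq h0 h1 h (by simp)⟩

/-- The elements of order at least `n` at a place. -/
def ball (n : ℤ) : Submodule F K where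
  carrier := {f | f = 0 ∨ n ≤ ordAt P.1 f}
  zero_mem' := Or.inl rfl
  add_mem' := by
    rintro x y hx hy
    by_cases hx0 : x = 0
    · simpa [hx0] using hy
    by_cases hy0 : y = 0
    · simpa [hy0] using hx
    by_cases hxy : x + y = 0
    · exact Or.inl hxy
    right
    have hx1 := hx.resolve_left hx0
    have hy1 := hy.resolve_left hy0
    rcases le_max_iff.1 (P.val.map_add x y) with h | h
    · exact hx1.trans ((P.ordAt_le_iff hx0 hxy).2 h)
    · exact hy1.trans ((P.ordAt_le_iff hy0 hxy).2 h)
  smul_mem' := by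
    rintro c x hx
    by_cases hx0 : x = 0
    · left; simp [hx0]
    by_cases hc : c = 0
    · left; simp [hc]
    right
    rw [Algebra.smul_def, P.ordAt_mul (by simpa using hc) hx0, ordAt_const, zero_add]
    exact hx.resolve_left hx0

theorem mem_ball {n : ℤ} {f : K} : f ∈ P.ball n ↔ f = 0 ∨ n ≤ ordAt P.1 f := Iff.rfl

theorem mem_ball_of_ne {n : ℤ} {f : K} (hf : f ≠ 0) : f ∈ P.ball n ↔ n ≤ ordAt P.1 f := by
  simp [mem_ball, hf]

theorem ball_anti {m n : ℤ} (h : m ≤ n) : P.ball n ≤ P.ball m := by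
  rintro f (hf | hf)
  · exact Or.inl hf
  · exact Or.inr (h.trans hf)

theorem mul_mem_ball {m n : ℤ} {f g : K} (hf : f ∈ P.ball m) (hg : g ∈ P.ball n) :
    f * g ∈ P.ball (m + n) := by
  by_cases hf0 : f = 0
  · left; simp [hf0]
  by_cases hg0 : g = 0
  · left; simp [hg0]
  right
  rw [P.ordAt_mul hf0 hg0]
  exact add_le_add ((P.mem_ball_of_ne hf0).1 hf) ((P.mem_ball_of_ne hg0).1 hg)

theorem mul_mem_ball_iff {n : ℤ} {f g : K} (hf : f ≠ 0) :
    f * g ∈ P.ball n ↔ g ∈ P.ball (n - ordAt P.1 f) := by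
  by_cases hg0 : g = 0
  · simp [hg0]
  rw [P.mem_ball_of_ne (mul_ne_zero hf hg0), P.mem_ball_of_ne hg0, P.ordAt_mul hf hg0]
  constructor <;> intro <;> linarith

theorem mem_ball_zero {f : K} : f ∈ P.ball 0 ↔ f ∈ P.1 := by
  by_cases hf : f = 0
  · simp [hf, P.1.zero_mem]
  rw [P.mem_ball_of_ne hf, P.ordAt_nonneg_iff hf]

theorem mem_ball_one {f : K} : f ∈ P.ball 1 ↔ P.val f < 1 := by
  by_cases hf : f = 0
  · simp [hf]
  rw [P.mem_ball_of_ne hf, ← P.ordAt_pos_iff hf]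
  rfl

theorem mem_ball_one_iff_residue {f : P.1} :
    (f : K) ∈ P.ball 1 ↔ IsLocalRing.residue P.1 f = 0 := by
  rw [mem_ball_one, IsLocalRing.residue_eq_zero_iff, P.1.valuation_lt_one_iff]

end ord

instance : Algebra F P.1 := (constHom F P).toAlgebra

instance : IsScalarTower F P.1 K := IsScalarTower.of_algebraMap_eq fun _ => rfl

/-- The residue field of a place. -/
abbrev ResField := IsLocalRing.ResidueField P.1

theorem placeDegree_eq : placeDegree F P = Module.finrank F P.ResField := by
  unfold placeDegree
  congr 1

theorem finite_resField [IsFF F K] : Module.Finite F P.ResField := by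
  obtain ⟨t, ht0, ht⟩ := P.exists_val_lt_one
  obtain ⟨m, hm⟩ := (IsFF.ff (F := F) (K := K)).exists_bound
    (P.transcendental_of_val_lt_one ht0 ht)
  rw [← Module.rank_lt_aleph0_iff]
  refine lt_of_le_of_lt (rank_le (n := m) ?_) Cardinal.natCast_lt_aleph0
  intro s hs
  choose y hy using fun i : Fin s.card => IsLocalRing.residue_surjective (R := P.1)
    ((s.equivFin.symm i : s) : P.ResField)
  refine hm s.card (fun i => (y i : K)) fun p hp => ?_
  have htm : t ∈ P.1 := P.val_le_one_iff.1 ht.le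
  have hp' : ∑ i, aeval (⟨t, htm⟩ : P.1) (p i) * y i = 0 := by
    apply Subtype.ext
    change algebraMap P.1 K (∑ i, aeval (⟨t, htm⟩ : P.1) (p i) * y i) = 0
    rw [map_sum, ← hp]
    refine Finset.sum_congr rfl fun i _ => ?_
    rw [map_mul, ← aeval_algebraMap_apply]
    rfl
  have hres := congrArg (IsLocalRing.residue P.1) hp'
  rw [map_sum, map_zero] at hres
  have hrt : algebraMap P.1 P.ResField ⟨t, htm⟩ = 0 := by
    have : IsLocalRing.residue P.1 ⟨t, htm⟩ = 0 := by
      rw [← mem_ball_one_iff_residue, mem_ball_one]; exact ht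
    exact this
  have hlin : ∑ i, (p i).coeff 0 • ((s.equivFin.symm i : s) : P.ResField) = 0 := by
    rw [← hres]
    refine Finset.sum_congr rfl fun i _ => ?_
    rw [map_mul, hy i]
    have : IsLocalRing.residue P.1 (aeval (⟨t, htm⟩ : P.1) (p i))
        = aeval (algebraMap P.1 P.ResField ⟨t, htm⟩) (p i) := by
      rw [aeval_algebraMap_apply]; rfl
    rw [this, hrt, ← coeff_zero_eq_aeval_zero', Algebra.smul_def]
  have hs' : LinearIndependent F fun i : Fin s.card => ((s.equivFin.symm i : s) : P.ResField) :=
    hs.comp _ s.equivFin.symm.injective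
  exact Fintype.linearIndependent_iff.1 hs' _ hlin

theorem placeDegree_pos [IsFF F K] : 0 < placeDegree F P := by
  rw [placeDegree_eq]
  have := P.finite_resField
  exact Module.finrank_pos

end Place
end Places
end CFF

namespace CFF

open Polynomial

section RiemannRochSpaces

variable {F K : Type} [Field F] [Field K] [Algebra F K]

theorem exists_pole [IsFF F K] {f : K} (hf : f ∉ (algebraMap F K).range) :
    ∃ P : Place F K, ordAt P.1 f < 0 := by
  have hf0 : f ≠ 0 := by rintro rfl; exact hf ⟨0, by simp⟩
  have hs : Transcendental F f⁻¹ := transcendental_of_notMem (by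
    rintro ⟨c, hc⟩
    exact hf ⟨c⁻¹, by rw [map_inv₀, hc, inv_inv]⟩)
  let A : Subalgebra F K := Algebra.adjoin F {f⁻¹}
  have hsA : f⁻¹ ∈ A := Algebra.subset_adjoin rfl
  let I : Ideal A.toSubring := Ideal.span {⟨f⁻¹, hsA⟩}
  have hI : I ≠ ⊤ := by
    intro htop
    rw [Ideal.span_singleton_eq_top] at htop
    obtain ⟨b, hb⟩ := htop.exists_right_inv
    have hb' : f⁻¹ * (b : K) = 1 := congrArg Subtype.val hb
    have hbA : (b : K) ∈ Algebra.adjoin F {f⁻¹} := b.2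
    rw [Algebra.adjoin_singleton_eq_range_aeval] at hbA
    obtain ⟨p, hp⟩ := hbA
    have hp' : aeval f⁻¹ p = (b : K) := hp
    have h0 : aeval f⁻¹ (X * p - 1) = 0 := by
      rw [map_sub, map_mul, aeval_X, hp', hb', map_one, sub_self]
    have h1 := congrArg (fun q => coeff q 0) ((transcendental_iff.1 hs) _ h0)
    simp at h1
  obtain ⟨B, hAB, hB⟩ := Ideal.image_subset_nonunits_valuationSubring I hI
  have hsB : f⁻¹ ∈ B.nonunits := hB ⟨⟨f⁻¹, hsA⟩, Ideal.subset_span rfl, rfl⟩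
  have hlt : B.valuation f⁻¹ < 1 := (B.mem_nonunits_iff).1 hsB
  have hfB : f ∉ B := by
    intro h
    rw [← B.valuation_le_one_iff] at h
    have h1 : B.valuation f * B.valuation f⁻¹ = 1 := by
      rw [← map_mul, mul_inv_cancel₀ hf0, map_one]
    have h2 : B.valuation f * B.valuation f⁻¹ < 1 :=
      lt_of_le_of_lt (mul_le_of_le_one_left' h) hlt
    exact h2.ne h1
  let P : Place F K := ⟨B, by rintro rfl; exact hfB (ValuationSubring.mem_top f), fun c =>
    hAB (A.algebraMap_mem c)⟩
  refine ⟨P, ?_⟩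
  by_contra hcon
  exact hfB ((P.ordAt_nonneg_iff hf0).1 (not_lt.1 hcon))

/-- The degree of a divisor. -/
abbrev deg (D : Divisor F K) : ℤ := degHom F K D

theorem deg_single (P : Place F K) (n : ℤ) : deg (Finsupp.single P n) = n * placeDegree F P := by
  simp [deg, degHom]

theorem deg_eq_sum (D : Divisor F K) : deg D = D.sum fun P n => n * (placeDegree F P : ℤ) := rfl

theorem deg_nonneg {D : Divisor F K} (h : 0 ≤ D) : 0 ≤ deg D := by
  rw [deg_eq_sum]
  exact Finset.sum_nonneg fun P _ => mul_nonneg (h P) (Int.natCast_nonneg _)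

theorem deg_mono {D E : Divisor F K} (h : D ≤ E) : deg D ≤ deg E := by
  have := deg_nonneg (sub_nonneg.2 h)
  rw [deg, map_sub] at this
  linarith

variable [IsFF F K]

theorem effective_induction {p : Divisor F K → Prop} (h0 : p 0)
    (hs : ∀ D P, 0 ≤ D → p D → p (D + Finsupp.single P 1)) {D : Divisor F K} (hD : 0 ≤ D) :
    p D := by
  obtain ⟨n, hn⟩ := Int.eq_ofNat_of_zero_le (deg_nonneg hD)
  induction n using Nat.strong_induction_on generalizing D with
  | _ n ih =>
    by_cases hD0 : D = 0
    · rwa [hD0]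
    obtain ⟨P, hP⟩ := Finsupp.ne_iff.1 hD0
    have hP1 : 1 ≤ D P := by
      have := hD P
      simp only [Finsupp.coe_zero, Pi.zero_apply] at hP this
      omega
    have hD' : 0 ≤ D - Finsupp.single P 1 := by
      intro Q
      simp only [Finsupp.coe_zero, Pi.zero_apply, Finsupp.coe_sub, Pi.sub_apply,
        Finsupp.single_apply]
      split_ifs with h
      · subst h; omega
      · simpa using hD Q
    have hdeg : deg (D - Finsupp.single P 1) = n - placeDegree F P := by
      rw [deg, map_sub]
      rw [show degHom F K D = n from hn, show degHom F K (Finsupp.single P 1) = _ from deg_single P 1]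
      ring
    have hpos := P.placeDegree_pos
    have hnn := deg_nonneg hD'
    rw [hdeg] at hnn
    have := hs _ P hD' (ih (n - placeDegree F P) (by omega) hD' (by rw [hdeg]; omega))
    rwa [sub_add_cancel] at this

theorem mem_RRspace {D : Divisor F K} {f : K} :
    f ∈ RRspace F D ↔ ∀ P : Place F K, f ∈ P.ball (-(D P)) := by
  constructor
  · intro hf
    have : RRspace F D ≤ ⨅ P : Place F K, P.ball (-(D P)) := by
      refine Submodule.span_le.2 fun g hg => ?_
      simp only [SetLike.mem_coe, Submodule.mem_iInf]
      intro P
      exact Or.inr (by linarith [hg P])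
    simpa [Submodule.mem_iInf] using this hf
  · intro hf
    by_cases hf0 : f = 0
    · rw [hf0]; exact Submodule.zero_mem _
    refine Submodule.subset_span fun P => ?_
    have := (P.mem_ball_of_ne hf0).1 (hf P)
    linarith

theorem RRspace_mono {D E : Divisor F K} (h : D ≤ E) : RRspace F D ≤ RRspace F E := by
  intro f hf
  rw [mem_RRspace] at hf ⊢
  exact fun P => P.ball_anti (neg_le_neg (h P)) (hf P)

theorem mul_mem_RRspace {D E : Divisor F K} {f g : K} (hf : f ∈ RRspace F D)
    (hg : g ∈ RRspace F E) : f * g ∈ RRspace F (D + E) := by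
  rw [mem_RRspace] at *
  intro P
  have := P.mul_mem_ball (hf P) (hg P)
  rw [Finsupp.add_apply, neg_add]
  exact this

theorem mem_RRspace_zero {f : K} : f ∈ RRspace F (0 : Divisor F K) ↔
    f ∈ (algebraMap F K).range := by
  constructor
  · intro hf
    by_contra hcon
    obtain ⟨P, hP⟩ := exists_pole hcon
    have hf0 : f ≠ 0 := by rintro rfl; exact hcon ⟨0, by simp⟩
    have := (P.mem_ball_of_ne hf0).1 (mem_RRspace.1 hf P)
    simp at this
    omega
  · rintro ⟨c, rfl⟩
    rw [mem_RRspace]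
    intro P
    right
    rw [P.ordAt_const]; simp

theorem ell_zero : ell F (0 : Divisor F K) = 1 := by
  rw [ell, finrank_eq_one_iff']
  refine ⟨⟨1, mem_RRspace_zero.2 ⟨1, by simp⟩⟩, by simp [Subtype.ext_iff], ?_⟩
  rintro ⟨f, hf⟩
  obtain ⟨c, rfl⟩ := mem_RRspace_zero.1 hf
  exact ⟨c, Subtype.ext (by simp [Algebra.smul_def])⟩

/-- The leading coefficient map at a place. -/
theorem Place.exists_resMap (P : Place F K) (n : ℤ) :
    ∃ φ : P.ball n →ₗ[F] P.ResField, Function.Surjective φ ∧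
      ∀ f, φ f = 0 ↔ (f : K) ∈ P.ball (n + 1) := by
  obtain ⟨π, hπ0, hπ1⟩ := P.exists_ordAt_eq_one
  have hpow : ordAt P.1 (π ^ (-n)) = -n := by
    rcases le_total 0 (-n) with h | h
    · obtain ⟨k, hk⟩ := Int.eq_ofNat_of_zero_le h
      rw [hk, zpow_natCast, P.ordAt_pow, hπ1, mul_one]
    · obtain ⟨k, hk⟩ := Int.eq_ofNat_of_zero_le (neg_nonneg.2 h)
      have : -n = -(k : ℤ) := by omega
      rw [this, zpow_neg, zpow_natCast, P.ordAt_inv, P.ordAt_pow, hπ1, mul_one]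
  have hp0 : π ^ (-n) ≠ 0 := zpow_ne_zero _ hπ0
  have hmem : ∀ f : K, f ∈ P.ball n ↔ π ^ (-n) * f ∈ P.1 := by
    intro f
    rw [← P.mem_ball_zero, P.mul_mem_ball_iff hp0, hpow]
    simp
  let φ : P.ball n →ₗ[F] P.ResField :=
    { toFun := fun f => IsLocalRing.residue P.1 ⟨π ^ (-n) * f, (hmem f).1 f.2⟩
      map_add' := by
        intro f g
        rw [← map_add]
        congr 1
        apply Subtype.ext
        change π ^ (-n) * ((f : K) + g) = π ^ (-n) * f + π ^ (-n) * g
        ring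
      map_smul' := by
        intro c f
        rw [RingHom.id_apply, Algebra.smul_def]
        have : algebraMap F P.ResField c = IsLocalRing.residue P.1 (algebraMap F P.1 c) := rfl
        rw [this, ← map_mul]
        congr 1
        apply Subtype.ext
        change π ^ (-n) * (c • (f : K)) = algebraMap F K c * (π ^ (-n) * f)
        rw [Algebra.smul_def]; ring }
  refine ⟨φ, ?_, ?_⟩
  · intro r
    obtain ⟨a, ha⟩ := IsLocalRing.residue_surjective r
    refine ⟨⟨(π ^ (-n))⁻¹ * a, (hmem _).2 ?_⟩, ?_⟩
    · rw [mul_inv_cancel_left₀ hp0]; exact a.2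
    · rw [← ha]
      change IsLocalRing.residue P.1 _ = _
      congr 1
      apply Subtype.ext
      exact mul_inv_cancel_left₀ hp0 _
  · intro f
    change IsLocalRing.residue P.1 _ = 0 ↔ _
    rw [← P.mem_ball_one_iff_residue]
    change π ^ (-n) * (f : K) ∈ P.ball 1 ↔ _
    rw [P.mul_mem_ball_iff hp0, hpow]
    rw [show (1 : ℤ) - -n = n + 1 by ring]

theorem exists_step (D : Divisor F K) (P : Place F K) :
    ∃ φ : RRspace F (D + Finsupp.single P 1) →ₗ[F] P.ResField,
      ∀ f, φ f = 0 ↔ (f : K) ∈ RRspace F D := by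
  obtain ⟨φ, -, hφ⟩ := P.exists_resMap (-(D P) - 1)
  have hle : RRspace F (D + Finsupp.single P 1) ≤ P.ball (-(D P) - 1) := by
    intro f hf
    have := mem_RRspace.1 hf P
    rwa [Finsupp.add_apply, Finsupp.single_eq_same, neg_add] at this
  refine ⟨φ ∘ₗ Submodule.inclusion hle, fun f => ?_⟩
  rw [LinearMap.comp_apply, hφ, sub_add_cancel, Submodule.coe_inclusion, mem_RRspace]
  constructor
  · intro h Q
    by_cases hQ : Q = P
    · rw [hQ]; exact h
    · have := mem_RRspace.1 f.2 Q
      rwa [Finsupp.add_apply, Finsupp.single_eq_of_ne hQ, add_zero] at this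
  · intro h
    exact h P

theorem finite_RRspace_add {D : Divisor F K} (P : Place F K) [Module.Finite F (RRspace F D)] :
    Module.Finite F (RRspace F (D + Finsupp.single P 1)) ∧
      (ell F (D + Finsupp.single P 1) : ℤ) ≤ ell F D + placeDegree F P := by
  obtain ⟨φ, hφ⟩ := exists_step D P
  have := P.finite_resField
  have hker : ∀ f : φ.ker, ((f : RRspace F (D + Finsupp.single P 1)) : K) ∈ RRspace F D :=
    fun f => (hφ _).1 f.2
  let ι : φ.ker →ₗ[F] RRspace F D :=
    ((RRspace F (D + Finsupp.single P 1)).subtype ∘ₗ φ.ker.subtype).codRestrict _ hker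
  have hι : Function.Injective ι := by
    intro a b hab
    have := congrArg Subtype.val hab
    exact Subtype.ext (Subtype.ext this)
  have h1 : Module.Finite F φ.ker := Module.Finite.of_injective ι hι
  have h2 : Module.Finite F φ.range := inferInstance
  have h3 : Module.Finite F (RRspace F (D + Finsupp.single P 1)) := by
    have : Module.Finite F (_ ⧸ φ.ker) := Module.Finite.equiv φ.quotKerEquivRange.symm
    exact Module.Finite.of_submodule_quotient φ.ker
  refine ⟨h3, ?_⟩
  have h4 := LinearMap.finrank_range_add_finrank_ker φ
  have h5 := LinearMap.finrank_le_finrank_of_injective hι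
  have h6 : Module.finrank F φ.range ≤ Module.finrank F P.ResField := Submodule.finrank_le _
  rw [← P.placeDegree_eq] at h6
  unfold ell
  omega

instance finite_RRspace (D : Divisor F K) : Module.Finite F (RRspace F D) := by
  have h0 : Module.Finite F (RRspace F (0 : Divisor F K)) :=
    Module.finite_of_finrank_pos (by have := ell_zero (F := F) (K := K); unfold ell at this; omega)
  have h1 : ∀ E : Divisor F K, 0 ≤ E → Module.Finite F (RRspace F E) := fun E hE =>
    effective_induction (p := fun E => Module.Finite F (RRspace F E)) h0
      (fun D P _ hD => (finite_RRspace_add (D := D) P).1) hE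
  have := h1 (D ⊔ 0) le_sup_right
  exact Module.Finite.of_injective (Submodule.inclusion (RRspace_mono (le_sup_left : D ≤ D ⊔ 0)))
    (Submodule.inclusion_injective _)

theorem ell_sub_le {D E : Divisor F K} (h : D ≤ E) :
    (ell F E : ℤ) - ell F D ≤ deg E - deg D := by
  have key : ∀ G : Divisor F K, 0 ≤ G → (ell F (D + G) : ℤ) - ell F D ≤ deg G := fun G hG =>
    effective_induction (p := fun G => (ell F (D + G) : ℤ) - ell F D ≤ deg G) (by simp)
      (fun G P _ ih => by
        have := (finite_RRspace_add (D := D + G) P).2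
        rw [deg, map_add, show degHom F K (Finsupp.single P 1) = _ from deg_single P 1, ← add_assoc]
        unfold deg at ih
        linarith) hG
  have := key (E - D) (sub_nonneg.2 h)
  rw [deg, map_sub, add_sub_cancel] at this
  exact this

end RiemannRochSpaces
end CFF

namespace CFF

open Polynomial

/-- Function fields for which Riemann's theorem holds (so that `genus` is meaningful). -/
class HasGenus (F K : Type) [Field F] [Field K] [Algebra F K] : Prop extends IsFF F K where
  riemann : ∀ D : Divisor F K, degHom F K D + 1 - ell F D ≤ genus F K
  attained : ∃ D : Divisor F K, (genus F K : ℤ) = degHom F K D + 1 - ell F D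

section Genus

variable {F K : Type} [Field F] [Field K] [Algebra F K]

theorem hasGenus_of_genus_ne_zero [IsFF F K] (h : genus F K ≠ 0) : HasGenus F K := by
  let S : Set ℕ := {g : ℕ | ∃ D : Divisor F K, (g : ℤ) = degHom F K D + 1 - ell F D}
  have hg : genus F K = sSup S := rfl
  have hbdd : BddAbove S := by
    by_contra hcon
    exact h (hg.trans (Nat.sSup_of_not_bddAbove hcon))
  have hne : S.Nonempty := ⟨0, 0, by simp [ell_zero]⟩
  refine ⟨fun D => ?_, ?_⟩
  · rcases le_total 0 (degHom F K D + 1 - ell F D) with h0 | h0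
    · obtain ⟨n, hn⟩ := Int.eq_ofNat_of_zero_le h0
      rw [hn, hg]
      exact_mod_cast le_csSup hbdd (show n ∈ S from ⟨D, hn.symm⟩)
    · exact h0.trans (Int.natCast_nonneg _)
  · exact Nat.sSup_mem hne hbdd

theorem exists_independent_mod {V W : Submodule F K} [Module.Finite F V]
    (h : W ≤ V) : ∃ b : Fin (Module.finrank F V - Module.finrank F W) → K, (∀ i, b i ∈ V) ∧
      ∀ c : Fin (Module.finrank F V - Module.finrank F W) → F, ∑ i, c i • b i ∈ W →
        ∀ i, c i = 0 := by
  have hfr : Module.finrank F (V ⧸ W.submoduleOf V) =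
      Module.finrank F V - Module.finrank F W := by
    rw [Submodule.finrank_quotient, (Submodule.submoduleOfEquivOfLe h).finrank_eq]
  let e := Module.finBasisOfFinrankEq F (V ⧸ W.submoduleOf V) hfr
  choose b hb using fun i => Submodule.mkQ_surjective (W.submoduleOf V) (e i)
  refine ⟨fun i => b i, fun i => (b i).2, fun c hc => ?_⟩
  refine Fintype.linearIndependent_iff.1 e.linearIndependent c ?_
  have h1 : ∑ i, c i • b i ∈ W.submoduleOf V := by
    change ((∑ i, c i • b i : V) : K) ∈ W
    simpa using hc
  rw [← (Submodule.Quotient.mk_eq_zero _)] at h1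
  rw [← h1]
  change _ = (W.submoduleOf V).mkQ _
  rw [map_sum]
  exact Finset.sum_congr rfl fun i _ => by rw [map_smul, hb]

variable [HasGenus F K]

theorem riemann (D : Divisor F K) : deg D + 1 - ell F D ≤ genus F K := HasGenus.riemann D

theorem finite_zeros {f : K} (hf : f ∉ (algebraMap F K).range) :
    {P : Place F K | 0 < ordAt P.1 f}.Finite := by
  have hf0 : f ≠ 0 := by rintro rfl; exact hf ⟨0, by simp⟩
  obtain ⟨m, hm⟩ := (IsFF.ff (F := F) (K := K)).exists_bound (transcendental_of_notMem hf)
  by_contra hinf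
  obtain ⟨s, hs, hcard⟩ := Set.Infinite.exists_subset_card_eq hinf (m + genus F K + 1)
  let D : Divisor F K := ∑ P ∈ s, Finsupp.single P 1
  have hD : ∀ P, D P = if P ∈ s then 1 else 0 := by
    intro P
    simp [D, Finsupp.finsetSum_apply, Finsupp.single_apply]
  have hD0 : 0 ≤ D := fun P => by rw [hD]; split_ifs <;> simp
  have hdeg : (m + genus F K + 1 : ℤ) ≤ deg D := by
    have : deg D = ∑ P ∈ s, (placeDegree F P : ℤ) := by
      simp only [D, deg, map_sum]
      exact Finset.sum_congr rfl fun P _ => by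
        rw [show degHom F K (Finsupp.single P 1) = _ from deg_single P 1, one_mul]
    rw [this]
    have h1 : (s.card : ℤ) = ∑ P ∈ s, 1 := by simp
    rw [hcard] at h1
    push_cast at h1
    rw [h1]
    exact Finset.sum_le_sum fun P _ => by exact_mod_cast P.placeDegree_pos
  have hr := riemann D
  -- a complement of the constants
  have hle : RRspace F (0 : Divisor F K) ≤ RRspace F D := RRspace_mono hD0
  obtain ⟨b, hbD, hb⟩ := exists_independent_mod hle
  have hlen := hm _ b (by
    intro p hp
    apply hb
    have hw : ∑ i, (p i).coeff 0 • b i = f * (-∑ i, aeval f (divX (p i)) * b i) := by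
      have h1 : ∀ i, aeval f (p i) * b i =
          f * (aeval f (divX (p i)) * b i) + (p i).coeff 0 • b i := by
        intro i
        conv_lhs => rw [← divX_mul_X_add (p i)]
        rw [map_add, map_mul, aeval_X, aeval_C, Algebra.smul_def]
        ring
      rw [Finset.sum_congr rfl fun i _ => h1 i, Finset.sum_add_distrib, ← Finset.mul_sum] at hp
      rw [mul_neg, ← eq_neg_of_add_eq_zero_right hp]
    rw [mem_RRspace]
    intro P
    rw [Finsupp.coe_zero, Pi.zero_apply]
    by_cases hP : P ∈ s
    · rw [hw]
      have hfP : f ∈ P.ball 1 := Or.inr (hs hP)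
      have hfO : P.val f ≤ 1 := (P.mem_ball_one.1 hfP).le
      have hsum : (-∑ i, aeval f (divX (p i)) * b i) ∈ P.ball (-1) := by
        refine Submodule.neg_mem _ (Submodule.sum_mem _ fun i _ => ?_)
        have h1 : aeval f (divX (p i)) ∈ P.ball 0 := by
          rw [P.mem_ball_zero, ← P.val_le_one_iff]
          exact P.val_aeval_le hfO _
        have h2 := mem_RRspace.1 (hbD i) P
        rw [hD, if_pos hP] at h2
        have := P.mul_mem_ball h1 h2
        rwa [zero_add] at this
      exact P.mul_mem_ball hfP hsum
    · refine Submodule.sum_mem _ fun i _ => Submodule.smul_mem _ _ ?_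
      have h2 := mem_RRspace.1 (hbD i) P
      rwa [hD, if_neg hP] at h2)
  have h0 := ell_zero (F := F) (K := K)
  unfold ell at hr h0
  omega

theorem finite_support (f : K) : (Function.support fun P : Place F K => ordAt P.1 f).Finite := by
  by_cases hf : f ∈ (algebraMap F K).range
  · obtain ⟨c, rfl⟩ := hf
    convert Set.finite_empty
    ext P
    simp [Place.ordAt_const]
  · have hf' : f⁻¹ ∉ (algebraMap F K).range := by
      rintro ⟨c, hc⟩
      exact hf ⟨c⁻¹, by rw [map_inv₀, hc, inv_inv]⟩
    refine ((finite_zeros (F := F) hf).union (finite_zeros (F := F) hf')).subset fun P hP => ?_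
    rw [Function.mem_support] at hP
    simp only [Set.mem_union, Set.mem_ofPred_eq, P.ordAt_inv]
    omega

variable (F) in
/-- The divisor of a function (zero for the zero function). -/
def pdiv (f : K) : Divisor F K := Finsupp.ofSupportFinite _ (finite_support (F := F) f)

@[simp]
theorem pdiv_apply (f : K) (P : Place F K) : pdiv F f P = ordAt P.1 f := rfl

theorem pdiv_mul {f g : K} (hf : f ≠ 0) (hg : g ≠ 0) : pdiv F (f * g) = pdiv F f + pdiv F g := by
  ext P
  exact P.ordAt_mul hf hg

theorem pdiv_inv (f : K) : pdiv F f⁻¹ = -pdiv F f := by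
  ext P
  exact P.ordAt_inv f

theorem pdiv_pow (f : K) (n : ℕ) : pdiv F (f ^ n) = n • pdiv F f := by
  ext P
  simp [P.ordAt_pow]

theorem mem_RRspace_iff {D : Divisor F K} {f : K} (hf : f ≠ 0) :
    f ∈ RRspace F D ↔ 0 ≤ D + pdiv F f := by
  rw [mem_RRspace]
  refine forall_congr' fun P => ?_
  rw [P.mem_ball_of_ne hf]
  simp only [Finsupp.coe_zero, Pi.zero_apply, Finsupp.add_apply, pdiv_apply]
  constructor <;> intro <;> linarith

theorem mul_mem_RRspace_iff {D : Divisor F K} {f g : K} (hf : f ≠ 0) :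
    f * g ∈ RRspace F D ↔ g ∈ RRspace F (D + pdiv F f) := by
  rw [mem_RRspace, mem_RRspace]
  refine forall_congr' fun P => ?_
  rw [P.mul_mem_ball_iff hf, Finsupp.add_apply, pdiv_apply, neg_add, sub_eq_add_neg]

theorem ell_add_pdiv (D : Divisor F K) {f : K} (hf : f ≠ 0) :
    ell F (D + pdiv F f) = ell F D := by
  have hle : ∀ (D : Divisor F K) {f : K}, f ≠ 0 → ell F (D + pdiv F f) ≤ ell F D := by
    intro D f hf
    let φ : RRspace F (D + pdiv F f) →ₗ[F] RRspace F D :=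
      ((LinearMap.mulLeft F f) ∘ₗ (RRspace F (D + pdiv F f)).subtype).codRestrict _ fun g =>
        (mul_mem_RRspace_iff hf).2 g.2
    apply LinearMap.finrank_le_finrank_of_injective (f := φ)
    intro a b hab
    have := congrArg Subtype.val hab
    exact Subtype.ext (mul_left_cancel₀ hf this)
  refine le_antisymm (hle D hf) ?_
  have := hle (D + pdiv F f) (inv_ne_zero hf)
  rwa [pdiv_inv, add_neg_cancel_right] at this

theorem deg_pdiv (f : K) : deg (pdiv F f) = 0 := by
  by_cases hf : f = 0
  · have : pdiv F f = 0 := by ext P; simp [hf, P.ordAt_zero]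
    rw [this, deg, map_zero]
  have key : ∀ f : K, f ≠ 0 → deg (pdiv F f) ≤ 0 := by
    intro f hf
    by_contra! hcon
    have h1 := riemann (pdiv F (f ^ (genus F K + 1)))
    have h2 := ell_add_pdiv (0 : Divisor F K) (pow_ne_zero (genus F K + 1) hf)
    rw [zero_add, ell_zero] at h2
    rw [h2, pdiv_pow, deg, map_nsmul, nsmul_eq_mul] at h1
    unfold deg at hcon
    push_cast at h1
    nlinarith
  have h1 := key f hf
  have h2 := key f⁻¹ (inv_ne_zero hf)
  rw [pdiv_inv, deg, map_neg] at h2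
  unfold deg at *
  omega

theorem eq_zero_of_deg_neg {D : Divisor F K} (h : deg D < 0) {f : K} (hf : f ∈ RRspace F D) :
    f = 0 := by
  by_contra hf0
  have := deg_nonneg ((mem_RRspace_iff hf0).1 hf)
  rw [deg, map_add, show degHom F K (pdiv F f) = 0 from deg_pdiv f] at this
  unfold deg at h
  omega

theorem ell_eq_zero_of_deg_neg {D : Divisor F K} (h : deg D < 0) : ell F D = 0 := by
  have : RRspace F D = ⊥ := (Submodule.eq_bot_iff _).2 fun f hf => eq_zero_of_deg_neg h hf
  rw [ell, this, finrank_bot]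

theorem ell_le (D : Divisor F K) (h : 0 ≤ deg D) : (ell F D : ℤ) ≤ deg D + 1 := by
  by_cases hD : RRspace F D = ⊥
  · rw [ell, hD, finrank_bot]; push_cast; omega
  obtain ⟨f, hf, hf0⟩ := Submodule.exists_mem_ne_zero_of_ne_bot hD
  have h1 := (mem_RRspace_iff hf0).1 hf
  have h2 := ell_sub_le h1
  rw [ell_add_pdiv D hf0, ell_zero, deg, map_add,
    show degHom F K (pdiv F f) = 0 from deg_pdiv f, deg, map_zero] at h2
  unfold deg
  push_cast at h2
  omega

end Genus
end CFF

namespace CFF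

section LinearAlgebra

variable {F M C V : Type*} [Field F] [AddCommGroup M] [Module F M] [AddCommGroup C] [Module F C]
  [AddCommGroup V] [Module F V]

theorem finrank_range_of_ker_le [Module.Finite F C] (f : M →ₗ[F] C) (g : M →ₗ[F] V)
    (hf : Function.Surjective f) (h : f.ker ≤ g.ker) :
    Module.Finite F g.range ∧
      Module.finrank F g.range + Module.finrank F (g.ker.map f) = Module.finrank F C := by
  let e := f.quotKerEquivOfSurjective hf
  let Ψ : C →ₗ[F] V := (f.ker.liftQ g h) ∘ₗ e.symm.toLinearMap
  have hΨ : ∀ m, Ψ (f m) = g m := by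
    intro m
    have : e.symm (f m) = f.ker.mkQ m := by
      rw [LinearEquiv.symm_apply_eq]; rfl
    change f.ker.liftQ g h (e.symm (f m)) = g m
    rw [this]
    rfl
  have hr : Ψ.range = g.range := by
    ext v
    constructor
    · rintro ⟨c, rfl⟩
      obtain ⟨m, rfl⟩ := hf c
      exact ⟨m, (hΨ m).symm⟩
    · rintro ⟨m, rfl⟩
      exact ⟨f m, hΨ m⟩
  have hk : Ψ.ker = g.ker.map f := by
    ext c
    obtain ⟨m, rfl⟩ := hf c
    rw [LinearMap.mem_ker, hΨ, Submodule.mem_map]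
    constructor
    · intro hm
      exact ⟨m, hm, rfl⟩
    · rintro ⟨m', hm', hmm⟩
      rw [← hΨ, ← hmm, hΨ]
      exact hm'
  rw [← hr, ← hk]
  exact ⟨inferInstance, Ψ.finrank_range_add_finrank_ker⟩

end LinearAlgebra

section Adeles

variable (F K : Type) [Field F] [Field K] [Algebra F K] [HasGenus F K]

/-- The adeles (without completion) of a function field. -/
def adele : Submodule F (Place F K → K) where
  carrier := {α | {P : Place F K | α P ∉ P.ball 0}.Finite}
  zero_mem' := by simp
  add_mem' := by
    intro α β hα hβ
    refine (hα.union hβ).subset fun P hP => ?_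
    by_contra hcon
    simp only [Set.mem_union, Set.mem_ofPred_eq, not_or, not_not] at hcon
    exact hP (Submodule.add_mem _ hcon.1 hcon.2)
  smul_mem' := by
    intro c α hα
    refine hα.subset fun P hP => ?_
    intro hcon
    exact hP (Submodule.smul_mem _ c hcon)

variable {F K}

theorem mem_adele_of {D : Divisor F K} {α : Place F K → K}
    (h : ∀ P : Place F K, α P ∈ P.ball (-(D P))) : α ∈ adele F K := by
  refine (D.support.finite_toSet).subset fun P hP => ?_
  by_contra hcon
  have : D P = 0 := by simpa using hcon
  have h2 := h P
  rw [this, neg_zero] at h2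
  exact hP h2

/-- Adeles with prescribed poles. -/
def adeleOf (D : Divisor F K) : Submodule F (adele F K) where
  carrier := {α | ∀ P : Place F K, (α : Place F K → K) P ∈ P.ball (-(D P))}
  zero_mem' := fun _ => Submodule.zero_mem _
  add_mem' := fun hα hβ P => Submodule.add_mem _ (hα P) (hβ P)
  smul_mem' := fun c _ hα P => Submodule.smul_mem _ c (hα P)

theorem mem_adeleOf {D : Divisor F K} {α : adele F K} :
    α ∈ adeleOf D ↔ ∀ P : Place F K, (α : Place F K → K) P ∈ P.ball (-(D P)) := Iff.rfl

theorem adeleOf_mono {D E : Divisor F K} (h : D ≤ E) : adeleOf D ≤ adeleOf E :=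
  fun _ hα P => P.ball_anti (neg_le_neg (h P)) (hα P)

theorem exists_adeleOf (D : Divisor F K) (α : adele F K) : ∃ E, D ≤ E ∧ α ∈ adeleOf E := by
  have hfin : (Function.support fun P : Place F K =>
      if (α : Place F K → K) P ∈ P.ball 0 then 0 else |ordAt P.1 ((α : Place F K → K) P)|).Finite := by
    refine Set.Finite.subset (show {P : Place F K | (α : Place F K → K) P ∉ P.ball 0}.Finite from α.2)
      fun P hP => ?_
    intro hcon
    simp [hcon] at hP
  refine ⟨D ⊔ Finsupp.ofSupportFinite _ hfin, le_sup_left, fun P => ?_⟩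
  refine P.ball_anti (m := -(_)) (n := -(Finsupp.ofSupportFinite _ hfin P))
    (neg_le_neg (le_sup_right (a := D P))) ?_
  change _ ∈ P.ball (-(if _ then _ else _))
  split_ifs with h
  · simpa using h
  · right
    exact neg_abs_le _

variable (F K) in
/-- The diagonal embedding. -/
def diag : K →ₗ[F] adele F K where
  toFun f := ⟨fun _ => f, by
    refine (finite_support (F := F) f).subset fun P hP => ?_
    rw [Function.mem_support]
    intro hcon
    exact hP (Or.inr hcon.ge)⟩
  map_add' _ _ := rfl
  map_smul' _ _ := rfl

/-- Adeles with prescribed poles up to principal adeles. -/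
def adeleClass (D : Divisor F K) : Submodule F (adele F K) := adeleOf D ⊔ (diag F K).range

theorem diag_mem_adeleOf {D : Divisor F K} {f : K} :
    diag F K f ∈ adeleOf D ↔ f ∈ RRspace F D := by
  rw [mem_RRspace]; rfl

theorem adeleClass_mono {D E : Divisor F K} (h : D ≤ E) : adeleClass D ≤ adeleClass E :=
  sup_le_sup_right (adeleOf_mono h) _

/-- The index of speciality. -/
def spec (D : Divisor F K) : ℤ := ell F D - deg D - 1 + genus F K

theorem spec_nonneg (D : Divisor F K) : 0 ≤ spec D := by
  have := riemann D
  unfold spec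
  linarith

theorem spec_anti {D E : Divisor F K} (h : D ≤ E) : spec E ≤ spec D := by
  have := ell_sub_le h
  unfold spec
  linarith

theorem finrank_step (D : Divisor F K) (P : Place F K) :
    Module.Finite F ((adeleClass (D + Finsupp.single P 1)).map (adeleClass D).mkQ) ∧
    (Module.finrank F ((adeleClass (D + Finsupp.single P 1)).map (adeleClass D).mkQ) : ℤ) =
      spec D - spec (D + Finsupp.single P 1) := by
  obtain ⟨φ, hφs, hφ⟩ := P.exists_resMap (-(D P) - 1)
  have hfin := P.finite_resField
  set E := D + Finsupp.single P 1 with hE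
  have hDE : D ≤ E := by
    rw [hE]
    exact le_add_of_nonneg_right (by simp)
  have hEP : -(E P) = -(D P) - 1 := by
    rw [hE, Finsupp.add_apply, Finsupp.single_eq_same]; ring
  have hEQ : ∀ Q, Q ≠ P → E Q = D Q := by
    intro Q hQ
    rw [hE, Finsupp.add_apply, Finsupp.single_eq_of_ne hQ, add_zero]
  -- the leading coefficient on adeles
  let f : adeleOf E →ₗ[F] P.ResField := φ ∘ₗ
    ((LinearMap.proj P ∘ₗ (adele F K).subtype ∘ₗ (adeleOf E).subtype).codRestrict _ fun α => by
      have := α.2 P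
      rw [hEP] at this
      exact this)
  have hf0 : ∀ α : adeleOf E, f α = 0 ↔ (α : adele F K) ∈ adeleOf D := by
    intro α
    change φ _ = 0 ↔ _
    rw [hφ, sub_add_cancel, mem_adeleOf]
    constructor
    · intro h Q
      by_cases hQ : Q = P
      · rw [hQ]; exact h
      · rw [← hEQ Q hQ]; exact α.2 Q
    · intro h
      exact h P
  have hfs : Function.Surjective f := by
    intro r
    obtain ⟨a, ha⟩ := hφs r
    have hmem : ∀ Q : Place F K, (Pi.single P (a : K) : Place F K → K) Q ∈ Q.ball (-(E Q)) := by
      intro Q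
      by_cases hQ : Q = P
      · subst hQ
        rw [Pi.single_eq_same, hEP]; exact a.2
      · rw [Pi.single_eq_of_ne hQ]; exact Submodule.zero_mem _
    refine ⟨⟨⟨_, mem_adele_of hmem⟩, hmem⟩, ?_⟩
    rw [← ha]
    change φ _ = _
    congr 1
    apply Subtype.ext
    change (Pi.single P (a : K) : Place F K → K) P = a
    rw [Pi.single_eq_same]
  let g : adeleOf E →ₗ[F] (adele F K ⧸ adeleClass D) := (adeleClass D).mkQ ∘ₗ (adeleOf E).subtype
  have hg0 : ∀ α : adeleOf E, g α = 0 ↔ (α : adele F K) ∈ adeleClass D := fun α =>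
    Submodule.Quotient.mk_eq_zero _
  have hker : f.ker ≤ g.ker := by
    intro α hα
    rw [LinearMap.mem_ker, hf0] at hα
    rw [LinearMap.mem_ker, hg0]
    exact Submodule.mem_sup_left hα
  have hrange : g.range = (adeleClass E).map (adeleClass D).mkQ := by
    have hcls : adeleClass E = adeleOf E ⊔ (diag F K).range := rfl
    rw [LinearMap.range_comp, Submodule.range_subtype, hcls, Submodule.map_sup]
    refine le_antisymm le_sup_left (sup_le le_rfl ?_)
    rintro _ ⟨_, ⟨k, rfl⟩, rfl⟩
    have : (adeleClass D).mkQ (diag F K k) = 0 :=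
      (Submodule.Quotient.mk_eq_zero _).2 (Submodule.mem_sup_right ⟨k, rfl⟩)
    rw [this]
    exact Submodule.zero_mem _
  obtain ⟨h1, h2⟩ := finrank_range_of_ker_le (F := F) (M := adeleOf E) (C := P.ResField)
    (V := adele F K ⧸ adeleClass D) f g hfs hker
  rw [hrange] at h1 h2
  refine ⟨h1, ?_⟩
  -- the leading coefficients of functions
  let ψ : RRspace F E →ₗ[F] P.ResField := f ∘ₗ
    (((diag F K) ∘ₗ (RRspace F E).subtype).codRestrict (adeleOf E) fun k => diag_mem_adeleOf.2 k.2)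
  have hψ : ψ.range = g.ker.map f := by
    ext c
    constructor
    · rintro ⟨k, rfl⟩
      refine ⟨_, ?_, rfl⟩
      exact (hg0 _).2 (Submodule.mem_sup_right ⟨k, rfl⟩)
    · rintro ⟨α, hα, rfl⟩
      have hα' := (hg0 α).1 hα
      obtain ⟨β, hβ, _, ⟨k, rfl⟩, hsum⟩ := Submodule.mem_sup.1 hα'
      have hk : diag F K k ∈ adeleOf E := by
        have : diag F K k = α - β := by rw [← hsum]; abel
        rw [this]
        exact Submodule.sub_mem _ α.2 (adeleOf_mono hDE hβ)
      refine ⟨⟨k, diag_mem_adeleOf.1 hk⟩, ?_⟩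
      change f ⟨diag F K k, hk⟩ = f α
      have hα2 : α = ⟨β, adeleOf_mono hDE hβ⟩ + ⟨diag F K k, hk⟩ := Subtype.ext hsum.symm
      rw [hα2, map_add, (hf0 ⟨β, _⟩).2 hβ, zero_add]
  have hψk : Module.finrank F ψ.ker = ell F D := by
    have : ψ.ker = (RRspace F D).submoduleOf (RRspace F E) := by
      ext k
      rw [LinearMap.mem_ker]
      change f ⟨diag F K k, _⟩ = 0 ↔ (k : K) ∈ RRspace F D
      rw [hf0, diag_mem_adeleOf]
    rw [this, (Submodule.submoduleOfEquivOfLe (RRspace_mono hDE)).finrank_eq, ell]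
  have h3 := ψ.finrank_range_add_finrank_ker
  rw [hψ, hψk] at h3
  rw [← P.placeDegree_eq] at h2
  have h4 : deg E = deg D + placeDegree F P := by
    rw [hE, deg, map_add, show degHom F K (Finsupp.single P 1) = _ from deg_single P 1, one_mul]
  unfold spec
  rw [h4]
  unfold ell at *
  omega

theorem adeleClass_add_le {E : Divisor F K} (hE : spec E = 0) {G : Divisor F K} (hG : 0 ≤ G) :
    adeleClass (E + G) ≤ adeleClass E := by
  refine effective_induction (p := fun G => adeleClass (E + G) ≤ adeleClass E) (by simp) ?_ hG
  intro G P hG ih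
  have h0 : spec (E + G) = 0 :=
    le_antisymm (hE ▸ spec_anti (le_add_of_nonneg_right hG)) (spec_nonneg _)
  obtain ⟨h1, h2⟩ := finrank_step (E + G) P
  have h3 := spec_nonneg (E + G + Finsupp.single P 1)
  have h4 : Module.finrank F
      ((adeleClass (E + G + Finsupp.single P 1)).map (adeleClass (E + G)).mkQ) = 0 := by omega
  have h5 := Submodule.finrank_eq_zero.1 h4
  rw [← le_bot_iff, Submodule.map_le_iff_le_comap] at h5
  rw [← add_assoc]
  refine le_trans (h5.trans ?_) ih
  intro α hα
  exact (Submodule.Quotient.mk_eq_zero _).1 hα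

theorem adeleClass_eq_top {E : Divisor F K} (hE : spec E = 0) : adeleClass E = ⊤ := by
  rw [eq_top_iff]
  intro α _
  obtain ⟨E', hle, hα⟩ := exists_adeleOf E α
  have := adeleClass_add_le hE (sub_nonneg.2 hle)
  rw [add_sub_cancel] at this
  exact this (Submodule.mem_sup_left hα)

theorem finrank_quotient_step {D : Divisor F K} (P : Place F K)
    (h : Module.Finite F (adele F K ⧸ adeleClass (D + Finsupp.single P 1)) ∧
      (Module.finrank F (adele F K ⧸ adeleClass (D + Finsupp.single P 1)) : ℤ) =
        spec (D + Finsupp.single P 1)) :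
    Module.Finite F (adele F K ⧸ adeleClass D) ∧
      (Module.finrank F (adele F K ⧸ adeleClass D) : ℤ) = spec D := by
  obtain ⟨hfin, hrank⟩ := h
  obtain ⟨h1, h2⟩ := finrank_step D P
  have hle : adeleClass D ≤ adeleClass (D + Finsupp.single P 1) :=
    adeleClass_mono (le_add_of_nonneg_right (by simp))
  let e := Submodule.quotientQuotientEquivQuotient _ _ hle
  have h3 : Module.Finite F ((adele F K ⧸ adeleClass D) ⧸
      (adeleClass (D + Finsupp.single P 1)).map (adeleClass D).mkQ) := Module.Finite.equiv e.symm
  have h4 := Module.Finite.of_submodule_quotient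
    ((adeleClass (D + Finsupp.single P 1)).map (adeleClass D).mkQ)
  refine ⟨h4, ?_⟩
  have h5 := Submodule.finrank_quotient_add_finrank
    ((adeleClass (D + Finsupp.single P 1)).map (adeleClass D).mkQ)
  rw [e.finrank_eq] at h5
  omega

theorem finrank_adele_quotient (D : Divisor F K) :
    Module.Finite F (adele F K ⧸ adeleClass D) ∧
      (Module.finrank F (adele F K ⧸ adeleClass D) : ℤ) = spec D := by
  obtain ⟨D₀, hD₀⟩ := HasGenus.attained (F := F) (K := K)
  have h0 : spec D₀ = 0 := by unfold spec deg; linarith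
  have h1 : spec (D ⊔ D₀) = 0 :=
    le_antisymm (h0 ▸ spec_anti le_sup_right) (spec_nonneg _)
  have h2 : Module.Finite F (adele F K ⧸ adeleClass (D ⊔ D₀)) ∧
      (Module.finrank F (adele F K ⧸ adeleClass (D ⊔ D₀)) : ℤ) = spec (D ⊔ D₀) := by
    have : Subsingleton (adele F K ⧸ adeleClass (D ⊔ D₀)) := by
      rw [Submodule.Quotient.subsingleton_iff]
      exact adeleClass_eq_top h1
    exact ⟨inferInstance, by rw [h1, Module.finrank_zero_of_subsingleton]; rfl⟩
  have key : ∀ G : Divisor F K, 0 ≤ G →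
      (Module.Finite F (adele F K ⧸ adeleClass (D + G)) ∧
        (Module.finrank F (adele F K ⧸ adeleClass (D + G)) : ℤ) = spec (D + G)) →
      (Module.Finite F (adele F K ⧸ adeleClass D) ∧
        (Module.finrank F (adele F K ⧸ adeleClass D) : ℤ) = spec D) := by
    intro G hG
    refine effective_induction (p := fun G => (Module.Finite F (adele F K ⧸ adeleClass (D + G)) ∧
        (Module.finrank F (adele F K ⧸ adeleClass (D + G)) : ℤ) = spec (D + G)) →
      (Module.Finite F (adele F K ⧸ adeleClass D) ∧
        (Module.finrank F (adele F K ⧸ adeleClass D) : ℤ) = spec D)) ?_ ?_ hG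
    · intro h; rwa [add_zero] at h
    · intro G P _ ih h
      rw [← add_assoc] at h
      exact ih (finrank_quotient_step P h)
  have := key (D ⊔ D₀ - D) (sub_nonneg.2 le_sup_left)
  rw [add_sub_cancel] at this
  exact this h2

end Adeles
end CFF

namespace CFF

section Differentials

variable {F K : Type} [Field F] [Field K] [Algebra F K] [HasGenus F K]

theorem mul_mem_adele (f : K) (α : adele F K) :
    (fun P => f * (α : Place F K → K) P) ∈ adele F K := by
  by_cases hf : f = 0
  · subst hf
    simp only [zero_mul]
    exact (adele F K).zero_mem
  obtain ⟨E, -, hE⟩ := exists_adeleOf 0 α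
  refine mem_adele_of (D := E - pdiv F f) fun P => ?_
  rw [P.mul_mem_ball_iff hf, Finsupp.sub_apply, pdiv_apply]
  have := hE P
  ring_nf at this ⊢
  exact this

variable (F) in
/-- Multiplication of adeles by a function. -/
def mulAdele (f : K) : adele F K →ₗ[F] adele F K where
  toFun α := ⟨fun P => f * (α : Place F K → K) P, mul_mem_adele f α⟩
  map_add' α β := by
    apply Subtype.ext
    funext P
    exact mul_add _ _ _
  map_smul' c α := by
    apply Subtype.ext
    funext P
    exact mul_smul_comm _ _ _

theorem mulAdele_mem_adeleOf {f : K} (hf : f ≠ 0) {D : Divisor F K} {α : adele F K}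
    (h : α ∈ adeleOf (D + pdiv F f)) : mulAdele F f α ∈ adeleOf D := by
  intro P
  change f * _ ∈ _
  rw [P.mul_mem_ball_iff hf]
  have := h P
  rw [Finsupp.add_apply, pdiv_apply, neg_add'] at this
  exact this

/-- Multiplication of a functional on adeles by a function. -/
def mulDual (f : K) (ω : (adele F K →ₗ[F] F)) : (adele F K →ₗ[F] F) :=
  ω ∘ₗ mulAdele F f

theorem mulDual_mul (f g : K) (ω : (adele F K →ₗ[F] F)) :
    mulDual f (mulDual g ω) = mulDual (g * f) ω := by
  ext α
  change ω (mulAdele F g (mulAdele F f α)) = ω (mulAdele F (g * f) α)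
  congr 1
  apply Subtype.ext
  funext P
  exact (mul_assoc _ _ _).symm

theorem mulDual_one (ω : (adele F K →ₗ[F] F)) : mulDual 1 ω = ω := by
  ext α
  change ω (mulAdele F 1 α) = ω α
  congr 1
  apply Subtype.ext
  funext P
  exact one_mul _

/-- Multiplication of a fixed functional by functions. -/
def mulDualHom (ω : (adele F K →ₗ[F] F)) : K →ₗ[F] (adele F K →ₗ[F] F) where
  toFun f := mulDual f ω
  map_add' f g := by
    ext α
    change ω (mulAdele F (f + g) α) = ω (mulAdele F f α) + ω (mulAdele F g α)
    rw [← map_add]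
    congr 1
    apply Subtype.ext
    funext P
    exact add_mul _ _ _
  map_smul' c f := by
    ext α
    change ω (mulAdele F (c • f) α) = c • ω (mulAdele F f α)
    rw [← map_smul]
    congr 1
    apply Subtype.ext
    funext P
    exact smul_mul_assoc _ _ _

theorem mulDualHom_apply (ω : (adele F K →ₗ[F] F)) (f : K) :
    mulDualHom ω f = mulDual f ω := rfl

/-- Weil differentials with prescribed divisor bound. -/
def diffs (D : Divisor F K) : Submodule F ((adele F K →ₗ[F] F)) :=
  (adeleClass D).dualAnnihilator

theorem mem_diffs {D : Divisor F K} {ω : (adele F K →ₗ[F] F)} :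
    ω ∈ diffs D ↔ (∀ α ∈ adeleOf D, ω α = 0) ∧ ∀ k, ω (diag F K k) = 0 := by
  rw [diffs, Submodule.mem_dualAnnihilator]
  constructor
  · intro h
    exact ⟨fun α hα => h α (Submodule.mem_sup_left hα),
      fun k => h _ (Submodule.mem_sup_right ⟨k, rfl⟩)⟩
  · rintro ⟨h1, h2⟩ α hα
    obtain ⟨β, hβ, _, ⟨k, rfl⟩, rfl⟩ := Submodule.mem_sup.1 hα
    rw [map_add, h1 β hβ, h2, add_zero]

theorem diffs_anti {D E : Divisor F K} (h : D ≤ E) : diffs E ≤ diffs D :=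
  Submodule.dualAnnihilator_anti (adeleClass_mono h)

theorem finrank_diffs (D : Divisor F K) :
    Module.Finite F (diffs D) ∧ (Module.finrank F (diffs D) : ℤ) = spec D := by
  obtain ⟨h1, h2⟩ := finrank_adele_quotient D
  let e := (adeleClass D).dualQuotEquivDualAnnihilator
  refine ⟨Module.Finite.equiv e, ?_⟩
  rw [← h2, ← Subspace.dual_finrank_eq (V := adele F K ⧸ adeleClass D)]
  exact_mod_cast e.finrank_eq.symm

theorem mulDual_mem_diffs {f : K} (hf : f ≠ 0) {D : Divisor F K}
    {ω : (adele F K →ₗ[F] F)} (h : ω ∈ diffs D) : mulDual f ω ∈ diffs (D + pdiv F f) := by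
  rw [mem_diffs] at h ⊢
  refine ⟨fun α hα => h.1 _ (mulAdele_mem_adeleOf hf hα), fun k => h.2 (f * k)⟩

theorem mulDual_mem_diffs_sub {f : K} {D E : Divisor F K} (hf : f ∈ RRspace F E)
    {ω : (adele F K →ₗ[F] F)} (h : ω ∈ diffs D) : mulDual f ω ∈ diffs (D - E) := by
  by_cases hf0 : f = 0
  · subst hf0
    rw [← mulDualHom_apply, map_zero]
    exact Submodule.zero_mem _
  · refine diffs_anti ?_ (mulDual_mem_diffs hf0 h)
    rw [mem_RRspace_iff hf0] at hf
    rw [sub_le_iff_le_add, add_assoc, add_comm (pdiv F f)]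
    exact le_add_of_nonneg_right hf

theorem eq_zero_of_mulDual_eq_zero {ω : (adele F K →ₗ[F] F)} (hω : ω ≠ 0) {f : K}
    (h : mulDual f ω = 0) : f = 0 := by
  by_contra hf
  apply hω
  rw [← mulDual_one ω, ← mul_inv_cancel₀ hf, ← mulDual_mul, h]
  rfl

theorem mulDualHom_injective {ω : (adele F K →ₗ[F] F)} (h0 : ω ≠ 0) :
    Function.Injective (mulDualHom ω) := by
  intro f g hfg
  rw [← sub_eq_zero, ← map_sub] at hfg
  exact sub_eq_zero.1 (eq_zero_of_mulDual_eq_zero h0 hfg)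

theorem map_RRspace_le_diffs {W : Divisor F K} {ω : (adele F K →ₗ[F] F)} (hω : ω ∈ diffs W)
    (E : Divisor F K) : (RRspace F E).map (mulDualHom ω) ≤ diffs (W - E) := by
  rintro _ ⟨f, hf, rfl⟩
  exact mulDual_mem_diffs_sub hf hω

theorem finrank_map_RRspace {ω : (adele F K →ₗ[F] F)} (h0 : ω ≠ 0) (E : Divisor F K) :
    Module.finrank F ((RRspace F E).map (mulDualHom ω)) = ell F E :=
  (Submodule.equivMapOfInjective _ (mulDualHom_injective h0) _).finrank_eq.symm

theorem ell_le_spec {W : Divisor F K} {ω : (adele F K →ₗ[F] F)} (hω : ω ∈ diffs W)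
    (h0 : ω ≠ 0) (E : Divisor F K) : (ell F E : ℤ) ≤ spec (W - E) := by
  have := (finrank_diffs (W - E)).1
  rw [← (finrank_diffs (W - E)).2, ← finrank_map_RRspace h0]
  exact_mod_cast Submodule.finrank_mono (map_RRspace_le_diffs hω E)

theorem exists_place : Nonempty (Place F K) := by
  obtain ⟨x, hx, -⟩ := IsFF.ff (F := F) (K := K)
  have : x ∉ (algebraMap F K).range := by
    rintro ⟨c, rfl⟩
    exact hx (isAlgebraic_algebraMap c)
  obtain ⟨P, -⟩ := exists_pole (F := F) this
  exact ⟨P⟩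

theorem exists_deg_gt (n : ℤ) : ∃ E : Divisor F K, 0 ≤ E ∧ n < deg E := by
  obtain ⟨P⟩ := exists_place (F := F) (K := K)
  refine ⟨Finsupp.single P (|n| + 1), ?_, ?_⟩
  · rw [Finsupp.single_nonneg]; positivity
  · rw [deg_single]
    have := P.placeDegree_pos (F := F)
    have h2 : (1 : ℤ) ≤ placeDegree F P := by exact_mod_cast this
    nlinarith [le_abs_self n, abs_nonneg n]

theorem exists_eq_mulDual {W : Divisor F K} {ω₁ ω₂ : (adele F K →ₗ[F] F)}
    (h₁ : ω₁ ∈ diffs W) (h₂ : ω₂ ∈ diffs W) (h₁0 : ω₁ ≠ 0) (h₂0 : ω₂ ≠ 0) :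
    ∃ f : K, f ≠ 0 ∧ ω₂ = mulDual f ω₁ := by
  obtain ⟨E, -, hE⟩ := exists_deg_gt (F := F) (K := K) (|deg W| + 3 * genus F K)
  have hfin := (finrank_diffs (W - E)).1
  have hrank := (finrank_diffs (W - E)).2
  have hA := map_RRspace_le_diffs h₁ E
  have hB := map_RRspace_le_diffs h₂ E
  have hfA := Submodule.finiteDimensional_of_le hA
  have hfB := Submodule.finiteDimensional_of_le hB
  have hnot : (RRspace F E).map (mulDualHom ω₁) ⊓ (RRspace F E).map (mulDualHom ω₂) ≠ ⊥ := by
    intro hbot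
    have h3 := Submodule.finrank_sup_add_finrank_inf_eq
      ((RRspace F E).map (mulDualHom ω₁)) ((RRspace F E).map (mulDualHom ω₂))
    rw [hbot, finrank_bot, add_zero, finrank_map_RRspace h₁0, finrank_map_RRspace h₂0] at h3
    have h3' := Submodule.finrank_mono (sup_le hA hB)
    have h4 : ell F (W - E) = 0 := by
      apply ell_eq_zero_of_deg_neg
      rw [deg, map_sub]
      change deg W - deg E < 0
      have := le_abs_self (deg W)
      have : (0 : ℤ) ≤ genus F K := by positivity
      linarith
    have h5 := riemann (F := F) E
    have h6 : deg (W - E) = deg W - deg E := map_sub _ _ _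
    rw [spec, h4, h6] at hrank
    have h7 := neg_abs_le (deg W)
    omega
  obtain ⟨η, ⟨⟨f, hfE, hfη⟩, ⟨g, hgE, hgη⟩⟩, hη⟩ := Submodule.exists_mem_ne_zero_of_ne_bot hnot
  have heq : mulDual f ω₁ = mulDual g ω₂ := hfη.trans hgη.symm
  have hz : ∀ ω : (adele F K →ₗ[F] F), mulDual 0 ω = 0 := fun ω => map_zero (mulDualHom ω)
  have hg : g ≠ 0 := by
    rintro rfl
    exact hη (hgη.symm.trans (hz _))
  have hf : f ≠ 0 := by
    rintro rfl
    exact hη (hfη.symm.trans (hz _))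
  refine ⟨f * g⁻¹, mul_ne_zero hf (inv_ne_zero hg), ?_⟩
  rw [← mulDual_mul, heq, mulDual_mul, mul_inv_cancel₀ hg, mulDual_one]

theorem mem_diffs_sup {D E : Divisor F K} {ω : (adele F K →ₗ[F] F)} (hD : ω ∈ diffs D)
    (hE : ω ∈ diffs E) : ω ∈ diffs (D ⊔ E) := by
  rw [mem_diffs] at hD hE ⊢
  refine ⟨fun α hα => ?_, hD.2⟩
  let β : Place F K → K := fun P => if E P ≤ D P then (α : Place F K → K) P else 0
  let γ : Place F K → K := fun P => if E P ≤ D P then 0 else (α : Place F K → K) P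
  have hβ : ∀ P, β P ∈ P.ball (-(D P)) := by
    intro P
    have := hα P
    rw [Finsupp.sup_apply] at this
    simp only [β]
    split_ifs with h
    · rwa [sup_eq_left.2 h] at this
    · exact Submodule.zero_mem _
  have hγ : ∀ P, γ P ∈ P.ball (-(E P)) := by
    intro P
    have := hα P
    rw [Finsupp.sup_apply] at this
    simp only [γ]
    split_ifs with h
    · exact Submodule.zero_mem _
    · rwa [sup_eq_right.2 (not_le.1 h).le] at this
  have hsum : α = ⟨β, mem_adele_of hβ⟩ + ⟨γ, mem_adele_of hγ⟩ := by
    apply Subtype.ext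
    funext P
    change _ = β P + γ P
    simp only [β, γ]
    split_ifs <;> simp
  rw [hsum, map_add, hD.1 ⟨β, mem_adele_of hβ⟩ hβ, hE.1 ⟨γ, mem_adele_of hγ⟩ hγ, add_zero]

theorem exists_maximal_diff : ∃ (W : Divisor F K) (ω : (adele F K →ₗ[F] F)),
    ω ≠ 0 ∧ ω ∈ diffs W ∧ ∀ D, ω ∈ diffs D → D ≤ W := by
  have hbdd : ∀ W : Divisor F K, diffs W ≠ ⊥ → deg W ≤ 2 * genus F K := by
    intro W hW
    obtain ⟨ω, hω, h0⟩ := Submodule.exists_mem_ne_zero_of_ne_bot hW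
    have h1 := ell_le_spec hω h0 W
    have h2 := riemann (F := F) W
    have h3 : deg (0 : Divisor F K) = 0 := map_zero _
    rw [sub_self, spec, ell_zero, h3] at h1
    push_cast at h1
    linarith
  have hne : ∃ W : Divisor F K, diffs W ≠ ⊥ := by
    obtain ⟨E, -, hE⟩ := exists_deg_gt (F := F) (K := K) 2
    refine ⟨-E, fun hbot => ?_⟩
    have h1 := (finrank_diffs (-E)).2
    have h2 : deg (-E) = - deg E := map_neg _ _
    rw [hbot, finrank_bot, spec, h2] at h1
    push_cast at h1
    linarith
  obtain ⟨_, ⟨W, hW, rfl⟩, hmax⟩ := Int.exists_greatest_of_bdd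
    (P := fun d => ∃ W : Divisor F K, diffs W ≠ ⊥ ∧ deg W = d)
    ⟨2 * genus F K, by rintro _ ⟨W, hW, rfl⟩; exact hbdd W hW⟩
    (by obtain ⟨W, hW⟩ := hne; exact ⟨_, W, hW, rfl⟩)
  obtain ⟨ω, hω, h0⟩ := Submodule.exists_mem_ne_zero_of_ne_bot hW
  refine ⟨W, ω, h0, hω, fun D hD => ?_⟩
  by_contra hle
  obtain ⟨P, hP⟩ : ∃ P, W P < D P := by
    by_contra hcon
    push Not at hcon
    exact hle hcon
  have h1 : W + Finsupp.single P 1 ≤ W ⊔ D := by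
    intro Q
    rw [Finsupp.add_apply, Finsupp.sup_apply]
    by_cases hQ : Q = P
    · subst hQ
      rw [Finsupp.single_eq_same]
      exact le_sup_of_le_right hP
    · rw [Finsupp.single_eq_of_ne hQ, add_zero]
      exact le_sup_left
  have h2 : diffs (W + Finsupp.single P 1) ≠ ⊥ := by
    intro hbot
    have := diffs_anti h1 (mem_diffs_sup hω hD)
    rw [hbot] at this
    exact h0 this
  have h3 := hmax _ ⟨_, h2, rfl⟩
  rw [deg, map_add, show degHom F K (Finsupp.single P 1) = _ from deg_single P 1] at h3
  have := P.placeDegree_pos (F := F)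
  change deg W + _ ≤ deg W at h3
  omega

/-- The Riemann-Roch theorem. -/
theorem riemann_roch : ∃ W : Divisor F K, ∀ D : Divisor F K,
    (ell F D : ℤ) = deg D + 1 - genus F K + ell F (W - D) := by
  obtain ⟨W, ω, h0, hω, hmax⟩ := exists_maximal_diff (F := F) (K := K)
  refine ⟨W, fun D => ?_⟩
  have hle : (ell F (W - D) : ℤ) ≤ spec D := by
    have := ell_le_spec hω h0 (W - D)
    rwa [sub_sub_cancel] at this
  have hge : spec D ≤ ell F (W - D) := by
    rw [← (finrank_diffs D).2]
    have hsub : diffs D ≤ (RRspace F (W - D)).map (mulDualHom ω) := by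
      intro η hη
      by_cases hη0 : η = 0
      · rw [hη0]; exact Submodule.zero_mem _
      obtain ⟨f, hf, hfη⟩ := exists_eq_mulDual (diffs_anti inf_le_left hω)
        (diffs_anti (inf_le_right (a := W)) hη) h0 hη0
      refine ⟨f, ?_, hfη.symm⟩
      have h1 : ω = mulDual f⁻¹ η := by
        rw [hfη, mulDual_mul, mul_inv_cancel₀ hf, mulDual_one]
      have h2 := mulDual_mem_diffs (inv_ne_zero hf) hη
      rw [← h1] at h2
      have h3 := hmax _ h2
      rw [SetLike.mem_coe, mem_RRspace_iff hf]
      rw [pdiv_inv] at h3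
      intro P
      have := h3 P
      simp only [Finsupp.add_apply, Finsupp.sub_apply, Finsupp.neg_apply, Finsupp.coe_zero,
        Pi.zero_apply] at this ⊢
      linarith
    have h1 := Submodule.finrank_mono hsub
    have h2 := Submodule.finrank_map_le (mulDualHom ω) (RRspace F (W - D))
    unfold ell
    exact_mod_cast h1.trans h2
  have := le_antisymm hle hge
  unfold spec at this
  linarith

end Differentials
end CFF

namespace CFF

/-- Function fields in which every divisor of degree zero is principal. -/
class ClassOne (F K : Type) [Field F] [Field K] [Algebra F K] : Prop extends HasGenus F K where
  principal : ∀ D : Divisor F K, deg D = 0 → ∃ f : K, f ≠ 0 ∧ D = pdiv F f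

theorem classOne_of_classNumber {F K : Type} [Field F] [Field K] [Algebra F K] [HasGenus F K]
    (h : classNumber F K = 1) : ClassOne F K where
  principal D hD := by
    have hsub : Subsingleton (ClassGroup0 F K) := (Nat.card_eq_one_iff_unique.1 h).1
    have h1 : (principalDivisors F K).addSubgroupOf (zeroDivisors F K) = ⊤ :=
      QuotientAddGroup.subsingleton_iff.1 hsub
    have h2 : D ∈ principalDivisors F K := by
      have : (⟨D, hD⟩ : zeroDivisors F K) ∈
          (principalDivisors F K).addSubgroupOf (zeroDivisors F K) := by rw [h1]; trivial
      exact this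
    refine AddSubgroup.closure_induction (p := fun D _ => ∃ f : K, f ≠ 0 ∧ D = pdiv F f)
      ?_ ?_ ?_ ?_ h2
    · rintro E ⟨f, hf, hE⟩
      exact ⟨f, hf, Finsupp.ext hE⟩
    · refine ⟨1, one_ne_zero, ?_⟩
      ext P
      rw [pdiv_apply, P.ordAt_one]; rfl
    · rintro _ _ _ _ ⟨f, hf, rfl⟩ ⟨g, hg, rfl⟩
      exact ⟨f * g, mul_ne_zero hf hg, (pdiv_mul hf hg).symm⟩
    · rintro _ _ ⟨f, hf, rfl⟩
      exact ⟨f⁻¹, inv_ne_zero hf, (pdiv_inv f).symm⟩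

theorem ell_eq_of_deg_eq {F K : Type} [Field F] [Field K] [Algebra F K] [ClassOne F K] {D E : Divisor F K}
    (h : deg D = deg E) : ell F D = ell F E := by
  obtain ⟨f, hf, hfD⟩ := ClassOne.principal (F := F) (K := K) (D - E) (by
    rw [deg, map_sub]; exact sub_eq_zero.2 h)
  rw [← ell_add_pdiv E hf, ← hfD, add_sub_cancel]

section Counting

variable {K : Type} [Field K] [Algebra (ZMod 2) K]

variable (K) in
/-- Effective divisors of degree `n`. -/
def effSet (n : ℕ) : Set (Divisor (ZMod 2) K) := {E | 0 ≤ E ∧ deg E = n}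

variable (K) in
/-- The number of effective divisors of degree `n`. -/
def effCount (n : ℕ) : ℕ := (effSet K n).ncard

variable [ClassOne (ZMod 2) K]

theorem eq_of_pdiv_eq {f g : K} (hf : f ≠ 0) (hg : g ≠ 0)
    (h : pdiv (ZMod 2) f = pdiv (ZMod 2) g) : f = g := by
  have h1 : pdiv (ZMod 2) (f * g⁻¹) = 0 := by
    rw [pdiv_mul hf (inv_ne_zero hg), pdiv_inv, h, add_neg_cancel]
  have h2 : f * g⁻¹ ∈ RRspace (ZMod 2) (0 : Divisor (ZMod 2) K) := by
    rw [mem_RRspace_iff (mul_ne_zero hf (inv_ne_zero hg)), h1, add_zero]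
  obtain ⟨c, hc⟩ := mem_RRspace_zero.1 h2
  have hc2 : ∀ c : ZMod 2, c = 0 ∨ c = 1 := by decide
  rcases hc2 c with rfl | rfl
  · rw [map_zero] at hc
    exact absurd hc.symm (mul_ne_zero hf (inv_ne_zero hg))
  · rw [map_one] at hc
    exact (eq_mul_inv_iff_mul_eq₀ hg).1 hc ▸ (one_mul g).symm ▸ rfl

theorem effSet_eq_image {D : Divisor (ZMod 2) K} {n : ℕ} (hD : deg D = n) :
    effSet K n = (fun f : K => D + pdiv (ZMod 2) f) '' ((RRspace (ZMod 2) D : Set K) \ {0}) := by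
  ext E
  constructor
  · rintro ⟨h0, hE⟩
    obtain ⟨f, hf, hfE⟩ := ClassOne.principal (F := ZMod 2) (K := K) (E - D) (by
      rw [deg, map_sub]; exact sub_eq_zero.2 (hE.trans hD.symm))
    have hsum : D + pdiv (ZMod 2) f = E := by rw [← hfE, add_sub_cancel]
    exact ⟨f, ⟨(mem_RRspace_iff hf).2 (hsum ▸ h0), hf⟩, hsum⟩
  · rintro ⟨f, ⟨hfD, hf⟩, rfl⟩
    refine ⟨(mem_RRspace_iff hf).1 hfD, ?_⟩
    have : deg (D + pdiv (ZMod 2) f) = deg D + deg (pdiv (ZMod 2) f) := map_add _ _ _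
    rw [this, deg_pdiv, add_zero, hD]

theorem finite_RRset (D : Divisor (ZMod 2) K) : (RRspace (ZMod 2) D : Set K).Finite := by
  have : Finite (RRspace (ZMod 2) D) := Module.finite_of_finite (ZMod 2)
  exact Set.toFinite _

theorem effSet_finite (n : ℕ) : (effSet K n).Finite := by
  rcases (effSet K n).eq_empty_or_nonempty with h | ⟨D, hD⟩
  · rw [h]; exact Set.finite_empty
  · rw [effSet_eq_image hD.2]
    exact ((finite_RRset D).subset Set.sdiff_subset).image _

theorem effCount_add_one {D : Divisor (ZMod 2) K} {n : ℕ} (hD : deg D = n) :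
    effCount K n + 1 = 2 ^ ell (ZMod 2) D := by
  rw [effCount, effSet_eq_image hD, Set.InjOn.ncard_image,
    Set.ncard_sdiff_singleton_add_one (Submodule.zero_mem _) (finite_RRset D)]
  · rw [← Nat.card_coe_set_eq]
    have := Module.natCard_eq_pow_finrank (K := ZMod 2) (V := RRspace (ZMod 2) D)
    rw [Nat.card_zmod] at this
    exact this
  · rintro f ⟨-, hf⟩ g ⟨-, hg⟩ hfg
    exact eq_of_pdiv_eq hf hg (add_left_cancel hfg)

theorem finite_degree_le (n : ℕ) : {P : Place (ZMod 2) K | placeDegree (ZMod 2) P ≤ n}.Finite := by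
  have h1 : (⋃ k ∈ Finset.range (n + 1), effSet K k).Finite :=
    Set.Finite.biUnion (Finset.finite_toSet _) fun k _ => effSet_finite k
  refine Set.Finite.of_injOn (f := fun P => Finsupp.single P (1 : ℤ)) ?_ ?_ h1
  · intro P hP
    simp only [Set.mem_iUnion]
    refine ⟨placeDegree (ZMod 2) P, Finset.mem_range.2 (Nat.lt_succ_of_le hP), ?_, ?_⟩
    · simp
    · rw [deg_single, one_mul]
  · intro P _ Q _ h
    exact Finsupp.single_left_injective one_ne_zero h

variable (K) in
/-- The finite set of places of degree at most `n`. -/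
def placesLE (n : ℕ) : Finset (Place (ZMod 2) K) := (finite_degree_le n).toFinset

theorem mem_placesLE {n : ℕ} {P : Place (ZMod 2) K} :
    P ∈ placesLE K n ↔ placeDegree (ZMod 2) P ≤ n := by
  rw [placesLE, Set.Finite.mem_toFinset]; rfl

variable (K) in
/-- The number of rational points over the extension of degree `n`. -/
def pointCount (n : ℕ) : ℕ :=
  ∑ P ∈ (placesLE K n).filter fun P => placeDegree (ZMod 2) P ∣ n, placeDegree (ZMod 2) P

theorem card_multiples {d e n : ℕ} (hd : 0 < d) (h : e * d ≤ n) :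
    ((Finset.Icc 1 n).filter fun k => d ∣ k ∧ k / d ≤ e).card = e := by
  have : (Finset.Icc 1 n).filter (fun k => d ∣ k ∧ k / d ≤ e) =
      (Finset.Icc 1 e).image (fun j => j * d) := by
    ext k
    simp only [Finset.mem_filter, Finset.mem_Icc, Finset.mem_image]
    constructor
    · rintro ⟨⟨h1, h2⟩, ⟨j, rfl⟩, h4⟩
      rw [Nat.mul_div_cancel_left _ hd] at h4
      refine ⟨j, ⟨?_, h4⟩, mul_comm _ _⟩
      by_contra hj
      have : j = 0 := by omega
      subst this
      omega
    · rintro ⟨j, ⟨h1, h2⟩, rfl⟩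
      refine ⟨⟨Nat.mul_pos h1 hd, (Nat.mul_le_mul_right d h2).trans h⟩, dvd_mul_left _ _, ?_⟩
      rwa [Nat.mul_div_cancel _ hd]
  rw [this, Finset.card_image_of_injective, Nat.card_Icc, Nat.add_sub_cancel]
  intro a b hab
  exact Nat.eq_of_mul_eq_mul_right hd hab

theorem card_effSet_ge {n k : ℕ} (hk : k ≤ n) (P : Place (ZMod 2) K)
    (hP : placeDegree (ZMod 2) P ∣ k) :
    ((effSet_finite (K := K) n).toFinset.filter fun E =>
      k / placeDegree (ZMod 2) P ≤ (E P).toNat).card = effCount K (n - k) := by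
  obtain ⟨j, rfl⟩ := hP
  rw [Nat.mul_div_cancel_left _ P.placeDegree_pos, effCount,
    Set.ncard_eq_toFinset_card _ (effSet_finite _)]
  have hs : deg (Finsupp.single P (j : ℤ)) = ((placeDegree (ZMod 2) P * j : ℕ) : ℤ) := by
    rw [deg_single]; push_cast; ring
  refine Finset.card_bij' (fun E _ => E - Finsupp.single P (j : ℤ))
    (fun E _ => E + Finsupp.single P (j : ℤ)) ?_ ?_ ?_ ?_
  · intro E hE
    rw [Finset.mem_filter, Set.Finite.mem_toFinset] at hE
    rw [Set.Finite.mem_toFinset]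
    obtain ⟨⟨h0, h1⟩, h2⟩ := hE
    refine ⟨?_, ?_⟩
    · rw [sub_nonneg]
      intro Q
      by_cases hQ : Q = P
      · subst hQ
        have := h0 Q
        rw [Finsupp.coe_zero, Pi.zero_apply] at this
        rw [Finsupp.single_eq_same]
        omega
      · rw [Finsupp.single_eq_of_ne hQ]; exact h0 Q
    · have : deg (E - Finsupp.single P (j : ℤ)) = deg E - deg (Finsupp.single P (j : ℤ)) :=
        map_sub _ _ _
      rw [this, h1, hs]
      omega
  · intro E hE
    rw [Set.Finite.mem_toFinset] at hE
    rw [Finset.mem_filter, Set.Finite.mem_toFinset]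
    obtain ⟨h0, h1⟩ := hE
    refine ⟨⟨add_nonneg h0 (by simp), ?_⟩, ?_⟩
    · have : deg (E + Finsupp.single P (j : ℤ)) = deg E + deg (Finsupp.single P (j : ℤ)) :=
        map_add _ _ _
      rw [this, h1, hs]
      omega
    · have := h0 P
      rw [Finsupp.coe_zero, Pi.zero_apply] at this
      rw [Finsupp.add_apply, Finsupp.single_eq_same]
      omega
  · intro E _
    exact sub_add_cancel _ _
  · intro E _
    exact add_sub_cancel_right _ _

theorem deg_eq_sum_placesLE {n : ℕ} {E : Divisor (ZMod 2) K} (hE : E ∈ effSet K n) :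
    (∀ P ∈ placesLE K n, (E P).toNat * placeDegree (ZMod 2) P ≤ n) ∧
    n = ∑ P ∈ placesLE K n, (E P).toNat * placeDegree (ZMod 2) P := by
  obtain ⟨h0, h1⟩ := hE
  have hsub : E.support ⊆ placesLE K n := by
    intro P hP
    rw [mem_placesLE]
    have h2 : Finsupp.single P 1 ≤ E := by
      intro Q
      by_cases hQ : Q = P
      · subst hQ
        rw [Finsupp.single_eq_same]
        have := h0 Q
        rw [Finsupp.coe_zero, Pi.zero_apply] at this
        have := Finsupp.mem_support_iff.1 hP
        omega
      · rw [Finsupp.single_eq_of_ne hQ]; exact h0 Q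
    have := deg_mono h2
    rw [deg_single, h1, one_mul] at this
    exact_mod_cast this
  have h2 : n = ∑ P ∈ placesLE K n, (E P).toNat * placeDegree (ZMod 2) P := by
    have h3 : deg E = ∑ P ∈ placesLE K n, E P * (placeDegree (ZMod 2) P : ℤ) := by
      rw [deg_eq_sum]
      exact Finset.sum_subset hsub fun P _ hP => by
        rw [Finsupp.notMem_support_iff.1 hP]; exact zero_mul _
    zify
    rw [← h1, h3]
    refine Finset.sum_congr rfl fun P _ => ?_
    rw [Int.toNat_of_nonneg (h0 P)]
  refine ⟨fun P hP => ?_, h2⟩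
  conv_rhs => rw [h2]
  exact Finset.single_le_sum (f := fun P => (E P).toNat * placeDegree (ZMod 2) P)
    (fun _ _ => Nat.zero_le _) hP

theorem mul_effCount (n : ℕ) :
    n * effCount K n = ∑ k ∈ Finset.Icc 1 n, pointCount K k * effCount K (n - k) := by
  have h1 : n * effCount K n = ∑ E ∈ (effSet_finite (K := K) n).toFinset,
      ∑ P ∈ placesLE K n, ∑ k ∈ Finset.Icc 1 n,
        if placeDegree (ZMod 2) P ∣ k ∧ k / placeDegree (ZMod 2) P ≤ (E P).toNat then
          placeDegree (ZMod 2) P else 0 := by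
    rw [effCount, Set.ncard_eq_toFinset_card _ (effSet_finite _), mul_comm, ← smul_eq_mul,
      ← Finset.sum_const]
    refine Finset.sum_congr rfl fun E hE => ?_
    obtain ⟨h2, h3⟩ := deg_eq_sum_placesLE ((Set.Finite.mem_toFinset _).1 hE)
    conv_lhs => rw [h3]
    refine Finset.sum_congr rfl fun P hP => ?_
    rw [← Finset.sum_filter, Finset.sum_const, smul_eq_mul,
      card_multiples P.placeDegree_pos (h2 P hP)]
  rw [h1, Finset.sum_comm]
  have h2 : ∀ P ∈ placesLE K n, (∑ E ∈ (effSet_finite (K := K) n).toFinset,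
      ∑ k ∈ Finset.Icc 1 n,
        if placeDegree (ZMod 2) P ∣ k ∧ k / placeDegree (ZMod 2) P ≤ (E P).toNat then
          placeDegree (ZMod 2) P else 0) = ∑ k ∈ Finset.Icc 1 n,
        if placeDegree (ZMod 2) P ∣ k then placeDegree (ZMod 2) P * effCount K (n - k) else 0 := by
    intro P _
    rw [Finset.sum_comm]
    refine Finset.sum_congr rfl fun k hk => ?_
    by_cases hd : placeDegree (ZMod 2) P ∣ k
    · simp only [hd, true_and, if_true]
      rw [← Finset.sum_filter, Finset.sum_const, smul_eq_mul,
        card_effSet_ge (Finset.mem_Icc.1 hk).2 P hd, mul_comm]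
    · simp [hd]
  rw [Finset.sum_congr rfl h2, Finset.sum_comm]
  refine Finset.sum_congr rfl fun k hk => ?_
  rw [← Finset.sum_filter, pointCount, Finset.sum_mul]
  refine Finset.sum_congr ?_ fun _ _ => rfl
  ext P
  rw [Finset.mem_filter, Finset.mem_filter, mem_placesLE, mem_placesLE]
  have hk' := Finset.mem_Icc.1 hk
  constructor
  · rintro ⟨-, h⟩
    exact ⟨Nat.le_of_dvd hk'.1 h, h⟩
  · rintro ⟨h, h'⟩
    exact ⟨h.trans hk'.2, h'⟩

end Counting
end CFF

namespace CFF

section LinearDisjointness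

open Polynomial

variable {F K L κ : Type} [Field F] [Field K] [Field L] [Field κ] [Algebra F K] [Algebra F L]
  [Algebra K L] [IsScalarTower F K L] [Algebra F κ]

theorem natDegree_minpoly_eq (hc : HasExactConstants F K) {θ : L} (hθ : IsIntegral F θ) :
    (minpoly K θ).natDegree = (minpoly F θ).natDegree := by
  have hθK : IsIntegral K θ := hθ.tower_top
  have hdvd : minpoly K θ ∣ (minpoly F θ).map (algebraMap F K) := minpoly.dvd_map_of_isScalarTower F K θ
  apply le_antisymm
  · have := natDegree_le_of_dvd hdvd ((minpoly.monic hθ).map _).ne_zero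
    rwa [natDegree_map] at this
  · have hlift : minpoly K θ ∈ lifts (algebraMap F K) := by
      rw [lifts_iff_coeff_lifts]
      intro n
      have := isIntegral_coeff_of_dvd _ _ (minpoly.monic hθ) (minpoly.monic hθK) hdvd n
      exact hc _ this.isAlgebraic
    obtain ⟨q, hq, hqd, hqm⟩ := lifts_and_natDegree_eq_and_monic hlift (minpoly.monic hθK)
    rw [← hqd]
    apply natDegree_le_of_dvd _ hqm.ne_zero
    apply minpoly.dvd
    rw [← aeval_map_algebraMap K, hq, minpoly.aeval]

theorem linearIndependent_map_powerBasis (hc : HasExactConstants F K) (pb : PowerBasis F κ)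
    (σ : κ →ₐ[F] L) : LinearIndependent K fun i => σ (pb.basis i) := by
  have h1 : IsIntegral F (σ pb.gen) := pb.isIntegral_gen.map σ
  have h2 := natDegree_minpoly_eq hc h1
  rw [minpoly.algHom_eq σ σ.toRingHom.injective, pb.natDegree_minpoly] at h2
  have h3 := linearIndependent_pow (K := K) (σ pb.gen)
  have h4 := h3.comp (finCongr h2.symm) (finCongr h2.symm).injective
  convert h4 using 2 with i
  rw [pb.basis_eq_pow, map_pow]
  rfl

/-- The matrix of multiplication by `∑ xᵢ ⊗ cᵢ`. -/
def tensorMatrix {ι n A : Type} [Fintype ι] [Fintype n] [CommRing A] [Algebra F A]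
    (b : Module.Basis n F κ) (x : ι → A) (c : ι → κ) : Matrix n n A :=
  ∑ i, x i • (Algebra.leftMulMatrix b (c i)).map (algebraMap F A)

theorem tensorMatrix_apply {ι n A : Type} [Fintype ι] [Fintype n] [CommRing A] [Algebra F A]
    (b : Module.Basis n F κ) (x : ι → A) (c : ι → κ) (j l : n) : tensorMatrix b x c j l =
      ∑ i, x i * algebraMap F A (Algebra.leftMulMatrix b (c i) j l) := by
  rw [tensorMatrix, Matrix.sum_apply]
  rfl

theorem map_tensorMatrix {ι n A B : Type} [Fintype ι] [Fintype n] [CommRing A] [Algebra F A]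
    [CommRing B] [Algebra F B] (φ : A →+* B) (hφ : ∀ a, φ (algebraMap F A a) = algebraMap F B a)
    (b : Module.Basis n F κ) (x : ι → A) (c : ι → κ) :
    (tensorMatrix b x c).map φ = tensorMatrix b (φ ∘ x) c := by
  ext j l
  rw [Matrix.map_apply, tensorMatrix_apply, tensorMatrix_apply, map_sum]
  refine Finset.sum_congr rfl fun i _ => ?_
  rw [map_mul, hφ]
  rfl

theorem vecMul_tensorMatrix {ι n A : Type} [Fintype ι] [Fintype n] [CommRing A] [Algebra F A]
    (b : Module.Basis n F κ) (x : ι → A) (c : ι → κ) (T : κ →ₐ[F] A) :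
    Matrix.vecMul (fun j => T (b j)) (tensorMatrix b x c) =
      (∑ i, x i * T (c i)) • fun j => T (b j) := by
  ext l
  rw [Matrix.vecMul, dotProduct, Pi.smul_apply, smul_eq_mul, Finset.sum_mul]
  simp_rw [tensorMatrix_apply, Finset.mul_sum]
  rw [Finset.sum_comm]
  refine Finset.sum_congr rfl fun i _ => ?_
  rw [mul_assoc, ← map_mul, ← b.sum_repr (c i * b l), map_sum, Finset.mul_sum]
  refine Finset.sum_congr rfl fun j _ => ?_
  rw [map_smul, Algebra.leftMulMatrix_eq_repr_mul, Algebra.smul_def]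
  ring

theorem det_tensorMatrix_eq_zero {ι n A : Type} [Fintype ι] [Fintype n] [DecidableEq n] [CommRing A]
    [Algebra F A] (b : Module.Basis n F κ) (x : ι → A) (c : ι → κ) (T : κ →ₐ[F] A)
    (h : ∑ i, x i * T (c i) = 0) : (tensorMatrix b x c).det = 0 := by
  have h1 := vecMul_tensorMatrix b x c T
  rw [h, zero_smul] at h1
  have h2 : ∀ j, (tensorMatrix b x c).det * T (b j) = 0 := by
    intro j
    have h3 : Matrix.vecMul (Matrix.vecMul (fun j => T (b j)) (tensorMatrix b x c))
        (tensorMatrix b x c).adjugate = 0 := by rw [h1, Matrix.zero_vecMul]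
    rw [Matrix.vecMul_vecMul, Matrix.mul_adjugate, Matrix.vecMul_smul, Matrix.vecMul_one] at h3
    exact congrFun h3 j
  have h4 : (tensorMatrix b x c).det * T 1 = 0 := by
    rw [← b.sum_repr 1, map_sum, Finset.mul_sum]
    refine Finset.sum_eq_zero fun j _ => ?_
    rw [map_smul, mul_smul_comm, h2, smul_zero]
  rwa [map_one, mul_one] at h4

theorem det_tensorMatrix_ne_zero [FiniteDimensional F κ] (hc : HasExactConstants F K)
    {ι : Type} [Fintype ι] (pb : PowerBasis F κ) {v : ι → K} (hv : LinearIndependent F v)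
    {c : ι → κ} (hne : c ≠ 0) : (tensorMatrix pb.basis v c).det ≠ 0 := by
  intro hdet
  let L := AlgebraicClosure K
  let σ : κ →ₐ[F] L := IsAlgClosed.lift
  have hli : LinearIndependent K fun i => σ (pb.basis i) := linearIndependent_map_powerBasis hc pb σ
  obtain ⟨u, hu, hMu⟩ := Matrix.exists_mulVec_eq_zero_iff.2 hdet
  have hs : (∑ i, algebraMap K L (v i) * σ (c i)) ≠ 0 := by
    intro hs
    have h1 : ∑ l, (∑ i, pb.basis.repr (c i) l • v i) • σ (pb.basis l) = 0 := by
      rw [← hs]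
      have : ∀ i, algebraMap K L (v i) * σ (c i) =
          ∑ l, (pb.basis.repr (c i) l • v i) • σ (pb.basis l) := by
        intro i
        conv_lhs => rw [← pb.basis.sum_repr (c i), map_sum, Finset.mul_sum]
        refine Finset.sum_congr rfl fun l _ => ?_
        rw [map_smul, smul_assoc, mul_smul_comm, Algebra.smul_def (v i)]
      simp_rw [this]
      rw [Finset.sum_comm]
      refine Finset.sum_congr rfl fun l _ => ?_
      rw [Finset.sum_smul]
    have h2 := Fintype.linearIndependent_iff.1 hli _ h1
    apply hne
    funext i
    rw [Pi.zero_apply, ← pb.basis.repr.map_eq_zero_iff]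
    ext l
    exact Fintype.linearIndependent_iff.1 hv _ (h2 l) i
  have h1 := vecMul_tensorMatrix pb.basis (algebraMap K L ∘ v) c σ
  rw [← map_tensorMatrix (algebraMap K L) fun a => (IsScalarTower.algebraMap_apply F K L a).symm] at h1
  have h2 : dotProduct (Matrix.vecMul (fun j => σ (pb.basis j))
      ((tensorMatrix pb.basis v c).map (algebraMap K L))) (algebraMap K L ∘ u) = 0 := by
    rw [← Matrix.dotProduct_mulVec]
    have : ((tensorMatrix pb.basis v c).map (algebraMap K L)).mulVec (algebraMap K L ∘ u) = 0 := by
      ext j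
      have h3 := congrFun hMu j
      rw [← RingHom.map_mulVec, h3]
      exact map_zero _
    rw [this, dotProduct_zero]
  rw [h1, smul_dotProduct, smul_eq_mul] at h2
  have h3 : dotProduct (fun j => σ (pb.basis j)) (algebraMap K L ∘ u) = 0 :=
    (mul_eq_zero.1 h2).resolve_left hs
  apply hu
  funext j
  refine Fintype.linearIndependent_iff.1 hli u ?_ j
  rw [← h3, dotProduct]
  refine Finset.sum_congr rfl fun l _ => ?_
  rw [Algebra.smul_def, mul_comm]
  rfl

end LinearDisjointness

section Local

variable {F K : Type} [Field F] [Field K] [Algebra F K] [IsFF F K]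

/-- The ideal of functions of order at least `n`. -/
def Place.ballIdeal (P : Place F K) (n : ℤ) : Ideal P.1 where
  carrier := {a | (a : K) ∈ P.ball n}
  zero_mem' := by
    change ((0 : P.1) : K) ∈ P.ball n
    exact Submodule.zero_mem _
  add_mem' := fun {a b} ha hb => by
    change ((a + b : P.1) : K) ∈ P.ball n
    exact Submodule.add_mem _ ha hb
  smul_mem' := fun a b hb => by
    change ((a * b : P.1) : K) ∈ P.ball n
    have := P.mul_mem_ball (P.mem_ball_zero.2 a.2) hb
    rwa [zero_add] at this

theorem Place.mem_ballIdeal {P : Place F K} {n : ℤ} {a : P.1} :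
    a ∈ P.ballIdeal n ↔ (a : K) ∈ P.ball n := Iff.rfl

theorem Place.pow_mem_ball (P : Place F K) {n : ℤ} {f : K} (hf : f ∈ P.ball n) (k : ℕ) :
    f ^ k ∈ P.ball (k * n) := by
  induction k with
  | zero => simpa using P.mem_ball_zero.2 P.1.one_mem
  | succ k ih =>
    rw [pow_succ]
    have := P.mul_mem_ball ih hf
    have h2 : ((k + 1 : ℕ) : ℤ) * n = k * n + n := by push_cast; ring
    rwa [h2]

theorem Place.exists_ordAt_eq (P : Place F K) (n : ℤ) : ∃ f : K, f ≠ 0 ∧ ordAt P.1 f = n := by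
  obtain ⟨π, hπ, h1⟩ := P.exists_ordAt_eq_one
  rcases le_total 0 n with h | h
  · refine ⟨π ^ n.toNat, pow_ne_zero _ hπ, ?_⟩
    rw [P.ordAt_pow, h1, mul_one, Int.toNat_of_nonneg h]
  · refine ⟨(π ^ (-n).toNat)⁻¹, inv_ne_zero (pow_ne_zero _ hπ), ?_⟩
    rw [P.ordAt_inv, P.ordAt_pow, h1, mul_one, Int.toNat_of_nonneg (by omega), neg_neg]

end Local

section Frobenius

variable {K : Type} [Field K] [Algebra (ZMod 2) K]

theorem Place.charP_two (P : Place (ZMod 2) K) : CharP P.1 2 := by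
  have : CharP K 2 := charP_of_injective_algebraMap (algebraMap (ZMod 2) K).injective 2
  exact (P.1.subtype.charP_iff Subtype.val_injective 2).2 this

/-- The lift of Frobenius powers of residues modulo a power of the maximal ideal. -/
theorem Place.exists_frobLift [IsFF (ZMod 2) K] (P : Place (ZMod 2) K) (ν : ℕ) :
    ∃ T : P.ResField →ₐ[ZMod 2] (P.1 ⧸ P.ballIdeal (2 ^ ν)), ∀ a : P.1,
      T (IsLocalRing.residue P.1 a) = Ideal.Quotient.mk (P.ballIdeal (2 ^ ν)) (a ^ 2 ^ ν) := by
  have hchar : CharP P.1.toSubring 2 := P.charP_two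
  have : ExpChar P.1.toSubring 2 := ExpChar.prime Nat.prime_two
  let ψ : P.1 →+* P.1 := iterateFrobenius P.1.toSubring 2 ν
  have hψ : ∀ a : P.1, ψ a = a ^ 2 ^ ν := fun a => iterateFrobenius_def (R := P.1.toSubring) 2 ν a
  let φ : P.1 →+* (P.1 ⧸ P.ballIdeal (2 ^ ν)) := (Ideal.Quotient.mk _).comp ψ
  have hφ' : ∀ a, φ a = Ideal.Quotient.mk _ (a ^ 2 ^ ν) := fun a => by
    rw [← hψ]; exact RingHom.comp_apply _ _ _
  have hφ : ∀ a ∈ IsLocalRing.maximalIdeal P.1, φ a = 0 := by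
    intro a ha
    rw [← IsLocalRing.residue_eq_zero_iff, ← P.mem_ball_one_iff_residue] at ha
    rw [hφ', Ideal.Quotient.eq_zero_iff_mem, Place.mem_ballIdeal]
    have := P.pow_mem_ball ha (2 ^ ν)
    rw [mul_one, Nat.cast_pow, Nat.cast_ofNat] at this
    exact this
  let T : P.ResField →+* (P.1 ⧸ P.ballIdeal (2 ^ ν)) := Ideal.Quotient.lift _ φ hφ
  refine ⟨⟨T, fun r => ?_⟩, fun a => ?_⟩
  · exact congrArg (fun f : ZMod 2 →+* (P.1 ⧸ P.ballIdeal (2 ^ ν)) => f r)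
      (Subsingleton.elim (T.comp (algebraMap (ZMod 2) P.ResField)) (algebraMap (ZMod 2) _))
  · rw [← hφ']
    exact Ideal.Quotient.lift_mk _ φ hφ

theorem det_tensorMatrix_mem_ball [IsFF (ZMod 2) K] {ι n : Type} [Fintype ι] [Fintype n]
    [DecidableEq n]
    (P : Place (ZMod 2) K) (b : Module.Basis n (ZMod 2) P.ResField) (ν : ℕ) (v w : ι → P.1)
    (hsum : ∑ i, v i * w i ^ 2 ^ ν = 0) :
    (tensorMatrix b (fun i => (v i : K)) fun i => IsLocalRing.residue P.1 (w i)).det ∈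
      P.ball (2 ^ ν) := by
  set I := P.ballIdeal (2 ^ ν) with hI
  obtain ⟨T, hT⟩ : ∃ T : P.ResField →ₐ[ZMod 2] (P.1 ⧸ I), ∀ a : P.1,
      T (IsLocalRing.residue P.1 a) = Ideal.Quotient.mk I (a ^ 2 ^ ν) := P.exists_frobLift ν
  set c := fun i => IsLocalRing.residue P.1 (w i) with hc
  have h1 : (tensorMatrix b (Ideal.Quotient.mk I ∘ v) c).det = 0 := by
    apply det_tensorMatrix_eq_zero _ _ _ T
    have h3 := congrArg (Ideal.Quotient.mk I) hsum
    rw [map_sum, map_zero] at h3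
    rw [← h3]
    refine Finset.sum_congr rfl fun i _ => ?_
    rw [map_mul]
    exact congrArg _ (hT _)
  have h4 : ∀ a, Ideal.Quotient.mk I (algebraMap (ZMod 2) P.1 a) = algebraMap (ZMod 2) (P.1 ⧸ I) a :=
    fun a => rfl
  rw [← map_tensorMatrix (Ideal.Quotient.mk I) h4, ← RingHom.mapMatrix_apply, ← RingHom.map_det,
    Ideal.Quotient.eq_zero_iff_mem, hI, Place.mem_ballIdeal] at h1
  have h2 := RingHom.map_det P.1.subtype (tensorMatrix b v c)
  have h5 : ∀ a, P.1.subtype (algebraMap (ZMod 2) P.1 a) = algebraMap (ZMod 2) K a := fun a => rfl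
  rw [RingHom.mapMatrix_apply, map_tensorMatrix _ h5] at h2
  have h6 : (P.1.subtype (tensorMatrix b v c).det : K) ∈ P.ball (2 ^ ν) := h1
  rw [h2] at h6
  exact h6

theorem det_tensorMatrix_mem_RRspace [IsFF (ZMod 2) K] {κ ι : Type} [Field κ] [Algebra (ZMod 2) κ]
    [Fintype ι] {n : ℕ} (b : Module.Basis (Fin n) (ZMod 2) κ) {E : Divisor (ZMod 2) K} {v : ι → K}
    (hv : ∀ i, v i ∈ RRspace (ZMod 2) E) (c : ι → κ) :
    (tensorMatrix b v c).det ∈ RRspace (ZMod 2) (n • E) := by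
  rw [Matrix.det_apply]
  have hentry : ∀ j l, tensorMatrix b v c j l ∈ RRspace (ZMod 2) E := by
    intro j l
    rw [tensorMatrix_apply]
    refine Submodule.sum_mem _ fun i _ => ?_
    rw [mul_comm, ← Algebra.smul_def]
    exact Submodule.smul_mem _ _ (hv i)
  have hprod : ∀ (s : Equiv.Perm (Fin n)) (S : Finset (Fin n)),
      ∏ j ∈ S, tensorMatrix b v c (s j) j ∈ RRspace (ZMod 2) (S.card • E) := by
    intro s S
    induction S using Finset.induction_on with
    | empty =>
      rw [Finset.prod_empty, Finset.card_empty, zero_smul, mem_RRspace_zero]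
      exact ⟨1, map_one _⟩
    | insert j S hj ih =>
      rw [Finset.prod_insert hj, Finset.card_insert_of_notMem hj, add_smul, one_smul, add_comm]
      exact mul_mem_RRspace (hentry _ _) ih
  refine Submodule.sum_mem _ fun s _ => ?_
  have := hprod s Finset.univ
  rw [Finset.card_univ, Fintype.card_fin] at this
  rw [Units.smul_def]
  exact zsmul_mem this _

theorem frobenius_independent_aux [HasGenus (ZMod 2) K] {ι : Type} [Fintype ι]
    (P : Place (ZMod 2) K) {E : Divisor (ZMod 2) K} (hEP : E P = 0) {ν : ℕ} {v w : ι → K}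
    (hv : ∀ i, v i ∈ RRspace (ZMod 2) E) (hli : LinearIndependent (ZMod 2) v)
    (hE : deg E < 2 ^ ν) (hw : ∀ i, w i ∈ P.1) (i₀ : ι) (hi₀ : w i₀ = 1) :
    ∑ i, v i * w i ^ 2 ^ ν ≠ 0 := by
  intro hsum
  have hfin := P.finite_resField (F := ZMod 2)
  have hperf : Finite P.ResField := Module.finite_of_finite (ZMod 2)
  let pb := Field.powerBasisOfFiniteOfSeparable (ZMod 2) P.ResField
  let w' : ι → P.1 := fun i => ⟨w i, hw i⟩
  have hc : (fun i => IsLocalRing.residue P.1 (w' i)) ≠ 0 := by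
    intro h
    have h1 := congrFun h i₀
    have h2 : w' i₀ = 1 := Subtype.ext hi₀
    rw [h2, map_one] at h1
    exact one_ne_zero h1
  have hvO : ∀ i, v i ∈ P.1 := by
    intro i
    have := mem_RRspace.1 (hv i) P
    rwa [hEP, neg_zero, P.mem_ball_zero] at this
  have hne := det_tensorMatrix_ne_zero (IsFF.const (F := ZMod 2) (K := K)) pb hli hc
  have hP := det_tensorMatrix_mem_ball P pb.basis ν (fun i => ⟨v i, hvO i⟩) w' <| by
    apply Subtype.val_injective
    change P.1.subtype (∑ i, _) = P.1.subtype 0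
    rw [map_sum, map_zero, ← hsum]
    refine Finset.sum_congr rfl fun i _ => ?_
    rw [map_mul, map_pow]
    rfl
  have hpole := det_tensorMatrix_mem_RRspace pb.basis hv fun i => IsLocalRing.residue P.1 (w' i)
  have hmem : (tensorMatrix pb.basis v fun i => IsLocalRing.residue P.1 (w' i)).det ∈
      RRspace (ZMod 2) (pb.dim • E - Finsupp.single P (2 ^ ν)) := by
    rw [mem_RRspace] at hpole ⊢
    intro Q
    by_cases hQ : Q = P
    · subst hQ
      rw [Finsupp.sub_apply, Finsupp.smul_apply, hEP, smul_zero, zero_sub, neg_neg,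
        Finsupp.single_eq_same]
      exact hP
    · have := hpole Q
      rw [Finsupp.sub_apply, Finsupp.single_eq_of_ne hQ, sub_zero]
      exact this
  refine hne (eq_zero_of_deg_neg ?_ hmem)
  have h1 : deg (pb.dim • E - Finsupp.single P (2 ^ ν)) =
      pb.dim • deg E - deg (Finsupp.single P (2 ^ ν)) := by
    rw [deg, map_sub, map_nsmul]
  have h2 : placeDegree (ZMod 2) P = pb.dim := by rw [P.placeDegree_eq, pb.finrank]
  rw [h1, deg_single, h2, nsmul_eq_mul]
  have h3 : (0 : ℤ) < pb.dim := by exact_mod_cast pb.dim_pos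
  nlinarith

/-- Linear independence over the field of `2 ^ ν`-th powers. -/
theorem frobenius_independent [HasGenus (ZMod 2) K] {ι : Type} [Fintype ι]
    {E : Divisor (ZMod 2) K} {ν : ℕ} {v w : ι → K}
    (hv : ∀ i, v i ∈ RRspace (ZMod 2) E) (hli : LinearIndependent (ZMod 2) v)
    (hE : deg E < 2 ^ ν) (hsum : ∑ i, v i * w i ^ 2 ^ ν = 0) : w = 0 := by
  by_contra hw
  obtain ⟨P⟩ := exists_place (F := ZMod 2) (K := K)
  obtain ⟨f, hf, hfE⟩ := P.exists_ordAt_eq (E P)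
  have hne : (Finset.univ.filter fun i => w i ≠ 0).Nonempty := by
    obtain ⟨i, hi⟩ := Function.ne_iff.1 hw
    exact ⟨i, by simpa using hi⟩
  obtain ⟨i₀, hi₀, hmin⟩ := Finset.exists_min_image _ (fun i => ordAt P.1 (w i)) hne
  rw [Finset.mem_filter] at hi₀
  have h0 := hi₀.2
  refine frobenius_independent_aux P (E := E - pdiv (ZMod 2) f) (v := fun i => f * v i)
    (w := fun i => w i * (w i₀)⁻¹) (ν := ν) ?_ ?_ ?_ ?_ ?_ i₀ (mul_inv_cancel₀ h0) ?_
  · rw [Finsupp.sub_apply, pdiv_apply, hfE, sub_self]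
  · intro i
    rw [mul_mem_RRspace_iff hf, sub_add_cancel]
    exact hv i
  · have := hli.map' (LinearMap.mulLeft (ZMod 2) f) (LinearMap.ker_eq_bot.2 (mul_right_injective₀ hf))
    exact this
  · have : deg (E - pdiv (ZMod 2) f) = deg E - deg (pdiv (ZMod 2) f) := map_sub _ _ _
    rw [this, deg_pdiv, sub_zero]
    exact hE
  · intro i
    by_cases hi : w i = 0
    · rw [hi, zero_mul]; exact P.1.zero_mem
    · rw [← P.ordAt_nonneg_iff (mul_ne_zero hi (inv_ne_zero h0)),
        P.ordAt_mul hi (inv_ne_zero h0), P.ordAt_inv]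
      have := hmin i (by simpa using hi)
      omega
  · have : ∀ i, f * v i * (w i * (w i₀)⁻¹) ^ 2 ^ ν =
        (f * ((w i₀)⁻¹) ^ 2 ^ ν) * (v i * w i ^ 2 ^ ν) := by intro i; rw [mul_pow]; ring
    simp_rw [this]
    rw [← Finset.mul_sum, hsum, mul_zero]

end Frobenius
end CFF

namespace CFF

theorem pow_mem_RRspace {F K : Type} [Field F] [Field K] [Algebra F K] [IsFF F K]
    {E : Divisor F K} {f : K} (hf : f ∈ RRspace F E) (k : ℕ) : f ^ k ∈ RRspace F (k • E) := by
  induction k with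
  | zero => rw [pow_zero, zero_smul, mem_RRspace_zero]; exact ⟨1, map_one _⟩
  | succ k ih => rw [pow_succ, add_smul, one_smul]; exact mul_mem_RRspace ih hf

section Stepanov

variable {K : Type} [Field K] [Algebra (ZMod 2) K]

theorem zmod_two_pow (c : ZMod 2) (n : ℕ) : c ^ 2 ^ n = c := by
  have := ZMod.pow_card_pow (p := 2) (n := n) c
  exact this

theorem sum_pow_two_pow {A ι : Type} [CommRing A] [CharP A 2] (s : Finset ι) (f : ι → A) (n : ℕ) :
    (∑ i ∈ s, f i) ^ 2 ^ n = ∑ i ∈ s, f i ^ 2 ^ n := by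
  have : ExpChar A 2 := ExpChar.prime Nat.prime_two
  exact sum_pow_char_pow 2 n s f

theorem smul_pow_two_pow {A : Type} [CommRing A] [Algebra (ZMod 2) A] (c : ZMod 2) (a : A) (n : ℕ) :
    (c • a) ^ 2 ^ n = c • a ^ 2 ^ n := by
  rw [smul_pow, zmod_two_pow]

instance charP_two_of_field : CharP K 2 :=
  charP_of_injective_algebraMap (algebraMap (ZMod 2) K).injective 2

theorem Place.residue_pow_eq [IsFF (ZMod 2) K] (P : Place (ZMod 2) K) {n : ℕ}
    (h : placeDegree (ZMod 2) P ∣ n) (a : P.ResField) : a ^ 2 ^ n = a := by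
  have hfin := P.finite_resField (F := ZMod 2)
  have hfin' : Finite P.ResField := Module.finite_of_finite (ZMod 2)
  have := Fintype.ofFinite P.ResField
  obtain ⟨k, rfl⟩ := h
  have hc : Fintype.card P.ResField = 2 ^ placeDegree (ZMod 2) P := by
    rw [← Nat.card_eq_fintype_card, Module.natCard_eq_pow_finrank (K := ZMod 2), Nat.card_zmod,
      P.placeDegree_eq]
  rw [pow_mul, ← hc]
  exact FiniteField.pow_card_pow k a

/-- A nonzero function vanishing on a finite set of places bounds the degree of this set. -/
theorem sum_placeDegree_le [HasGenus (ZMod 2) K] {E : Divisor (ZMod 2) K} {u : K} (hu : u ≠ 0)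
    (hE : u ∈ RRspace (ZMod 2) E) (S : Finset (Place (ZMod 2) K))
    (hS : ∀ P ∈ S, E P = 0 ∧ u ∈ P.ball 1) :
    (∑ P ∈ S, placeDegree (ZMod 2) P : ℤ) ≤ deg E := by
  by_contra! hlt
  have hmem : u ∈ RRspace (ZMod 2) (E - ∑ P ∈ S, Finsupp.single P 1) := by
    rw [mem_RRspace]
    intro P
    have hval : (∑ Q ∈ S, Finsupp.single Q (1 : ℤ)) P = if P ∈ S then 1 else 0 := by
      rw [Finsupp.finsetSum_apply]
      simp [Finsupp.single_apply]
    rw [Finsupp.sub_apply, hval]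
    split_ifs with h
    · rw [(hS P h).1]
      simpa using (hS P h).2
    · rw [sub_zero]
      exact mem_RRspace.1 hE P
  refine hu (eq_zero_of_deg_neg ?_ hmem)
  have h1 : deg (E - ∑ P ∈ S, Finsupp.single P 1) = deg E - ∑ P ∈ S, deg (Finsupp.single P 1) := by
    rw [deg, map_sub, map_sum]
  rw [h1]
  simp_rw [deg_single, one_mul]
  linarith

theorem Place.pow_mem_ball_one [IsFF (ZMod 2) K] (P : Place (ZMod 2) K) {u : K} {k : ℕ}
    (h : u ^ k ∈ P.ball 1) : u ∈ P.ball 1 := by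
  rw [P.mem_ball_one] at h ⊢
  rw [map_pow] at h
  by_contra! h1
  exact absurd h (not_lt.2 (one_le_pow₀ h1))

/-- The auxiliary function in Stepanov's method. -/
theorem exists_stepanov_function [HasGenus (ZMod 2) K] (E E' : Divisor (ZMod 2) K) (μ ν : ℕ)
    (hE : deg E < 2 ^ ν)
    (hlt : ell (ZMod 2) (2 ^ μ • E + E') < ell (ZMod 2) E * ell (ZMod 2) E') :
    ∃ (ι : Type) (_ : Fintype ι) (v w : ι → K), (∀ i, v i ∈ RRspace (ZMod 2) E) ∧
      (∀ i, w i ∈ RRspace (ZMod 2) E') ∧ ∑ i, v i ^ 2 ^ μ * w i = 0 ∧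
      ∑ i, v i * w i ^ 2 ^ ν ≠ 0 := by
  let bv := Module.finBasis (ZMod 2) (RRspace (ZMod 2) E)
  let bs := Module.finBasis (ZMod 2) (RRspace (ZMod 2) E')
  let v : Fin (Module.finrank (ZMod 2) (RRspace (ZMod 2) E)) → K := fun i => bv i
  let s : Fin (Module.finrank (ZMod 2) (RRspace (ZMod 2) E')) → K := fun i => bs i
  have hv : LinearIndependent (ZMod 2) v :=
    bv.linearIndependent.map' (Submodule.subtype _) (Submodule.ker_subtype _)
  have hs : LinearIndependent (ZMod 2) s :=
    bs.linearIndependent.map' (Submodule.subtype _) (Submodule.ker_subtype _)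
  let Φ := Fintype.linearCombination (ZMod 2)
    (fun p : Fin _ × Fin _ => v p.1 ^ 2 ^ μ * s p.2)
  have hmem : ∀ c, Φ c ∈ RRspace (ZMod 2) (2 ^ μ • E + E') := by
    intro c
    rw [Fintype.linearCombination_apply]
    exact Submodule.sum_mem _ fun p _ => Submodule.smul_mem _ _
      (mul_mem_RRspace (pow_mem_RRspace (bv _).2 _) (bs _).2)
  let Ψ := Φ.codRestrict _ hmem
  have hker : LinearMap.ker Ψ ≠ ⊥ := by
    apply LinearMap.ker_ne_bot_of_finrank_lt
    rw [Module.finrank_fintype_fun_eq_card, Fintype.card_prod, Fintype.card_fin, Fintype.card_fin]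
    exact hlt
  obtain ⟨c, hc, hc0⟩ := Submodule.exists_mem_ne_zero_of_ne_bot hker
  have hΦ : Φ c = 0 := congrArg Subtype.val (LinearMap.mem_ker.1 hc)
  refine ⟨_, inferInstance, v, fun i => ∑ j, c (i, j) • s j, fun i => (bv i).2,
    fun i => Submodule.sum_mem _ fun j _ => Submodule.smul_mem _ _ (bs j).2, ?_, ?_⟩
  · rw [← hΦ, Fintype.linearCombination_apply, Fintype.sum_prod_type]
    refine Finset.sum_congr rfl fun i _ => ?_
    rw [Finset.mul_sum]
    exact Finset.sum_congr rfl fun j _ => mul_smul_comm _ _ _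
  · intro h
    have := frobenius_independent (fun i => (bv i).2) hv hE h
    apply hc0
    funext p
    exact Fintype.linearIndependent_iff.1 hs (fun j => c (p.1, j)) (congrFun this p.1) p.2

theorem pointCount_le_of_ell_lt [ClassOne (ZMod 2) K] (E E' : Divisor (ZMod 2) K)
    (P₀ : Place (ZMod 2) K) (hP : ∀ P, P ≠ P₀ → E P = 0 ∧ E' P = 0) (μ ν : ℕ)
    (hE : deg E < 2 ^ ν)
    (hlt : ell (ZMod 2) (2 ^ μ • E + E') < ell (ZMod 2) E * ell (ZMod 2) E') :
    (pointCount K (μ + ν) : ℤ) ≤ placeDegree (ZMod 2) P₀ + deg E + 2 ^ ν * deg E' := by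
  obtain ⟨ι, _, v, w, hv, hw, h0, hne⟩ := exists_stepanov_function E E' μ ν hE hlt
  set u := ∑ i, v i * w i ^ 2 ^ ν with hu
  set T := (placesLE K (μ + ν)).filter (placeDegree (ZMod 2) · ∣ (μ + ν)) with hT
  have hmem : u ∈ RRspace (ZMod 2) (E + 2 ^ ν • E') :=
    Submodule.sum_mem _ fun i _ => mul_mem_RRspace (hv i) (pow_mem_RRspace (hw i) _)
  have hdeg : deg (E + 2 ^ ν • E') = deg E + 2 ^ ν * deg E' := by
    rw [deg, map_add, map_nsmul, nsmul_eq_mul]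
    push_cast
    rfl
  have hbound := sum_placeDegree_le hne hmem (T.erase P₀) fun P hPT => by
    have hPne : P ≠ P₀ := (Finset.mem_erase.1 hPT).1
    have hdvd : placeDegree (ZMod 2) P ∣ μ + ν :=
      (Finset.mem_filter.1 (Finset.mem_erase.1 hPT).2).2
    obtain ⟨h1, h2⟩ := hP P hPne
    refine ⟨by rw [Finsupp.add_apply, Finsupp.smul_apply, h1, h2, smul_zero, add_zero], ?_⟩
    apply P.pow_mem_ball_one (k := 2 ^ μ)
    have hvO : ∀ i, v i ∈ P.1 := fun i => by
      have := mem_RRspace.1 (hv i) P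
      rwa [h1, neg_zero, P.mem_ball_zero] at this
    have hwO : ∀ i, w i ∈ P.1 := fun i => by
      have := mem_RRspace.1 (hw i) P
      rwa [h2, neg_zero, P.mem_ball_zero] at this
    let v' : ι → P.1 := fun i => ⟨v i, hvO i⟩
    let w' : ι → P.1 := fun i => ⟨w i, hwO i⟩
    have h3 : ((∑ i, v' i ^ 2 ^ μ * w' i ^ 2 ^ (μ + ν) : P.1) : K) = u ^ 2 ^ μ := by
      change P.1.subtype _ = _
      rw [map_sum, hu, sum_pow_two_pow]
      refine Finset.sum_congr rfl fun i _ => ?_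
      rw [map_mul, map_pow, map_pow, mul_pow, ← pow_mul, ← pow_add, add_comm ν]
      rfl
    have h4 : (∑ i, v' i ^ 2 ^ μ * w' i : P.1) = 0 := by
      apply Subtype.val_injective
      change P.1.subtype _ = P.1.subtype 0
      rw [map_sum, map_zero, ← h0]
      refine Finset.sum_congr rfl fun i _ => ?_
      rw [map_mul, map_pow]
      rfl
    rw [← h3, P.mem_ball_one_iff_residue, map_sum, ← map_zero (IsLocalRing.residue P.1), ← h4,
      map_sum]
    refine Finset.sum_congr rfl fun i _ => ?_
    rw [map_mul, map_mul, map_pow _ (w' i)]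
    exact congrArg _ (P.residue_pow_eq hdvd _)
  have hle : ∑ P ∈ T, placeDegree (ZMod 2) P ≤
      placeDegree (ZMod 2) P₀ + ∑ P ∈ T.erase P₀, placeDegree (ZMod 2) P := by
    by_cases h : P₀ ∈ T
    · rw [Finset.add_sum_erase T _ h]
    · rw [Finset.erase_eq_of_notMem h]; omega
  have hle' : (pointCount K (μ + ν) : ℤ) ≤
      placeDegree (ZMod 2) P₀ + ∑ P ∈ T.erase P₀, (placeDegree (ZMod 2) P : ℤ) := by
    rw [pointCount]
    exact_mod_cast hle
  rw [hdeg] at hbound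
  linarith

/-- The upper bound for the number of points. -/
theorem exists_pointCount_le (K : Type) [Field K] [Algebra (ZMod 2) K] [ClassOne (ZMod 2) K] :
    ∃ C n₀ : ℕ, ∀ n ≥ n₀,
      (pointCount K n : ℤ) ≤ 2 ^ n + C * 2 ^ ((n + 1) / 2) := by
  obtain ⟨P₀⟩ := exists_place (F := ZMod 2) (K := K)
  set d := placeDegree (ZMod 2) P₀ with hd
  have hd0 : 0 < d := P₀.placeDegree_pos
  set g := genus (ZMod 2) K with hg
  refine ⟨2 * g + 2 * d + 2, 2 * ((g + 1) * d + g * (g + 2) + 1), fun n hn => ?_⟩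
  set μ := n / 2 with hμ
  set ν := (n + 1) / 2 with hν
  have hn' : n = μ + ν := by omega
  have hμν : μ ≤ ν := by omega
  have hQM : 2 ^ μ ≤ 2 ^ ν := Nat.pow_le_pow_right (by norm_num) hμν
  have hbig : (g + 1) * d + g * (g + 2) + 1 ≤ ν := by omega
  have hνlt : ν < 2 ^ ν := Nat.lt_two_pow_self
  set Q := 2 ^ ν with hQ
  set M := 2 ^ μ with hM
  have hqQ : 2 ^ n = M * Q := by rw [hn', pow_add]
  set a := (Q - 1) / d with ha
  set b := (M + 2 * g) / d + 1 with hb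
  have ha1 : a * d ≤ Q - 1 := Nat.div_mul_le_self _ _
  have ha2 : Q - 1 < (a + 1) * d := by
    have := Nat.lt_div_mul_add hd0 (a := Q - 1)
    rw [← ha] at this; linarith
  have hb1 : b * d ≤ M + 2 * g + d := by
    have := Nat.div_mul_le_self (M + 2 * g) d
    rw [hb, add_mul]; linarith
  have hb2 : M + 2 * g < b * d := by
    have := Nat.lt_div_mul_add hd0 (a := M + 2 * g)
    rw [hb, add_mul]; linarith
  have hXd : deg (Finsupp.single P₀ (a : ℤ) : Divisor (ZMod 2) K) = a * d := deg_single P₀ a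
  have hYd : deg (Finsupp.single P₀ (b : ℤ) : Divisor (ZMod 2) K) = b * d := deg_single P₀ b
  set X : ℕ := a * d with hX
  set Y : ℕ := b * d with hY
  have hkey : ell (ZMod 2) (M • (Finsupp.single P₀ (a : ℤ) : Divisor (ZMod 2) K) +
      Finsupp.single P₀ (b : ℤ)) < ell (ZMod 2) (Finsupp.single P₀ (a : ℤ) : Divisor (ZMod 2) K) *
      ell (ZMod 2) (Finsupp.single P₀ (b : ℤ) : Divisor (ZMod 2) K) := by
    have h1 := riemann (Finsupp.single P₀ (a : ℤ) : Divisor (ZMod 2) K)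
    have h2 := riemann (Finsupp.single P₀ (b : ℤ) : Divisor (ZMod 2) K)
    have hdd : deg (M • (Finsupp.single P₀ (a : ℤ) : Divisor (ZMod 2) K) +
        Finsupp.single P₀ (b : ℤ)) = M * X + Y := by
      rw [deg, map_add, map_nsmul, nsmul_eq_mul]
      have e1 : degHom (ZMod 2) K (Finsupp.single P₀ (a : ℤ)) = a * d := hXd
      have e2 : degHom (ZMod 2) K (Finsupp.single P₀ (b : ℤ)) = b * d := hYd
      rw [e1, e2, hX, hY]; push_cast; ring
    have h3 := ell_le (M • (Finsupp.single P₀ (a : ℤ) : Divisor (ZMod 2) K) +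
      Finsupp.single P₀ (b : ℤ)) (by rw [hdd]; positivity)
    rw [hdd] at h3
    rw [hXd, ← hg] at h1
    rw [hYd, ← hg] at h2
    have hX' : (X : ℤ) = a * d := by rw [hX]; push_cast; ring
    have hY' : (Y : ℤ) = b * d := by rw [hY]; push_cast; ring
    rw [← hX'] at h1
    rw [← hY'] at h2
    zify
    have hXQ : (Q : ℤ) - d ≤ X := by
      have : Q ≤ X + d := by rw [add_mul, one_mul] at ha2; omega
      zify at this; linarith
    have hYM : (M : ℤ) + 2 * g + 1 ≤ Y := by exact_mod_cast hb2
    have hQb : ((g + 1) * d + g * (g + 2) + 1 : ℤ) < Q := by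
      have : (g + 1) * d + g * (g + 2) + 1 < Q := by omega
      exact_mod_cast this
    have hMQ : (M : ℤ) ≤ Q := by exact_mod_cast hQM
    have hXg : (0 : ℤ) ≤ X + 1 - g := by nlinarith
    have hprod : ((X : ℤ) + 1 - g) * (Y + 1 - g) ≤
        ell (ZMod 2) (Finsupp.single P₀ (a : ℤ) : Divisor (ZMod 2) K) *
        ell (ZMod 2) (Finsupp.single P₀ (b : ℤ) : Divisor (ZMod 2) K) :=
      mul_le_mul (by linarith) (by linarith) (by nlinarith) (by positivity)
    refine lt_of_le_of_lt h3 (lt_of_lt_of_le ?_ hprod)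
    obtain ⟨t, ht, hYt⟩ : ∃ t : ℤ, 0 ≤ t ∧ (Y : ℤ) = M + 2 * g + 1 + t :=
      ⟨Y - (M + 2 * g + 1), by linarith, by ring⟩
    have hg0 : (0 : ℤ) ≤ g := by positivity
    have hd1 : (0 : ℤ) ≤ d := by positivity
    have k1 : (g + 2 : ℤ) * (Q - d) ≤ (g + 2) * X := mul_le_mul_of_nonneg_left hXQ (by linarith)
    have k2 : (g : ℤ) * M ≤ g * Q := mul_le_mul_of_nonneg_left hMQ hg0
    have k4 : (0 : ℤ) ≤ g * d := mul_nonneg hg0 hd1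
    have k5 : (0 : ℤ) ≤ g * g := mul_nonneg hg0 hg0
    have k3 : 0 ≤ t * (X - g) := mul_nonneg ht (by nlinarith)
    rw [hYt]
    nlinarith
  have hmain := pointCount_le_of_ell_lt (Finsupp.single P₀ (a : ℤ)) (Finsupp.single P₀ (b : ℤ))
    P₀ (fun P hP => ⟨Finsupp.single_eq_of_ne hP, Finsupp.single_eq_of_ne hP⟩) μ ν
    (by rw [hXd]; have : X < Q := by omega
        exact_mod_cast this) hkey
  rw [← hn', hXd, hYd] at hmain
  have e1 : (X : ℤ) = a * d := by rw [hX]; push_cast; ring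
  have e2 : (Y : ℤ) = b * d := by rw [hY]; push_cast; ring
  have e3 : ((2 : ℤ) ^ n) = M * Q := by exact_mod_cast hqQ
  have e4 : ((2 : ℤ) ^ ν) = Q := by rw [hQ]; push_cast; rfl
  rw [← e1, ← e2, e4] at hmain
  rw [e3, e4]
  have f1 : (X : ℤ) ≤ Q := by exact_mod_cast (show X ≤ Q by omega)
  have f2 : (Y : ℤ) ≤ M + 2 * g + d := by exact_mod_cast hb1
  have f3 : (1 : ℤ) ≤ Q := by exact_mod_cast Nat.one_le_two_pow
  have f4 : (0 : ℤ) ≤ d := by positivity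
  push_cast
  nlinarith [mul_le_mul_of_nonneg_left f2 (show (0 : ℤ) ≤ Q by linarith)]

end Stepanov
end CFF

namespace CFF

section PlaneModel

open Polynomial

variable {F K : Type} [Field F] [Field K] [Algebra F K]

/-- Evaluation of a bivariate polynomial. -/
def biEval (F : Type) {A : Type} [Field F] [CommRing A] [Algebra F A] (x y : A) : F[X][X] →+* A :=
  eval₂RingHom (aeval x : F[X] →ₐ[F] A).toRingHom y

section

variable {A B : Type} [CommRing A] [CommRing B] [Algebra F A] [Algebra F B] (x y : A)

theorem biEval_eq_sum (h : F[X][X]) :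
    biEval F x y h = ∑ i ∈ Finset.range (h.natDegree + 1), aeval x (h.coeff i) * y ^ i := by
  rw [biEval, coe_eval₂RingHom, eval₂_eq_sum_range]
  rfl

theorem biEval_C (p : F[X]) : biEval F x y (C p) = aeval x p := by
  rw [biEval, coe_eval₂RingHom, eval₂_C]
  rfl

theorem biEval_X : biEval F x y X = y := by
  rw [biEval, coe_eval₂RingHom, eval₂_X]

theorem map_biEval (φ : A →ₐ[F] B) (h : F[X][X]) :
    φ (biEval F x y h) = biEval F (φ x) (φ y) h := by
  rw [biEval_eq_sum, biEval_eq_sum, map_sum]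
  refine Finset.sum_congr rfl fun i _ => ?_
  rw [map_mul, map_pow, aeval_algHom_apply]

end

/-- A separable plane model of a function field. -/
structure IsPlaneModel (x y : K) (G : F[X][X]) : Prop where
  transcendental : Transcendental F x
  monic : G.Monic
  eval_eq_zero : biEval F x y G = 0
  eval_derivative_ne_zero : biEval F x y (derivative G) ≠ 0
  independent : ∀ p : Fin G.natDegree → F[X], ∑ i, aeval x (p i) * y ^ (i : ℕ) = 0 → p = 0
  generates : ∀ z : K, ∃ (r : F[X]) (h : F[X][X]), r ≠ 0 ∧ aeval x r * z = biEval F x y h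

theorem exists_separating (h : IsFunctionField F K) [PerfectField F] :
    ∃ x : K, Transcendental F x ∧ Algebra.IsSeparable (IntermediateField.adjoin F {x}) K := by
  obtain ⟨t, ht, hfin⟩ := h
  have : Algebra.EssFiniteType F (IntermediateField.adjoin F {t}) := by
    rw [IntermediateField.essFiniteType_iff]
    exact ⟨{t}, by simp⟩
  have h1 : Algebra.EssFiniteType F K :=
    Algebra.EssFiniteType.comp F (IntermediateField.adjoin F {t}) K
  have h5 : IsTranscendenceBasis F (fun _ : Unit => t) := by
    apply AlgebraicIndependent.isTranscendenceBasis_of_lift_trdeg_le_of_finite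
    · rwa [algebraicIndependent_unique_type_iff]
    · have : Algebra.IsAlgebraic (Algebra.adjoin F ({t} : Set K)) K :=
        IntermediateField.isAlgebraic_adjoin_iff_top.1 inferInstance
      simpa using Algebra.IsAlgebraic.trdeg_le_cardinalMk F ({t} : Set K)
  obtain ⟨s, hs, hsep⟩ := exists_isTranscendenceBasis_and_isSeparable_of_perfectField F K
  have hcard : s.card = 1 := by
    have h6 := hs.cardinalMk_eq h5
    rw [Cardinal.mk_fintype, Cardinal.mk_fintype, Fintype.card_unit] at h6
    have h7 : Fintype.card s = 1 := by exact_mod_cast h6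
    rwa [Fintype.card_coe] at h7
  obtain ⟨x, rfl⟩ := Finset.card_eq_one.1 hcard
  refine ⟨x, ?_, by rwa [Finset.coe_singleton] at hsep⟩
  exact hs.1.transcendental ⟨x, by simp⟩

/-- Common denominators in a simple extension. -/
theorem exists_common_denominator {x : K} (hx : Transcendental F x) {ι : Type} (s : Finset ι)
    (c : ι → K) (hc : ∀ i ∈ s, c i ∈ IntermediateField.adjoin F {x}) :
    ∃ d : F[X], d ≠ 0 ∧ ∀ i ∈ s, ∃ p : F[X], aeval x d * c i = aeval x p := by
  induction s using Finset.induction_on with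
  | empty => exact ⟨1, one_ne_zero, by simp⟩
  | insert j s hj ih =>
    obtain ⟨d, hd, hdp⟩ := ih fun i hi => hc i (Finset.mem_insert_of_mem hi)
    obtain ⟨r, t, hrt⟩ := (IntermediateField.mem_adjoin_simple_iff F _).1
      (hc j (Finset.mem_insert_self _ _))
    by_cases ht : t = 0
    · refine ⟨d, hd, fun i hi => ?_⟩
      rcases Finset.mem_insert.1 hi with rfl | hi
      · exact ⟨0, by simp [hrt, ht]⟩
      · exact hdp i hi
    · refine ⟨t * d, mul_ne_zero ht hd, fun i hi => ?_⟩
      have ht' : aeval x t ≠ 0 := fun h0 => ht (transcendental_iff.1 hx _ h0)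
      rcases Finset.mem_insert.1 hi with rfl | hi
      · refine ⟨d * r, ?_⟩
        rw [hrt, map_mul, map_mul]
        field_simp
      · obtain ⟨p, hp⟩ := hdp i hi
        exact ⟨t * p, by rw [map_mul, map_mul, ← hp, mul_assoc]⟩

theorem exists_planeModel (h : IsFunctionField F K) [PerfectField F] :
    ∃ (x y : K) (G : F[X][X]), IsPlaneModel x y G := by
  obtain ⟨x, hx, hsep⟩ := exists_separating h
  have hfin := h.finiteDimensional hx
  set k := IntermediateField.adjoin F {x} with hk
  obtain ⟨α, hα⟩ := Field.exists_primitive_element k K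
  let θ : F[X] →+* k := (aeval (IntermediateField.AdjoinSimple.gen F x) : F[X] →ₐ[F] k).toRingHom
  have hθ : ∀ p : F[X], (algebraMap k K) (θ p) = aeval x p := by
    intro p
    have := aeval_algebraMap_apply K (IntermediateField.AdjoinSimple.gen F x) p
    rw [IntermediateField.AdjoinSimple.algebraMap_gen] at this
    exact this.symm
  have hθinj : ∀ p, θ p = 0 → p = 0 := by
    intro p hp
    apply transcendental_iff.1 hx
    rw [← hθ, hp, map_zero]
  set f := minpoly k α with hf
  have hfm : f.Monic := minpoly.monic (Algebra.IsIntegral.isIntegral α)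
  obtain ⟨d, hd, hdp⟩ := exists_common_denominator hx (Finset.range f.natDegree)
    (fun i => (f.coeff i : K)) (fun i _ => (f.coeff i).2)
  have hd' : θ d ≠ 0 := fun h0 => hd (hθinj _ h0)
  let y : K := algebraMap k K (θ d) * α
  have hlift : f.scaleRoots (θ d) ∈ lifts θ := by
    rw [lifts_iff_coeff_lifts]
    intro n
    rcases lt_trichotomy n f.natDegree with hn | hn | hn
    · obtain ⟨p, hp⟩ := hdp n (Finset.mem_range.2 hn)
      refine ⟨p * d ^ (f.natDegree - n - 1), ?_⟩
      apply (algebraMap k K).injective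
      rw [coeff_scaleRoots, map_mul, map_mul, map_mul, map_pow, map_pow, map_pow, hθ, hθ, ← hp]
      have : f.natDegree - n = f.natDegree - n - 1 + 1 := by omega
      conv_rhs => rw [this, pow_succ]
      change _ = (f.coeff n : K) * _
      ring
    · refine ⟨1, ?_⟩
      rw [hn, coeff_scaleRoots_natDegree, map_one]
      exact hfm.symm
    · refine ⟨0, ?_⟩
      rw [map_zero, coeff_eq_zero_of_natDegree_lt]
      rwa [natDegree_scaleRoots]
  have hSm : (f.scaleRoots (θ d)).Monic := (monic_scaleRoots_iff _).2 hfm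
  obtain ⟨G, hG, hGd, hGm⟩ := lifts_and_natDegree_eq_and_monic hlift hSm
  have hyroot : aeval y (f.scaleRoots (θ d)) = 0 :=
    scaleRoots_aeval_eq_zero (minpoly.aeval k α)
  have hytop : IntermediateField.adjoin k {y} = ⊤ := by
    rw [eq_top_iff, ← hα, IntermediateField.adjoin_simple_le_iff]
    have h1 : y ∈ IntermediateField.adjoin k {y} := IntermediateField.mem_adjoin_simple_self k y
    have h2 : α = (algebraMap k K (θ d))⁻¹ * y := by
      rw [inv_mul_cancel_left₀]
      exact (_root_.map_ne_zero _).2 hd'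
    rw [h2]
    exact mul_mem (inv_mem (IntermediateField.algebraMap_mem _ _)) h1
  have hydeg : (minpoly k y).natDegree = f.natDegree := by
    rw [(Field.primitive_element_iff_minpoly_natDegree_eq k y).1 hytop,
      (Field.primitive_element_iff_minpoly_natDegree_eq k α).1 hα]
  have hym : (minpoly k y).Monic := minpoly.monic (Algebra.IsIntegral.isIntegral y)
  have hmin : G.map θ = minpoly k y := by
    rw [hG]
    refine eq_of_monic_of_dvd_of_natDegree_le hym hSm (minpoly.dvd k y hyroot) ?_ |>.symm ▸ rfl
    rw [natDegree_scaleRoots, hydeg]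
  have hbi : ∀ h : F[X][X], biEval F x y h = aeval y (h.map θ) := by
    intro h
    rw [aeval_def, eval₂_map, biEval, coe_eval₂RingHom]
    congr 1
    exact RingHom.ext fun p => (hθ p).symm
  have hGdeg : G.natDegree = (minpoly k y).natDegree := by rw [hydeg, hGd, natDegree_scaleRoots]
  refine ⟨x, y, G, hx, hGm, ?_, ?_, ?_, ?_⟩
  · rw [hbi, hmin, minpoly.aeval]
  · rw [hbi, ← derivative_map, hmin]
    exact (Algebra.IsSeparable.isSeparable k y).aeval_derivative_ne_zero (minpoly.aeval k y)
  · intro p hp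
    have h1 := (linearIndependent_pow (K := k) y).comp (finCongr hGdeg) (finCongr hGdeg).injective
    have h2 := Fintype.linearIndependent_iff.1 h1 (fun i => θ (p i)) (by
      rw [← hp]
      refine Finset.sum_congr rfl fun i _ => ?_
      rw [Algebra.smul_def, hθ]
      rfl)
    funext i
    exact hθinj _ (h2 i)
  · intro z
    have hz : z ∈ IntermediateField.adjoin k {y} := hytop ▸ IntermediateField.mem_top
    have hz' : z ∈ Algebra.adjoin k {y} := by
      rw [← IntermediateField.adjoin_simple_toSubalgebra_of_isAlgebraic
        (Algebra.IsAlgebraic.isAlgebraic y)]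
      exact hz
    rw [Algebra.adjoin_singleton_eq_range_aeval] at hz'
    obtain ⟨q, rfl⟩ := hz'
    obtain ⟨r, hr, hrp⟩ := exists_common_denominator hx (Finset.range (q.natDegree + 1))
      (fun i => (q.coeff i : K)) (fun i _ => (q.coeff i).2)
    have hrp' : ∀ i, ∃ p : F[X], aeval x r * (q.coeff i : K) = aeval x p := by
      intro i
      by_cases hi : i < q.natDegree + 1
      · exact hrp i (Finset.mem_range.2 hi)
      · exact ⟨0, by rw [coeff_eq_zero_of_natDegree_lt (by omega)]; simp⟩
    choose p hp using hrp'
    refine ⟨r, ∑ i ∈ Finset.range (q.natDegree + 1), C (p i) * X ^ i, hr, ?_⟩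
    change _ * aeval y q = _
    rw [map_sum, aeval_eq_sum_range (p := q), Finset.mul_sum]
    refine Finset.sum_congr rfl fun i _ => ?_
    rw [map_mul, map_pow, biEval_C, biEval_X, ← hp, Algebra.smul_def, mul_assoc]
    rfl

end PlaneModel
end CFF

namespace CFF

section SimpleRoot

open Polynomial

variable {F κ : Type} [Field F] [Field κ] [Algebra F κ] [FiniteDimensional F κ]

theorem exists_cofactor {a b : κ} {G : F[X][X]} (hG : biEval F a b G = 0)
    (hG' : biEval F a b (derivative G) ≠ 0) {h : F[X][X]} (hh : biEval F a b h = 0) :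
    ∃ u h' h'' : F[X][X], biEval F a b u ≠ 0 ∧ u * h = h' * G + C (minpoly F a) * h'' := by
  have ha : IsIntegral F a := Algebra.IsIntegral.isIntegral a
  have hirr := Fact.mk (minpoly.irreducible ha)
  let k₀ := AdjoinRoot (minpoly F a)
  let π : F[X] →+* k₀ := AdjoinRoot.mk (minpoly F a)
  have hπ : Function.Surjective π := AdjoinRoot.mk_surjective
  let j : k₀ →+* κ := AdjoinRoot.lift (algebraMap F κ) a (minpoly.aeval F a)
  have hj : ∀ p, j (π p) = aeval a p := fun p => AdjoinRoot.lift_mk _ p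
  have hbi : ∀ h : F[X][X], biEval F a b h = eval₂ j b (h.map π) := by
    intro h
    rw [eval₂_map, biEval, coe_eval₂RingHom]
    congr 1
  let _ : Algebra k₀ κ := j.toAlgebra
  have hbi' : ∀ h : F[X][X], biEval F a b h = aeval b (h.map π) := hbi
  obtain ⟨G₁, hG₁⟩ := minpoly.dvd k₀ b ((hbi' G).symm.trans hG)
  obtain ⟨h₁, hh₁⟩ := minpoly.dvd k₀ b ((hbi' h).symm.trans hh)
  obtain ⟨u, rfl⟩ := map_surjective π hπ G₁
  obtain ⟨h', rfl⟩ := map_surjective π hπ h₁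
  have hdvd : C (minpoly F a) ∣ u * h - h' * G := by
    rw [C_dvd_iff_dvd_coeff]
    intro i
    rw [← AdjoinRoot.mk_eq_zero]
    have : (u * h - h' * G).map π = 0 := by
      rw [Polynomial.map_sub, Polynomial.map_mul, Polynomial.map_mul, hG₁, hh₁]
      ring
    have h2 := congrArg (fun f => coeff f i) this
    simp only [coeff_map, coeff_zero] at h2
    exact h2
  obtain ⟨h'', hh''⟩ := hdvd
  refine ⟨u, h', h'', fun hu => hG' ?_, by rw [← hh'']; ring⟩
  rw [hbi'] at hu ⊢
  rw [← derivative_map, hG₁, derivative_mul, map_add, map_mul, map_mul, hu, minpoly.aeval]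
  simp

end SimpleRoot

section LocalModel

open Polynomial

variable {F K : Type} [Field F] [Field K] [Algebra F K]

/-- The residue map as a homomorphism of algebras. -/
def Place.resHom (P : Place F K) : P.1 →ₐ[F] P.ResField where
  __ := IsLocalRing.residue P.1
  commutes' _ := rfl

/-- The inclusion of the valuation ring as a homomorphism of algebras. -/
def Place.inclHom (P : Place F K) : P.1 →ₐ[F] K where
  __ := P.1.subtype
  commutes' _ := rfl

theorem Place.resHom_surjective (P : Place F K) : Function.Surjective P.resHom :=
  IsLocalRing.residue_surjective

theorem Place.mem_ball_one_iff_resHom [IsFF F K] (P : Place F K) (a : P.1) :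
    (a : K) ∈ P.ball 1 ↔ P.resHom a = 0 := P.mem_ball_one_iff_residue

theorem Place.coe_biEval (P : Place F K) (x y : P.1) (h : F[X][X]) :
    ((biEval F x y h : P.1) : K) = biEval F (x : K) (y : K) h := map_biEval x y P.inclHom h

theorem Place.coe_aeval (P : Place F K) (x : P.1) (p : F[X]) :
    ((aeval x p : P.1) : K) = aeval (x : K) p := (aeval_algHom_apply P.inclHom x p).symm

theorem Place.resHom_aeval (P : Place F K) (x : P.1) (p : F[X]) :
    P.resHom (aeval x p) = aeval (P.resHom x) p := (aeval_algHom_apply P.resHom x p).symm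

variable {x y : K} {G : F[X][X]}

theorem IsPlaneModel.mem_place (hM : IsPlaneModel x y G) {P : Place F K} (hx : x ∈ P.1) :
    y ∈ P.1 := by
  let x' : P.1 := ⟨x, hx⟩
  have h_int : IsIntegral P.1 y := by
    refine ⟨G.map (aeval x' : F[X] →ₐ[F] P.1).toRingHom, hM.monic.map _, ?_⟩
    rw [eval₂_map, ← hM.eval_eq_zero, biEval, coe_eval₂RingHom]
    congr 1
    exact RingHom.ext fun p => P.coe_aeval x' p
  obtain ⟨y', hy'⟩ := IsIntegrallyClosed.isIntegral_iff.1 h_int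
  rw [← hy']
  exact y'.2

variable {P : Place F K} {x y : P.1}

theorem IsPlaneModel.biEval_resHom (hM : IsPlaneModel (x : K) (y : K) G) :
    biEval F (P.resHom x) (P.resHom y) G = 0 := by
  rw [← map_biEval]
  have : (biEval F x y G : P.1) = 0 := by
    apply Subtype.val_injective
    rw [P.coe_biEval, hM.eval_eq_zero]
    rfl
  rw [this, map_zero]

variable [IsFF F K]

theorem IsPlaneModel.exists_mul_eq (hM : IsPlaneModel (x : K) (y : K) G)
    (hG : biEval F (P.resHom x) (P.resHom y) (derivative G) ≠ 0) {h : F[X][X]}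
    (hh : biEval F (P.resHom x) (P.resHom y) h = 0) :
    ∃ u h'' : F[X][X], biEval F (P.resHom x) (P.resHom y) u ≠ 0 ∧
      biEval F x y u * biEval F x y h = aeval x (minpoly F (P.resHom x)) * biEval F x y h'' := by
  have := P.finite_resField (F := F)
  obtain ⟨u, h', h'', hu, huh⟩ := exists_cofactor hM.biEval_resHom hG hh
  refine ⟨u, h'', hu, ?_⟩
  rw [← map_mul, huh, map_add, map_mul, map_mul, biEval_C]
  have : (biEval F x y G : P.1) = 0 := by
    apply Subtype.val_injective
    rw [P.coe_biEval, hM.eval_eq_zero]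
    rfl
  rw [this, mul_zero, zero_add]

theorem IsPlaneModel.exists_localization (hM : IsPlaneModel (x : K) (y : K) G)
    (hG : biEval F (P.resHom x) (P.resHom y) (derivative G) ≠ 0) (z : P.1) :
    ∃ u h : F[X][X], biEval F (P.resHom x) (P.resHom y) u ≠ 0 ∧
      biEval F x y u * z = biEval F x y h := by
  have hfin := P.finite_resField (F := F)
  set p := minpoly F (P.resHom x) with hp
  have h_int : IsIntegral F (P.resHom x) := Algebra.IsIntegral.isIntegral _
  have hpx : (aeval x p : P.1) ≠ 0 := by
    intro h0
    have h1 := congrArg (Subtype.val) h0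
    change ((aeval x p : P.1) : K) = 0 at h1
    rw [P.coe_aeval] at h1
    exact (minpoly.ne_zero h_int) (transcendental_iff.1 hM.transcendental _ h1)
  have key : ∀ (k : ℕ) (s : F[X]) (u h : F[X][X]), ¬ p ∣ s →
      biEval F (P.resHom x) (P.resHom y) u ≠ 0 →
      biEval F x y u * (aeval x (p ^ k * s) * z) = biEval F x y h →
      ∃ u h : F[X][X], biEval F (P.resHom x) (P.resHom y) u ≠ 0 ∧
      biEval F x y u * z = biEval F x y h := by
    intro k
    induction k with
    | zero =>
      intro s u h hs hu heq
      refine ⟨u * C s, h, ?_, ?_⟩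
      · rw [map_mul, biEval_C]
        exact mul_ne_zero hu fun h0 => hs (minpoly.dvd F _ h0)
      · rw [← heq, map_mul, biEval_C, pow_zero, one_mul, mul_assoc]
    | succ k ih =>
      intro s u h hs hu heq
      have h0 : biEval F (P.resHom x) (P.resHom y) h = 0 := by
        rw [← map_biEval, ← heq, map_mul, map_mul, P.resHom_aeval, map_mul, map_pow, pow_succ,
          hp, minpoly.aeval]
        simp
      obtain ⟨u₁, h₁, hu₁, huh⟩ := hM.exists_mul_eq hG h0
      refine ih s (u₁ * u) h₁ hs (by rw [map_mul]; exact mul_ne_zero hu₁ hu) ?_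
      apply mul_left_cancel₀ hpx
      rw [← huh, ← heq, map_mul, pow_succ, map_mul, map_mul, map_mul]
      ring
  obtain ⟨r, h, hr, hrh⟩ := hM.generates (z : K)
  have hpr : Irreducible p := minpoly.irreducible h_int
  obtain ⟨s, hs, hps⟩ :=
    (FiniteMultiplicity.of_not_isUnit hpr.not_isUnit hr).exists_eq_pow_mul_and_not_dvd
  refine key (multiplicity p r) s 1 h hps ?_ ?_
  · rw [map_one]
    exact one_ne_zero
  · rw [← hs]
    apply Subtype.val_injective
    rw [map_one, one_mul, P.coe_biEval, ← hrh, ← P.coe_aeval]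
    rfl

theorem IsPlaneModel.ordAt_minpoly (hM : IsPlaneModel (x : K) (y : K) G)
    (hG : biEval F (P.resHom x) (P.resHom y) (derivative G) ≠ 0) :
    ordAt P.1 (aeval (x : K) (minpoly F (P.resHom x))) = 1 := by
  have hfin := P.finite_resField (F := F)
  have h_int : IsIntegral F (P.resHom x) := Algebra.IsIntegral.isIntegral _
  have hpx : aeval (x : K) (minpoly F (P.resHom x)) ≠ 0 := fun h1 =>
    minpoly.ne_zero h_int (transcendental_iff.1 hM.transcendental _ h1)
  have hp1 : aeval (x : K) (minpoly F (P.resHom x)) ∈ P.ball 1 := by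
    rw [← P.coe_aeval, P.mem_ball_one_iff_resHom, P.resHom_aeval, minpoly.aeval]
  obtain ⟨π, hπ, hπ1⟩ := P.exists_ordAt_eq_one
  have hπP : π ∈ P.1 := (P.ordAt_nonneg_iff hπ).1 (by omega)
  have hπr : P.resHom ⟨π, hπP⟩ = 0 :=
    (P.mem_ball_one_iff_resHom ⟨π, hπP⟩).1 ((P.mem_ball_of_ne hπ).2 hπ1.ge)
  obtain ⟨u, h, hu, huh⟩ := hM.exists_localization hG ⟨π, hπP⟩
  have hh0 : biEval F (P.resHom x) (P.resHom y) h = 0 := by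
    rw [← map_biEval, ← huh, map_mul, hπr, mul_zero]
  obtain ⟨u₁, h₁, hu₁, huh₁⟩ := hM.exists_mul_eq hG hh0
  have hunit : ∀ w : F[X][X], biEval F (P.resHom x) (P.resHom y) w ≠ 0 →
      ((biEval F x y w : P.1) : K) ≠ 0 ∧ ordAt P.1 ((biEval F x y w : P.1) : K) = 0 := by
    intro w hw
    rw [← map_biEval] at hw
    have h1 : ((biEval F x y w : P.1) : K) ∉ P.ball 1 := fun h =>
      hw ((P.mem_ball_one_iff_resHom _).1 h)
    have h2 : ((biEval F x y w : P.1) : K) ≠ 0 := fun h => h1 (h ▸ zero_mem _)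
    rw [P.mem_ball_of_ne h2] at h1
    have := (P.ordAt_nonneg_iff h2).2 (biEval F x y w : P.1).2
    exact ⟨h2, by omega⟩
  obtain ⟨hu0, huo⟩ := hunit u hu
  obtain ⟨hu₁0, hu₁o⟩ := hunit u₁ hu₁
  have e1 := congrArg P.1.subtype huh
  have e2 := congrArg P.1.subtype huh₁
  rw [map_mul] at e1
  rw [map_mul, map_mul, ← e1] at e2
  change ((biEval F x y u₁ : P.1) : K) * (((biEval F x y u : P.1) : K) * π) =
    ((aeval x (minpoly F (P.resHom x)) : P.1) : K) * ((biEval F x y h₁ : P.1) : K) at e2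
  rw [P.coe_aeval] at e2
  have h10 : ((biEval F x y h₁ : P.1) : K) ≠ 0 := by
    intro h0
    rw [h0, mul_zero] at e2
    exact mul_ne_zero hu₁0 (mul_ne_zero hu0 hπ) e2
  have e3 := congrArg (ordAt P.1) e2
  rw [P.ordAt_mul hu₁0 (mul_ne_zero hu0 hπ), P.ordAt_mul hu0 hπ, P.ordAt_mul hpx h10, hu₁o,
    huo, hπ1] at e3
  have e4 := (P.ordAt_nonneg_iff h10).2 (biEval F x y h₁ : P.1).2
  have e5 := (P.mem_ball_of_ne hpx).1 hp1
  omega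

end LocalModel

section Frobenius

open Polynomial

variable {K : Type} [Field K] [Algebra (ZMod 2) K] [IsFF (ZMod 2) K] {G : (ZMod 2)[X][X]}
  {P : Place (ZMod 2) K} {x y : P.1}

theorem IsPlaneModel.placeDegree_dvd (hM : IsPlaneModel (x : K) (y : K) G)
    (hG : biEval (ZMod 2) (P.resHom x) (P.resHom y) (derivative G) ≠ 0) {n : ℕ}
    (hx : P.resHom x ^ 2 ^ n = P.resHom x) (hy : P.resHom y ^ 2 ^ n = P.resHom y) :
    placeDegree (ZMod 2) P ∣ n := by
  have hfin := P.finite_resField (F := ZMod 2)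
  have := Module.finite_of_finite (ZMod 2) (M := P.ResField)
  let _ := Fintype.ofFinite P.ResField
  rw [P.placeDegree_eq, ← FiniteField.orderOf_frobeniusAlgHom (ZMod 2) P.ResField,
    orderOf_dvd_iff_pow_eq_one]
  have hφ : ∀ a, (FiniteField.frobeniusAlgHom (ZMod 2) P.ResField ^ n) a = a ^ 2 ^ n := by
    intro a
    rw [AlgHom.coe_pow, FiniteField.coe_frobeniusAlgHom, pow_iterate, ZMod.card]
  have hbi : ∀ h, biEval (ZMod 2) (P.resHom x) (P.resHom y) h ^ 2 ^ n =
      biEval (ZMod 2) (P.resHom x) (P.resHom y) h := by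
    intro h
    rw [← hφ, map_biEval, hφ, hφ, hx, hy]
  refine AlgHom.ext fun a => ?_
  obtain ⟨z, rfl⟩ := P.resHom_surjective a
  obtain ⟨u, h, hu, huh⟩ := hM.exists_localization hG z
  have e := congrArg P.resHom huh
  rw [map_mul, map_biEval, map_biEval] at e
  have e2 := congrArg (fun t => t ^ 2 ^ n) e
  simp only [mul_pow, hbi] at e2
  rw [hφ]
  exact mul_left_cancel₀ hu (e2.trans e.symm)

theorem Place.ordAt_pow_sub_self (hx : Transcendental (ZMod 2) (x : K)) {n : ℕ} (hn : n ≠ 0) :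
    ordAt P.1 ((x : K) ^ 2 ^ n - x) =
      if P.resHom x ^ 2 ^ n = P.resHom x then
        ordAt P.1 (aeval (x : K) (minpoly (ZMod 2) (P.resHom x))) else 0 := by
  have hfin := P.finite_resField (F := ZMod 2)
  have h_int : IsIntegral (ZMod 2) (P.resHom x) := Algebra.IsIntegral.isIntegral _
  set f : (ZMod 2)[X] := X ^ 2 ^ n - X with hf
  have hfx : aeval (x : K) f = (x : K) ^ 2 ^ n - x := by simp [hf]
  have hfr : P.resHom (aeval x f) = P.resHom x ^ 2 ^ n - P.resHom x := by simp [hf]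
  have hunit : ∀ s : (ZMod 2)[X], P.resHom (aeval x s) ≠ 0 →
      aeval (x : K) s ≠ 0 ∧ ordAt P.1 (aeval (x : K) s) = 0 := by
    intro s hs
    rw [← P.coe_aeval]
    have h1 : ((aeval x s : P.1) : K) ∉ P.ball 1 := fun h =>
      hs ((P.mem_ball_one_iff_resHom _).1 h)
    have h2 : ((aeval x s : P.1) : K) ≠ 0 := fun h => h1 (h ▸ zero_mem _)
    rw [P.mem_ball_of_ne h2] at h1
    have := (P.ordAt_nonneg_iff h2).2 (aeval x s : P.1).2
    exact ⟨h2, by omega⟩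
  rw [← hfx]
  split_ifs with h
  · have hroot : aeval (P.resHom x) f = 0 := by
      rw [← P.resHom_aeval, hfr, h, sub_self]
    obtain ⟨s, hs⟩ := minpoly.dvd _ _ hroot
    have hsr : P.resHom (aeval x s) ≠ 0 := by
      rw [P.resHom_aeval]
      intro h0
      have e := congrArg (fun g => aeval (P.resHom x) (derivative g)) hs
      simp only [derivative_mul, map_add, map_mul, minpoly.aeval, h0, zero_mul, mul_zero,
        add_zero] at e
      rw [hf, derivative_sub, derivative_X_pow, derivative_X, map_sub, map_mul, map_one] at e
      have h2 : ((2 ^ n : ℕ) : ZMod 2) = 0 := by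
        rw [Nat.cast_pow]
        change (0 : ZMod 2) ^ n = 0
        exact zero_pow hn
      rw [h2, C_0, map_zero, zero_mul, zero_sub] at e
      exact one_ne_zero (neg_eq_zero.1 e)
    obtain ⟨h1, h2⟩ := hunit s hsr
    rw [hs, map_mul, P.ordAt_mul (fun h1 => minpoly.ne_zero h_int (transcendental_iff.1 hx _ h1)) h1,
      h2, add_zero]
  · exact (hunit f (by rw [hfr]; exact sub_ne_zero.2 h)).2

end Frobenius
end CFF

namespace CFF

section DivX

open Polynomial

variable {F A : Type} [Field F] [CommRing A] [Algebra F A]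

theorem biEval_divX (x b : A) (h : F[X][X]) :
    biEval F x b h = biEval F x b h.divX * b + aeval x (h.coeff 0) := by
  conv_lhs => rw [← divX_mul_X_add h]
  rw [map_add, map_mul, biEval_X, biEval_C]

theorem biEval_sub_biEval (x b₁ b₂ : A) (N : ℕ) : ∀ h : F[X][X], h.natDegree ≤ N →
    biEval F x b₁ h - biEval F x b₂ h =
      (b₁ - b₂) * ∑ j : Fin N, b₂ ^ (j : ℕ) * biEval F x b₁ (divX^[j + 1] h) := by
  induction N with
  | zero =>
    intro h hh
    rw [eq_C_of_natDegree_le_zero hh, biEval_C, biEval_C]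
    simp
  | succ N ih =>
    intro h hh
    have h1 := ih h.divX (by rw [natDegree_divX_eq_natDegree_tsub_one]; omega)
    rw [biEval_divX x b₁ h, biEval_divX x b₂ h, Fin.sum_univ_succ]
    simp only [Fin.val_zero, pow_zero, one_mul, zero_add, Function.iterate_zero, id_eq,
      Fin.val_succ, Function.iterate_succ_apply] at h1 ⊢
    have h2 : ∑ j : Fin N, b₂ ^ ((j : ℕ) + 1) * biEval F x b₁ (divX^[(j : ℕ)] h.divX.divX) =
        b₂ * ∑ j : Fin N, b₂ ^ (j : ℕ) * biEval F x b₁ (divX^[(j : ℕ)] h.divX.divX) := by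
      rw [Finset.mul_sum]
      exact Finset.sum_congr rfl fun j _ => by ring
    rw [h2]
    linear_combination b₂ * h1

theorem coeff_iterate_divX {R : Type} [CommRing R] (h : R[X]) (k n : ℕ) :
    (divX^[k] h).coeff n = h.coeff (n + k) := by
  induction k generalizing n with
  | zero => rfl
  | succ k ih => rw [Function.iterate_succ_apply', coeff_divX, ih]; congr 1; ring

theorem iterate_divX_natDegree {R : Type} [CommRing R] {h : R[X]} (hm : h.Monic) :
    divX^[h.natDegree] h = 1 := by
  ext n
  rw [coeff_iterate_divX, coeff_one]
  split_ifs with hn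
  · rw [hn, zero_add]
    exact hm
  · exact coeff_eq_zero_of_natDegree_lt (by omega)

end DivX

section PoleDivisor

variable {F K : Type} [Field F] [Field K] [Algebra F K]

/-- The divisor of poles of a function. -/
def poleDiv (F : Type) {K : Type} [Field F] [Field K] [Algebra F K] [HasGenus F K] (f : K) :
    Divisor F K :=
  (pdiv F f).mapRange (fun n => max 0 (-n)) (by simp)

variable [HasGenus F K]

theorem poleDiv_apply (f : K) (P : Place F K) : poleDiv F f P = max 0 (-ordAt P.1 f) := by
  rw [poleDiv, Finsupp.mapRange_apply, pdiv_apply]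

theorem poleDiv_nonneg (f : K) : 0 ≤ poleDiv F f := fun P => by
  rw [poleDiv_apply]
  exact le_max_left _ _

theorem poleDiv_eq_zero {f : K} {P : Place F K} (h : f ∈ P.1) : poleDiv F f P = 0 := by
  rw [poleDiv_apply]
  by_cases hf : f = 0
  · rw [hf, P.ordAt_zero]; simp
  · have := (P.ordAt_nonneg_iff hf).2 h
    omega

theorem one_le_poleDiv {f : K} {P : Place F K} (h : f ∉ P.1) : 1 ≤ poleDiv F f P := by
  rw [poleDiv_apply]
  have hf : f ≠ 0 := by
    rintro rfl
    exact h P.1.zero_mem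
  have := mt (P.ordAt_nonneg_iff hf).1 h
  omega

theorem mem_RRspace_poleDiv (f : K) : f ∈ RRspace F (poleDiv F f) := by
  rw [mem_RRspace]
  intro P
  by_cases hf : f = 0
  · rw [hf]; exact zero_mem _
  · rw [P.mem_ball_of_ne hf, poleDiv_apply]
    omega

theorem exists_mem_RRspace_smul {x z : K} (h : ∀ P : Place F K, x ∈ P.1 → z ∈ P.1) :
    ∃ t₀ : ℕ, ∀ t ≥ t₀, z ∈ RRspace F (t • poleDiv F x) := by
  refine ⟨∑ P ∈ (pdiv F z).support, (ordAt P.1 z).natAbs, fun t ht => mem_RRspace.2 fun P => ?_⟩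
  by_cases hx : x ∈ P.1
  · rw [Finsupp.smul_apply, poleDiv_eq_zero hx, smul_zero, neg_zero, P.mem_ball_zero]
    exact h P hx
  · by_cases hz : z = 0
    · rw [hz]; exact zero_mem _
    have h1 : (ordAt P.1 z).natAbs ≤ t := by
      by_cases hP : P ∈ (pdiv F z).support
      · exact (Finset.single_le_sum (f := fun P : Place F K => (ordAt P.1 z).natAbs)
          (fun _ _ => Nat.zero_le _) hP).trans ht
      · rw [Finsupp.notMem_support_iff, pdiv_apply] at hP
        rw [hP]
        simp
    rw [P.mem_ball_of_ne hz, Finsupp.smul_apply, nsmul_eq_mul]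
    have h2 := one_le_poleDiv (F := F) hx
    have h3 : (t : ℤ) * 1 ≤ t * poleDiv F x P := mul_le_mul_of_nonneg_left h2 (by positivity)
    omega

theorem exists_relation {ι κ : Type} [Fintype ι] [Fintype κ] (f : κ → ι → K) (D : Divisor F K)
    (hf : ∀ k i, f k i ∈ RRspace F D) (h : Fintype.card κ * ell F D < Fintype.card ι) :
    ∃ c : ι → F, c ≠ 0 ∧ ∀ k, ∑ i, c i • f k i = 0 := by
  have hmem : ∀ k c, Fintype.linearCombination F (f k) c ∈ RRspace F D := by
    intro k c
    rw [Fintype.linearCombination_apply]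
    exact Submodule.sum_mem _ fun i _ => Submodule.smul_mem _ _ (hf k i)
  let Ψ : (ι → F) →ₗ[F] (κ → RRspace F D) :=
    LinearMap.pi fun k => (Fintype.linearCombination F (f k)).codRestrict _ (hmem k)
  have hker : LinearMap.ker Ψ ≠ ⊥ := by
    apply LinearMap.ker_ne_bot_of_finrank_lt
    rw [Module.finrank_fintype_fun_eq_card, Module.finrank_pi_fintype, Finset.sum_const,
      Finset.card_univ, smul_eq_mul]
    exact h
  obtain ⟨c, hc, hc0⟩ := Submodule.exists_mem_ne_zero_of_ne_bot hker
  refine ⟨c, hc0, fun k => ?_⟩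
  rw [← Fintype.linearCombination_apply]
  exact congrArg Subtype.val (congrFun (LinearMap.mem_ker.1 hc) k)

end PoleDivisor

section PlaneStepanov

open Polynomial

variable {F K : Type} [Field F] [Field K] [Algebra F K]

theorem eq_zero_of_sum_C_mul_X_pow {b : ℕ} {c : Fin b → F}
    (h : ∑ l, C (c l) * X ^ (l : ℕ) = 0) (l : Fin b) : c l = 0 := by
  have := congrArg (fun p => coeff p l) h
  simp only [finsetSum_coeff, coeff_C_mul_X_pow, coeff_zero, Fin.val_inj] at this
  simpa using this

theorem aeval_sum_C_mul_X_pow {b : ℕ} (c : Fin b → F) (x : K) :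
    aeval x (∑ l, C (c l) * X ^ (l : ℕ)) = ∑ l, c l • x ^ (l : ℕ) := by
  simp [Algebra.smul_def]

theorem IsPlaneModel.eq_zero_of_sum {x y : K} {G : F[X][X]} (hM : IsPlaneModel x y G) {m : ℕ}
    (hm : G.natDegree = m) {p : Fin m → F[X]} (h : ∑ i, aeval x (p i) * y ^ (i : ℕ) = 0) :
    p = 0 := by
  subst hm
  exact hM.independent p h

variable [HasGenus F K] {x y : K} {G : F[X][X]}

theorem IsPlaneModel.natDegree_le_deg (hM : IsPlaneModel x y G) :
    (G.natDegree : ℤ) ≤ deg (poleDiv F x) := by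
  set D := poleDiv F x with hD
  have hδ := deg_nonneg (poleDiv_nonneg (F := F) x)
  have hy : ∀ j : Fin G.natDegree, ∃ t₀ : ℕ, ∀ t ≥ t₀, y ^ (j : ℕ) ∈ RRspace F (t • D) :=
    fun j => exists_mem_RRspace_smul fun P hP => pow_mem (hM.mem_place hP) _
  choose t ht using hy
  set T := ∑ j, t j with hT
  have hT' : ∀ j : Fin G.natDegree, y ^ (j : ℕ) ∈ RRspace F (T • D) := fun j =>
    ht j _ (Finset.single_le_sum (fun _ _ => Nat.zero_le _) (Finset.mem_univ j))
  by_contra! hlt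
  rw [← hD] at hδ
  obtain ⟨δ, hδ'⟩ := Int.eq_ofNat_of_zero_le hδ
  set a := T * δ + 1 with ha
  have hdeg : deg (a • D + T • D) = a * δ + T * δ := by
    rw [deg, map_add, map_nsmul, map_nsmul, nsmul_eq_mul, nsmul_eq_mul]
    change (a : ℤ) * deg D + T * deg D = _
    rw [hδ']
  have hl := ell_le (a • D + T • D) (by rw [hdeg]; positivity)
  rw [hdeg] at hl
  obtain ⟨c, hc0, hc⟩ := exists_relation (F := F) (κ := Unit)
    (fun _ (p : Fin G.natDegree × Fin (a + 1)) => x ^ (p.2 : ℕ) * y ^ (p.1 : ℕ)) (a • D + T • D)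
    (fun _ p => mul_mem_RRspace (RRspace_mono (by
        have h1 : (p.2 : ℕ) ≤ a := by omega
        exact nsmul_le_nsmul_left (poleDiv_nonneg x) h1)
      (pow_mem_RRspace (mem_RRspace_poleDiv x) p.2)) (hT' p.1)) (by
    rw [Fintype.card_unit, one_mul, Fintype.card_prod, Fintype.card_fin, Fintype.card_fin]
    zify
    refine lt_of_le_of_lt hl ?_
    have h1 : (δ : ℤ) + 1 ≤ G.natDegree := by rw [← hδ']; omega
    have h2 : ((δ : ℤ) + 1) * (a + 1) ≤ G.natDegree * (a + 1) :=
      mul_le_mul_of_nonneg_right h1 (by positivity)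
    have h3 : (a : ℤ) = T * δ + 1 := by rw [ha]; push_cast; ring
    nlinarith)
  apply hc0
  have h1 : (fun j => ∑ l, C (c (j, l)) * X ^ (l : ℕ)) = 0 := hM.eq_zero_of_sum rfl (by
    rw [← hc (), Fintype.sum_prod_type]
    refine Finset.sum_congr rfl fun j _ => ?_
    rw [aeval_sum_C_mul_X_pow, Finset.sum_mul]
    exact Finset.sum_congr rfl fun l _ => smul_mul_assoc _ _ _)
  funext p
  exact eq_zero_of_sum_C_mul_X_pow (congrFun h1 p.1) p.2

end PlaneStepanov

section PlaneStepanovTwo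

open Polynomial

variable {K : Type} [Field K] [Algebra (ZMod 2) K] {x y : K} {G : (ZMod 2)[X][X]}

/-- The auxiliary function for the places whose Frobenius moves `y` but not `x`. -/
theorem IsPlaneModel.exists_auxiliary [HasGenus (ZMod 2) K] (hM : IsPlaneModel x y G) {m : ℕ}
    (hm : G.natDegree = m + 1) {D E T : Divisor (ZMod 2) K} (hx : x ∈ RRspace (ZMod 2) D)
    (hD : 0 ≤ D) (e : Fin (m + 1) → K) (he : ∀ j, e j ∈ RRspace (ZMod 2) T)
    (he1 : e (Fin.last m) = 1) (μ ν b : ℕ) (hE : deg E < 2 ^ ν)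
    (hlt : m * ell (ZMod 2) (2 ^ μ • E + b • D + T) < ell (ZMod 2) E * (b * (m + 1))) :
    ∃ (ι : Type) (_ : Fintype ι) (v : ι → K) (w : ι → Fin (m + 1) → (ZMod 2)[X]),
      (∀ i, v i ∈ RRspace (ZMod 2) E) ∧ (∀ i j, aeval x (w i j) ∈ RRspace (ZMod 2) (b • D)) ∧
      (∀ j, ∑ i, v i ^ 2 ^ μ * aeval x (w i j) =
        (∑ i, v i ^ 2 ^ μ * aeval x (w i (Fin.last m))) * e j) ∧
      ∑ i, v i * (∑ j, aeval x (w i j) * y ^ (j : ℕ)) ^ 2 ^ ν ≠ 0 := by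
  let bv := Module.finBasis (ZMod 2) (RRspace (ZMod 2) E)
  let v : Fin (Module.finrank (ZMod 2) (RRspace (ZMod 2) E)) → K := fun i => bv i
  have hv : LinearIndependent (ZMod 2) v :=
    bv.linearIndependent.map' (Submodule.subtype _) (Submodule.ker_subtype _)
  have hxl : ∀ l : Fin b, x ^ (l : ℕ) ∈ RRspace (ZMod 2) (b • D) := fun l =>
    RRspace_mono (nsmul_le_nsmul_left hD l.2.le) (pow_mem_RRspace hx l)
  have hvM : ∀ i, v i ^ 2 ^ μ ∈ RRspace (ZMod 2) (2 ^ μ • E) := fun i =>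
    pow_mem_RRspace (bv i).2 _
  obtain ⟨c, hc0, hc⟩ := exists_relation (F := ZMod 2)
    (fun (j : Fin m) (p : Fin (Module.finrank (ZMod 2) (RRspace (ZMod 2) E)) × Fin b ×
        Fin (m + 1)) => v p.1 ^ 2 ^ μ * x ^ (p.2.1 : ℕ) *
      ((if p.2.2 = j.castSucc then 1 else 0) - (if p.2.2 = Fin.last m then e j.castSucc else 0)))
    (2 ^ μ • E + b • D + T)
    (fun j p => by
      refine mul_mem_RRspace (mul_mem_RRspace (hvM _) (hxl _)) (sub_mem ?_ ?_)
      · split_ifs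
        · rw [← he1]
          exact he _
        · exact zero_mem _
      · split_ifs
        · exact he _
        · exact zero_mem _)
    (by
      rw [Fintype.card_prod, Fintype.card_prod, Fintype.card_fin, Fintype.card_fin,
        Fintype.card_fin, Fintype.card_fin]
      exact hlt)
  have hw : ∀ i j, aeval x (∑ l, C (c (i, l, j)) * X ^ (l : ℕ)) = ∑ l, c (i, l, j) • x ^ (l : ℕ) :=
    fun i j => aeval_sum_C_mul_X_pow _ x
  refine ⟨_, inferInstance, v, fun i j => ∑ l, C (c (i, l, j)) * X ^ (l : ℕ),
    fun i => (bv i).2, fun i j => ?_, fun j => ?_, fun h => ?_⟩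
  · rw [hw]
    exact Submodule.sum_mem _ fun l _ => Submodule.smul_mem _ _ (hxl l)
  · induction j using Fin.lastCases with
    | last => rw [he1, mul_one]
    | cast j =>
      rw [← sub_eq_zero, ← hc j, Fintype.sum_prod_type, Finset.sum_mul, ← Finset.sum_sub_distrib]
      refine Finset.sum_congr rfl fun i _ => ?_
      rw [Fintype.sum_prod_type, hw, hw, Finset.mul_sum, Finset.mul_sum, Finset.sum_mul,
        ← Finset.sum_sub_distrib]
      refine Finset.sum_congr rfl fun l _ => ?_
      simp only [mul_sub, smul_sub, Finset.sum_sub_distrib, mul_ite, mul_one, mul_zero, smul_ite,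
        smul_zero, Finset.sum_ite_eq', Finset.mem_univ, if_true]
      rw [mul_smul_comm, mul_smul_comm, smul_mul_assoc]
  · have h1 := frobenius_independent (fun i => (bv i).2) hv hE h
    apply hc0
    funext p
    have h2 := hM.eq_zero_of_sum hm (congrFun h1 p.1)
    exact eq_zero_of_sum_C_mul_X_pow (congrFun h2 p.2.2) p.2.1

theorem Place.inclHom_injective (P : Place (ZMod 2) K) : Function.Injective P.inclHom :=
  Subtype.val_injective

theorem Place.resHom_pow_aeval [IsFF (ZMod 2) K] {P : Place (ZMod 2) K} {x : P.1} {n : ℕ}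
    (hx : P.resHom x ^ 2 ^ n = P.resHom x) (p : (ZMod 2)[X]) : P.resHom (aeval x p) ^ 2 ^ n = P.resHom (aeval x p) := by
  rw [P.resHom_aeval, aeval_eq_sum_range, sum_pow_two_pow]
  refine Finset.sum_congr rfl fun i _ => ?_
  rw [smul_pow_two_pow, ← pow_mul, mul_comm, pow_mul, hx]

theorem biEval_pow_two_pow {A : Type} [CommRing A] [Algebra (ZMod 2) A] [CharP A 2]
    (a b : A) (h : (ZMod 2)[X][X]) (n : ℕ) : biEval (ZMod 2) a b h ^ 2 ^ n = biEval (ZMod 2) (a ^ 2 ^ n) (b ^ 2 ^ n) h := by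
  rw [biEval_eq_sum, biEval_eq_sum, sum_pow_two_pow]
  refine Finset.sum_congr rfl fun i _ => ?_
  rw [mul_pow, ← pow_mul, ← pow_mul, mul_comm i]
  congr 1
  rw [aeval_eq_sum_range, aeval_eq_sum_range, sum_pow_two_pow]
  refine Finset.sum_congr rfl fun i _ => ?_
  rw [smul_pow_two_pow, ← pow_mul, ← pow_mul, mul_comm]

theorem IsPlaneModel.auxiliary_mem_ball_one [IsFF (ZMod 2) K] {P : Place (ZMod 2) K} {x y : P.1}
    (hM : IsPlaneModel (x : K) (y : K) G) {m : ℕ} (hm : G.natDegree = m + 1) {μ ν : ℕ}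
    (hx : P.resHom x ^ 2 ^ (μ + ν) = P.resHom x) (hy : P.resHom y ^ 2 ^ (μ + ν) ≠ P.resHom y)
    {ι : Type} [Fintype ι] {v : ι → P.1} {w : ι → Fin (m + 1) → (ZMod 2)[X]}
    (hA : ∀ j : Fin (m + 1), ∑ i, (v i : K) ^ 2 ^ μ * aeval (x : K) (w i j) =
        (∑ i, (v i : K) ^ 2 ^ μ * aeval (x : K) (w i (Fin.last m))) *
          biEval (ZMod 2) (x : K) (y : K) (divX^[(j : ℕ) + 1] G)) :
    ∑ i, (v i : K) * (∑ j, aeval (x : K) (w i j) * (y : K) ^ (j : ℕ)) ^ 2 ^ ν ∈ P.ball 1 := by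
  set φ := P.resHom with hφ
  have hA' : ∀ j : Fin (m + 1), ∑ i, v i ^ 2 ^ μ * aeval x (w i j) =
        (∑ i, v i ^ 2 ^ μ * aeval x (w i (Fin.last m))) *
          biEval (ZMod 2) x y (divX^[(j : ℕ) + 1] G) := by
    intro j
    apply P.inclHom_injective
    simp only [map_sum, map_mul, map_pow, ← aeval_algHom_apply, map_biEval]
    exact hA j
  have hsum : ∑ j : Fin (m + 1), (φ y ^ 2 ^ (μ + ν)) ^ (j : ℕ) *
      biEval (ZMod 2) (φ x) (φ y) (divX^[(j : ℕ) + 1] G) = 0 := by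
    have h1 := biEval_sub_biEval (F := ZMod 2) (φ x) (φ y) (φ y ^ 2 ^ (μ + ν)) (m + 1) G hm.le
    have h2 : biEval (ZMod 2) (φ x) (φ y ^ 2 ^ (μ + ν)) G = 0 := by
      conv_lhs => rw [← hx]
      rw [← biEval_pow_two_pow, hM.biEval_resHom, zero_pow (by positivity)]
    rw [hM.biEval_resHom, h2, sub_zero] at h1
    exact (mul_eq_zero.1 h1.symm).resolve_left (sub_ne_zero.2 (Ne.symm hy))
  apply P.pow_mem_ball_one (k := 2 ^ μ)
  have h3 : ((∑ i, v i ^ 2 ^ μ * (∑ j, aeval x (w i j) * y ^ (j : ℕ)) ^ 2 ^ (μ + ν) : P.1) : K) =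
      (∑ i, (v i : K) * (∑ j, aeval (x : K) (w i j) * (y : K) ^ (j : ℕ)) ^ 2 ^ ν) ^ 2 ^ μ := by
    change P.inclHom _ = _
    simp only [map_sum, map_mul, map_pow, ← aeval_algHom_apply]
    rw [sum_pow_two_pow]
    refine Finset.sum_congr rfl fun i _ => ?_
    rw [mul_pow, ← pow_mul, ← pow_add, add_comm ν]
    rfl
  rw [← h3, P.mem_ball_one_iff_resHom, ← hφ]
  have h4 : φ (∑ i, v i ^ 2 ^ μ * (∑ j, aeval x (w i j) * y ^ (j : ℕ)) ^ 2 ^ (μ + ν)) =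
      ∑ j : Fin (m + 1), (φ y ^ 2 ^ (μ + ν)) ^ (j : ℕ) *
        φ (∑ i, v i ^ 2 ^ μ * aeval x (w i j)) := by
    rw [map_sum]
    have : ∀ j : Fin (m + 1), (φ y ^ 2 ^ (μ + ν)) ^ (j : ℕ) *
        φ (∑ i, v i ^ 2 ^ μ * aeval x (w i j)) = ∑ i, φ (v i) ^ 2 ^ μ *
          (φ (aeval x (w i j)) * φ y ^ (j : ℕ)) ^ 2 ^ (μ + ν) := by
      intro j
      rw [map_sum, Finset.mul_sum]
      refine Finset.sum_congr rfl fun i _ => ?_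
      rw [map_mul, map_pow, mul_pow, Place.resHom_pow_aeval hx, ← pow_mul, ← pow_mul,
        mul_comm (j : ℕ)]
      ring
    simp_rw [this]
    rw [Finset.sum_comm]
    refine Finset.sum_congr rfl fun i _ => ?_
    rw [map_mul, map_pow, map_pow, map_sum, sum_pow_two_pow, Finset.mul_sum]
    simp only [map_mul, map_pow]
  rw [h4]
  refine Eq.trans (Finset.sum_congr rfl fun j _ => ?_)
    ((Finset.mul_sum _ _ (φ (∑ i, v i ^ 2 ^ μ * aeval x (w i (Fin.last m))))).symm.trans
      (by rw [hsum, mul_zero]))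
  rw [hA' j, map_mul, map_biEval]
  ring

end PlaneStepanovTwo
end CFF

namespace CFF

section LowerBound

open Polynomial

theorem exists_stepanov_parameters {m δ g t M Q r : ℕ} (hδ : m + 1 ≤ δ) (hMQ : M ≤ Q)
    (hr : r = (m + 1) * (δ + g) + m * δ) (hQ : (r + 2) * r + m * (t * δ + 1) < Q) :
    ∃ a b : ℕ, a * δ < Q ∧
      (m : ℤ) * ((M * a + b + t) * δ + 1) < (a * δ + 1 - g) * (b * (m + 1)) ∧
      (b : ℤ) * δ ≤ (δ - 1) * M + δ * (r + m + 2) := by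
  have hδ0 : 0 < δ := by omega
  set a := (Q - 1) / δ with ha
  set b := (m * M + r + 1) / (m + 1) + 1 with hb
  have ha1 : a * δ ≤ Q - 1 := Nat.div_mul_le_self _ _
  have ha2 : Q - 1 < a * δ + δ := Nat.lt_div_mul_add hδ0
  have hb1 : b * (m + 1) ≤ m * M + r + 1 + (m + 1) := by
    have := Nat.div_mul_le_self (m * M + r + 1) (m + 1)
    rw [hb, add_mul, one_mul]; omega
  have hb2 : m * M + r + 1 < b * (m + 1) := by
    have := Nat.lt_div_mul_add (show 0 < m + 1 by omega) (a := m * M + r + 1)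
    rw [hb, add_mul, one_mul]; exact this
  have hb3 : b ≤ M + r + 2 := by
    have : b * (m + 1) ≤ (M + r + 2) * (m + 1) := by nlinarith
    exact Nat.le_of_mul_le_mul_right this (by omega)
  refine ⟨a, b, by omega, ?_, ?_⟩
  · have hXQ : (Q : ℤ) - δ ≤ a * δ := by
      have : Q ≤ a * δ + δ := by omega
      zify at this; linarith
    have hX1 : (a * δ : ℤ) + 1 ≤ Q := by
      have : a * δ + 1 ≤ Q := by omega
      exact_mod_cast this
    zify at hr hQ hb1 hb2 hb3 hMQ hδ
    have hb0 : (0 : ℤ) ≤ b := by positivity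
    have hm0 : (0 : ℤ) ≤ m := by positivity
    have hM0 : (0 : ℤ) ≤ M := by positivity
    have hr0 : (0 : ℤ) ≤ r := by positivity
    have hQ0 : (0 : ℤ) ≤ Q := by positivity
    have k1 : (m : ℤ) * M * (a * δ) ≤ m * M * (Q - 1) :=
      mul_le_mul_of_nonneg_left (by linarith) (by positivity)
    have k2 : ((Q : ℤ) - δ + 1 - g) * (b * (m + 1)) ≤ (a * δ + 1 - g) * (b * (m + 1)) :=
      mul_le_mul_of_nonneg_right (by linarith) (by positivity)
    refine lt_of_lt_of_le ?_ k2
    have k3 : ((m : ℤ) * M + r + 2) * Q ≤ b * (m + 1) * Q :=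
      mul_le_mul_of_nonneg_right (by linarith) hQ0
    have k4 : (b : ℤ) * r ≤ (Q + r + 2) * r := mul_le_mul_of_nonneg_right (by linarith) hr0
    have k5 : (b : ℤ) * r = b * ((m + 1) * (δ + g)) + b * (m * δ) := by rw [hr]; ring
    have k6 : (0 : ℤ) ≤ m * M := by positivity
    have k7 : (0 : ℤ) ≤ b * (m + 1) := by positivity
    nlinarith
  · zify at hb1 hδ
    have hM0 : (0 : ℤ) ≤ M := by positivity
    have hδ0 : (0 : ℤ) ≤ δ := by positivity
    have k1 : (b * (m + 1) : ℤ) * δ ≤ (m * M + r + 1 + (m + 1)) * δ :=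
      mul_le_mul_of_nonneg_right hb1 hδ0
    have k2 : (0 : ℤ) ≤ (δ - (m + 1)) * M := mul_nonneg (by linarith) hM0
    have k3 : (0 : ℤ) ≤ m * (δ * (r + m + 2)) := by positivity
    have : ((b : ℤ) * δ) * (m + 1) ≤ ((δ - 1) * M + δ * (r + m + 2)) * (m + 1) := by nlinarith
    exact le_of_mul_le_mul_right this (by positivity)

variable {K : Type} [Field K] [Algebra (ZMod 2) K]

theorem Place.ordAt_pow_sub_self_le [IsFF (ZMod 2) K] {P : Place (ZMod 2) K} {x : K}
    (hx : x ∉ P.1) {n : ℕ} (hn : n ≠ 0) :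
    ordAt P.1 (x ^ 2 ^ n - x) ≤ 2 ^ n * ordAt P.1 x := by
  have hx0 : x ≠ 0 := by
    rintro rfl
    exact hx P.1.zero_mem
  have hord : ordAt P.1 x < 0 := by
    by_contra! h
    exact hx ((P.ordAt_nonneg_iff hx0).1 h)
  have h2 : (2 : ℤ) ≤ 2 ^ n := by
    calc (2 : ℤ) = 2 ^ 1 := by norm_num
      _ ≤ 2 ^ n := pow_le_pow_right₀ (by norm_num) (by omega)
  have hlt : 2 ^ n * ordAt P.1 x + 1 ≤ ordAt P.1 x := by nlinarith
  have hpow : x ^ 2 ^ n ∉ P.ball (2 ^ n * ordAt P.1 x + 1) := by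
    rw [P.mem_ball_of_ne (pow_ne_zero _ hx0), P.ordAt_pow]
    push_cast
    omega
  have hxb : x ∈ P.ball (2 ^ n * ordAt P.1 x + 1) := (P.mem_ball_of_ne hx0).2 hlt
  by_contra! h
  refine hpow ?_
  have hz : x ^ 2 ^ n - x ∈ P.ball (2 ^ n * ordAt P.1 x + 1) := by
    by_cases h0 : x ^ 2 ^ n - x = 0
    · rw [h0]; exact zero_mem _
    · exact (P.mem_ball_of_ne h0).2 (by omega)
  have := add_mem hz hxb
  rwa [sub_add_cancel] at this

/-- The multiplicity at `P` of the zero of the minimal polynomial of the residue of `x`. -/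
def zeroMultiplicity (x : K) (P : Place (ZMod 2) K) : ℕ :=
  if h : x ∈ P.1 then (ordAt P.1 (aeval x (minpoly (ZMod 2) (P.resHom ⟨x, h⟩)))).natAbs else 0

theorem deg_sum_single [IsFF (ZMod 2) K] (S : Finset (Place (ZMod 2) K))
    (f : Place (ZMod 2) K → ℤ) :
    deg (∑ P ∈ S, Finsupp.single P (f P)) = ∑ P ∈ S, f P * placeDegree (ZMod 2) P := by
  rw [deg, map_sum]
  exact Finset.sum_congr rfl fun P _ => deg_single P _

theorem sum_single_apply (S : Finset (Place (ZMod 2) K)) (f : Place (ZMod 2) K → ℤ)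
    (Q : Place (ZMod 2) K) :
    (∑ P ∈ S, Finsupp.single P (f P)) Q = if Q ∈ S then f Q else 0 := by
  simp only [Finsupp.finsetSum_apply, Finsupp.single_apply, Finset.sum_ite_eq']

variable {x y : K} {G : (ZMod 2)[X][X]}

theorem IsPlaneModel.exists_badPlaces [HasGenus (ZMod 2) K] (hM : IsPlaneModel x y G) :
    ∃ B : Finset (Place (ZMod 2) K), ∀ P : Place (ZMod 2) K, P ∉ B → ∀ (hx : x ∈ P.1)
      (hy : y ∈ P.1), biEval (ZMod 2) (P.resHom ⟨x, hx⟩) (P.resHom ⟨y, hy⟩) (derivative G) ≠ 0 := by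
  refine ⟨(pdiv (ZMod 2) (biEval (ZMod 2) x y (derivative G))).support,
    fun P hP hx hy h0 => ?_⟩
  rw [Finsupp.notMem_support_iff, pdiv_apply] at hP
  rw [← map_biEval, ← P.mem_ball_one_iff_resHom, P.coe_biEval,
    P.mem_ball_of_ne hM.eval_derivative_ne_zero, hP] at h0
  omega

theorem deg_le_pointCount_add [ClassOne (ZMod 2) K] (hM : IsPlaneModel x y G)
    {B : Finset (Place (ZMod 2) K)} (hB : ∀ P : Place (ZMod 2) K, P ∉ B → ∀ (hx : x ∈ P.1)
      (hy : y ∈ P.1), biEval (ZMod 2) (P.resHom ⟨x, hx⟩) (P.resHom ⟨y, hy⟩) (derivative G) ≠ 0)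
    {n : ℕ} (hn : n ≠ 0) {U : Divisor (ZMod 2) K} {u : K} (hu : u ≠ 0)
    (huU : u ∈ RRspace (ZMod 2) U) (hU : ∀ P : Place (ZMod 2) K, x ∈ P.1 → U P = 0)
    (hball : ∀ (P : Place (ZMod 2) K) (hx : x ∈ P.1) (hy : y ∈ P.1),
      P.resHom ⟨x, hx⟩ ^ 2 ^ n = P.resHom ⟨x, hx⟩ →
      P.resHom ⟨y, hy⟩ ^ 2 ^ n ≠ P.resHom ⟨y, hy⟩ → u ∈ P.ball 1) :
    2 ^ n * deg (poleDiv (ZMod 2) x) ≤ pointCount K n + deg U +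
      ∑ P ∈ B, (zeroMultiplicity x P : ℤ) * placeDegree (ZMod 2) P := by
  set D := poleDiv (ZMod 2) x with hD
  set z := x ^ 2 ^ n - x with hz
  set Z := 2 ^ n • D + pdiv (ZMod 2) z with hZ
  set T := (placesLE K n).filter (placeDegree (ZMod 2) · ∣ n) with hT
  set S := Z.support.filter (fun P => x ∈ P.1 ∧ P ∉ B ∧ P ∉ T) with hS
  have hTmem : ∀ P, P ∈ T ↔ placeDegree (ZMod 2) P ∣ n := by
    intro P
    rw [hT, Finset.mem_filter, mem_placesLE]
    exact ⟨fun h => h.2, fun h => ⟨Nat.le_of_dvd (by omega) h, h⟩⟩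
  have hZdeg : deg Z = 2 ^ n * deg D := by
    have := deg_pdiv (F := ZMod 2) z
    rw [deg] at this
    rw [hZ, deg, map_add, map_nsmul, this, add_zero, nsmul_eq_mul]
    push_cast
    rfl
  have hZin : ∀ (P : Place (ZMod 2) K) (hx : x ∈ P.1), Z P =
      if P.resHom ⟨x, hx⟩ ^ 2 ^ n = P.resHom ⟨x, hx⟩ then
        ordAt P.1 (aeval x (minpoly (ZMod 2) (P.resHom ⟨x, hx⟩))) else 0 := by
    intro P hx
    rw [hZ, Finsupp.add_apply, Finsupp.smul_apply, poleDiv_eq_zero hx, smul_zero, zero_add,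
      pdiv_apply]
    exact Place.ordAt_pow_sub_self (x := ⟨x, hx⟩) hM.transcendental hn
  have hZout : ∀ P : Place (ZMod 2) K, x ∉ P.1 → Z P ≤ 0 := by
    intro P hx
    have h1 := Place.ordAt_pow_sub_self_le hx hn
    have h2 := one_le_poleDiv (F := ZMod 2) hx
    rw [poleDiv_apply] at h2
    rw [hZ, Finsupp.add_apply, Finsupp.smul_apply, pdiv_apply, hD, poleDiv_apply, nsmul_eq_mul]
    have h3 : max 0 (-ordAt P.1 x) = -ordAt P.1 x := by omega
    rw [h3]
    push_cast
    linarith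
  clear_value Z
  have hle : Z ≤ ∑ P ∈ T, Finsupp.single P (1 : ℤ) + ∑ P ∈ S, Finsupp.single P (1 : ℤ) +
      ∑ P ∈ B, Finsupp.single P (zeroMultiplicity x P : ℤ) := by
    intro P
    rw [Finsupp.add_apply, Finsupp.add_apply, sum_single_apply T (fun _ => 1),
      sum_single_apply S (fun _ => 1), sum_single_apply B fun P => (zeroMultiplicity x P : ℤ)]
    have h0 : (0 : ℤ) ≤ zeroMultiplicity x P := by positivity
    by_cases hx : x ∈ P.1
    swap
    · refine (hZout P hx).trans ?_
      split_ifs <;> omega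
    by_cases hPB : P ∈ B
    · have h1 : Z P ≤ zeroMultiplicity x P := by
        rw [hZin P hx, zeroMultiplicity, dif_pos hx]
        split_ifs <;> omega
      rw [if_pos hPB]
      split_ifs <;> omega
    · have h1 : Z P ≤ 1 := by
        rw [hZin P hx]
        split_ifs
        · exact (IsPlaneModel.ordAt_minpoly (x := ⟨x, hx⟩) (y := ⟨y, hM.mem_place hx⟩) hM
            (hB P hPB hx _)).le
        · omega
      by_cases hZ0 : Z P = 0
      · rw [hZ0]
        split_ifs <;> omega
      · by_cases hPT : P ∈ T
        · rw [if_pos hPT]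
          split_ifs <;> omega
        · have hPS : P ∈ S := Finset.mem_filter.2
            ⟨Finsupp.mem_support_iff.2 hZ0, hx, hPB, hPT⟩
          rw [if_pos hPS]
          split_ifs
          omega
  have hdeg := deg_mono hle
  have hsplit : ∀ A B C : Divisor (ZMod 2) K, deg (A + B + C) = deg A + deg B + deg C :=
    fun A B C => by rw [deg, map_add, map_add]
  rw [hZdeg, hsplit, deg_sum_single T (fun _ => 1), deg_sum_single S (fun _ => 1),
    deg_sum_single B fun P => (zeroMultiplicity x P : ℤ)] at hdeg
  simp only [one_mul] at hdeg
  have hSle := sum_placeDegree_le hu huU S fun P hP => by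
    obtain ⟨hPZ, hx, hPB, hPT⟩ := Finset.mem_filter.1 hP
    refine ⟨hU P hx, hball P hx (hM.mem_place hx) ?_ fun hy => ?_⟩
    · by_contra hne
      rw [Finsupp.mem_support_iff, hZin P hx, if_neg hne] at hPZ
      exact hPZ rfl
    · refine hPT ((hTmem P).2 (IsPlaneModel.placeDegree_dvd (x := ⟨x, hx⟩)
        (y := ⟨y, hM.mem_place hx⟩) hM (hB P hPB hx _) ?_ hy))
      by_contra hne
      rw [Finsupp.mem_support_iff, hZin P hx, if_neg hne] at hPZ
      exact hPZ rfl
  have hTN : (pointCount K n : ℤ) = ∑ P ∈ T, (placeDegree (ZMod 2) P : ℤ) := by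
    rw [pointCount, Nat.cast_sum]
  linarith

/-- The lower bound for the number of points. -/
theorem exists_le_pointCount (K : Type) [Field K] [Algebra (ZMod 2) K] [ClassOne (ZMod 2) K] :
    ∃ C n₀ : ℕ, ∀ n ≥ n₀, (2 : ℤ) ^ n ≤ pointCount K n + C * 2 ^ ((n + 1) / 2) := by
  have hff : IsFF (ZMod 2) K := inferInstance
  obtain ⟨x, y, G, hM⟩ := exists_planeModel hff.ff
  obtain ⟨B, hB⟩ := hM.exists_badPlaces
  set D := poleDiv (ZMod 2) x with hD
  have hD0 : 0 ≤ D := poleDiv_nonneg x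
  obtain ⟨δ, hδ⟩ := Int.eq_ofNat_of_zero_le (deg_nonneg hD0)
  obtain ⟨m, hm⟩ : ∃ m, G.natDegree = m + 1 := by
    refine Nat.exists_eq_succ_of_ne_zero fun h0 => ?_
    have h1 := hM.eval_eq_zero
    rw [Polynomial.eq_one_of_monic_natDegree_zero hM.monic h0, map_one] at h1
    exact one_ne_zero h1
  have hmδ : m + 1 ≤ δ := by
    have := hM.natDegree_le_deg
    rw [← hD, hδ, hm] at this
    exact_mod_cast this
  let e : Fin (m + 1) → K := fun j => biEval (ZMod 2) x y (divX^[(j : ℕ) + 1] G)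
  have hreg : ∀ (h : (ZMod 2)[X][X]) (P : Place (ZMod 2) K), x ∈ P.1 →
      biEval (ZMod 2) x y h ∈ P.1 := by
    intro h P hx
    have := P.coe_biEval ⟨x, hx⟩ ⟨y, hM.mem_place hx⟩ h
    change _ = biEval (ZMod 2) x y h at this
    rw [← this]
    exact Subtype.prop _
  choose t₁ ht₁ using fun j : Fin (m + 1) =>
    exists_mem_RRspace_smul (F := ZMod 2) (x := x) (z := e j) (hreg _)
  choose t₂ ht₂ using fun j : Fin (m + 1) =>
    exists_mem_RRspace_smul (F := ZMod 2) (x := x) (z := y ^ (j : ℕ))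
      fun P hP => pow_mem (hM.mem_place hP) _
  obtain ⟨t, ht⟩ : ∃ t, t = ∑ j, t₁ j + ∑ j, t₂ j := ⟨_, rfl⟩
  have he : ∀ j, e j ∈ RRspace (ZMod 2) (t • D) := fun j => ht₁ j t (by
    have := Finset.single_le_sum (f := t₁) (fun _ _ => Nat.zero_le _) (Finset.mem_univ j)
    omega)
  have hy : ∀ j : Fin (m + 1), y ^ (j : ℕ) ∈ RRspace (ZMod 2) (t • D) := fun j => ht₂ j t (by
    have := Finset.single_le_sum (f := t₂) (fun _ _ => Nat.zero_le _) (Finset.mem_univ j)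
    omega)
  have he1 : e (Fin.last m) = 1 := by
    change biEval (ZMod 2) x y (divX^[m + 1] G) = 1
    rw [← hm, iterate_divX_natDegree hM.monic, map_one]
  set g := genus (ZMod 2) K with hg
  obtain ⟨r, hr⟩ : ∃ r, r = (m + 1) * (δ + g) + m * δ := ⟨_, rfl⟩
  obtain ⟨c, hc⟩ : ∃ c : ℕ, (c : ℤ) = ∑ P ∈ B, (zeroMultiplicity x P : ℤ) *
    placeDegree (ZMod 2) P := ⟨∑ P ∈ B, zeroMultiplicity x P * placeDegree (ZMod 2) P, by
      push_cast; rfl⟩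
  refine ⟨1 + δ * (r + m + 2) + t * δ + c, 2 * ((r + 2) * r + m * (t * δ + 1)) + 1,
    fun n hn => ?_⟩
  set μ := n / 2 with hμ
  set ν := (n + 1) / 2 with hν
  have hn' : n = μ + ν := by omega
  have hMQ : 2 ^ μ ≤ 2 ^ ν := Nat.pow_le_pow_right (by norm_num) (by omega)
  have hνlt : ν < 2 ^ ν := Nat.lt_two_pow_self
  obtain ⟨a, b, haQ, hab, hb⟩ := exists_stepanov_parameters (g := g) (t := t) hmδ hMQ hr
    (by omega)
  have hsm : ∀ s : ℕ, deg (s • D) = s * δ := by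
    intro s
    rw [deg, map_nsmul, nsmul_eq_mul, ← hδ]
  have hmul : 2 ^ μ • a • D + b • D + t • D = (2 ^ μ * a + b + t) • D := by
    rw [add_smul, add_smul, mul_smul]
  have hlt : m * ell (ZMod 2) (2 ^ μ • a • D + b • D + t • D) <
      ell (ZMod 2) (a • D) * (b * (m + 1)) := by
    have h1 := riemann (a • D)
    have h2 := ell_le (2 ^ μ • a • D + b • D + t • D) (by rw [hmul, hsm]; positivity)
    rw [hmul, hsm] at h2
    rw [hsm, ← hg] at h1
    rw [hmul]
    zify
    push_cast at h2 hab
    calc (m : ℤ) * ell (ZMod 2) ((2 ^ μ * a + b + t) • D)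
        ≤ m * ((2 ^ μ * a + b + t) * δ + 1) := mul_le_mul_of_nonneg_left h2 (by positivity)
      _ < (a * δ + 1 - g) * (b * (m + 1)) := hab
      _ ≤ ell (ZMod 2) (a • D) * (b * (m + 1)) :=
        mul_le_mul_of_nonneg_right (by linarith) (by positivity)
  obtain ⟨ι, _, v, w, hv, hw, hA, hne⟩ := hM.exists_auxiliary hm (mem_RRspace_poleDiv x) hD0 e he
    he1 μ ν b (E := a • D) (by rw [hsm]; exact_mod_cast haQ) hlt
  have hmem : ∑ i, v i * (∑ j, aeval x (w i j) * y ^ (j : ℕ)) ^ 2 ^ ν ∈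
      RRspace (ZMod 2) ((a + 2 ^ ν * (b + t)) • D) := by
    rw [add_smul, mul_smul, add_smul]
    exact Submodule.sum_mem _ fun i _ => mul_mem_RRspace (hv i) (pow_mem_RRspace
      (Submodule.sum_mem _ fun j _ => mul_mem_RRspace (hw i j) (hy j)) _)
  have hmain := deg_le_pointCount_add hM hB (n := n) (by omega) hne hmem
    (fun P hP => by rw [Finsupp.smul_apply, poleDiv_eq_zero hP, smul_zero])
    (fun P hx hy' h1 h2 => by
      have hvP : ∀ i, v i ∈ P.1 := fun i => by
        have := mem_RRspace.1 (hv i) P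
        rwa [Finsupp.smul_apply, poleDiv_eq_zero hx, smul_zero, neg_zero, P.mem_ball_zero] at this
      rw [hn'] at h1 h2
      exact IsPlaneModel.auxiliary_mem_ball_one (x := ⟨x, hx⟩) (y := ⟨y, hy'⟩) hM hm h1 h2
        (v := fun i => ⟨v i, hvP i⟩) hA)
  rw [← hc, hsm, ← hD, hδ] at hmain
  push_cast at hmain hb ⊢
  have hq : (2 : ℤ) ^ n = 2 ^ μ * 2 ^ ν := by rw [← pow_add, ← hn']
  have haQ' : (a : ℤ) * δ < 2 ^ ν := by exact_mod_cast haQ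
  have hQ1 : (1 : ℤ) ≤ 2 ^ ν := one_le_pow₀ (by norm_num)
  have hbQ : (b : ℤ) * δ * 2 ^ ν ≤ ((δ - 1) * 2 ^ μ + δ * (r + m + 2)) * 2 ^ ν :=
    mul_le_mul_of_nonneg_right hb (by positivity)
  have hcQ : (c : ℤ) * 1 ≤ c * 2 ^ ν := mul_le_mul_of_nonneg_left hQ1 (by positivity)
  rw [hq] at hmain ⊢
  nlinarith

end LowerBound
end CFF

namespace CFF

/-- A real polynomial with constant term `1` whose logarithmic derivative is given on `[0, ρ]` by an
absolutely convergent power series is positive at `ρ`. -/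
theorem sum_pos_of_recursion {d : ℕ} {b S : ℕ → ℝ} {ρ : ℝ} (hb0 : b 0 = 1)
    (hb : ∀ n ≥ d, b n = 0)
    (hrec : ∀ m : ℕ, ((m : ℝ) + 1) * b (m + 1) = -∑ k ∈ Finset.range (m + 1), b k * S (m - k))
    (hρ : 0 ≤ ρ) (hS : Summable fun n => |S n| * ρ ^ n) :
    0 < ∑ i ∈ Finset.range d, b i * ρ ^ i := by
  obtain ⟨f, hf⟩ : ∃ f : ℝ → ℝ, f = fun t => ∑ i ∈ Finset.range d, b i * t ^ i := ⟨_, rfl⟩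
  have hfsum (t : ℝ) : HasSum (fun i => b i * t ^ i) (f t) := by
    rw [hf]
    refine hasSum_sum_of_ne_finset_zero fun n hn => ?_
    rw [hb n (by simpa using hn), zero_mul]
  have hd : 0 < d := by
    by_contra h
    have := hb 0 (by omega)
    rw [hb0] at this
    exact one_ne_zero this
  have hf0 : f 0 = 1 := by
    simp only [hf]
    rw [Finset.sum_eq_single 0 (fun i _ hi => by rw [zero_pow hi, mul_zero])
      (fun h => absurd (Finset.mem_range.mpr hd) h), pow_zero, mul_one, hb0]
  have hSle {t : ℝ} (ht0 : 0 ≤ t) (ht : t ≤ ρ) (n : ℕ) : ‖S n * t ^ n‖ ≤ |S n| * ρ ^ n := by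
    rw [norm_mul, norm_pow, Real.norm_eq_abs, Real.norm_eq_abs, abs_of_nonneg ht0]
    gcongr
  obtain ⟨f', hf'⟩ : ∃ f' : ℝ → ℝ, f' = fun t =>
      ∑ i ∈ Finset.range d, ((i : ℝ) + 1) * b (i + 1) * t ^ i := ⟨_, rfl⟩
  have hderiv (t : ℝ) : HasDerivAt f (f' t) t := by
    rw [hf, hf']
    refine (HasDerivAt.fun_sum fun i _ => (hasDerivAt_pow i t).const_mul (b i)).congr_deriv ?_
    beta_reduce
    obtain ⟨e, rfl⟩ : ∃ e, d = e + 1 := ⟨d - 1, by omega⟩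
    rw [Finset.sum_range_succ', Finset.sum_range_succ, hb (e + 1) le_rfl]
    simp only [Nat.cast_zero, zero_mul, mul_zero, add_zero, Nat.add_sub_cancel]
    refine Finset.sum_congr rfl fun i _ => ?_
    push_cast
    ring
  have hlog {t : ℝ} (ht0 : 0 ≤ t) (ht : t ≤ ρ) : f' t = -(f t * ∑' n, S n * t ^ n) := by
    have h1 : HasSum (fun i : ℕ => ((i : ℝ) + 1) * b (i + 1) * t ^ i) (f' t) := by
      rw [hf']
      refine hasSum_sum_of_ne_finset_zero fun n hn => ?_
      rw [hb (n + 1) (by simp at hn; omega), mul_zero, zero_mul]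
    have h2 : Summable fun i => ‖b i * t ^ i‖ := (hfsum t).summable.norm
    have h3 : Summable fun i => ‖S i * t ^ i‖ :=
      Summable.of_nonneg_of_le (fun _ => norm_nonneg _) (hSle ht0 ht) hS
    rw [← (hfsum t).tsum_eq, tsum_mul_tsum_eq_tsum_sum_range_of_summable_norm h2 h3, ← tsum_neg,
      ← h1.tsum_eq]
    refine tsum_congr fun m => ?_
    rw [hrec, neg_mul, Finset.sum_mul]
    congr 1
    refine Finset.sum_congr rfl fun k hk => ?_
    have : t ^ m = t ^ k * t ^ (m - k) := by
      rw [← pow_add]; congr 1; simp at hk; omega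
    rw [this]; ring
  obtain ⟨B, hB⟩ : ∃ B : ℝ, B = ∑' n, |S n| * ρ ^ n := ⟨_, rfl⟩
  have hbound {t : ℝ} (ht0 : 0 ≤ t) (ht : t ≤ ρ) : ‖f' t‖ ≤ B * ‖f t‖ := by
    rw [hlog ht0 ht, norm_neg, norm_mul, mul_comm]
    gcongr
    rw [hB]
    exact tsum_of_norm_bounded hS.hasSum (hSle ht0 ht)
  have hcont : Continuous f := by
    rw [hf]; fun_prop
  by_contra! hneg
  have hneg' : f ρ ≤ 0 := by rw [hf]; exact hneg
  obtain ⟨r, hr, hr0⟩ := intermediate_value_Icc' hρ hcont.continuousOn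
    (show (0 : ℝ) ∈ Set.Icc (f ρ) (f 0) from ⟨hneg', by rw [hf0]; exact zero_le_one⟩)
  have key := eq_zero_of_abs_deriv_le_mul_abs_self_of_eq_zero_right (f := fun s => f (r - s))
    (f' := fun s => -f' (r - s)) (K := B) (a := 0) (b := r)
    (hcont.comp (by fun_prop)).continuousOn
    (fun x _ => ((hderiv (r - x)).comp_const_sub r x).hasDerivWithinAt)
    (by simpa using hr0)
    (fun x hx => by
      rw [norm_neg]
      exact hbound (by linarith [hx.2]) (by linarith [hx.1, hr.2]))
  have := key r ⟨hr.1, le_rfl⟩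
  rw [sub_self, hf0] at this
  exact one_ne_zero this

open PowerSeries in
/-- Passing from the zeta series to its numerator turns the logarithmic derivative with coefficients
`N` into the one with coefficients `N - 1 - 2 ^ n`. -/
theorem coeff_numerator_recursion {A N : ℕ → ℝ}
    (h : ∀ n : ℕ, (n : ℝ) * A n = ∑ k ∈ Finset.Icc 1 n, N k * A (n - k)) (m : ℕ) :
    ((m : ℝ) + 1) * coeff (m + 1) ((1 - X) * (1 - 2 * X) * mk A) =
      -∑ k ∈ Finset.range (m + 1), coeff k ((1 - X) * (1 - 2 * X) * mk A) *
        (1 + 2 ^ (m - k + 1) - N (m - k + 1)) := by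
  have hZ : d⁄dX ℝ (mk A) = mk (fun n => N (n + 1)) * mk A := by
    ext n
    rw [coeff_derivative, coeff_mk, coeff_mul,
      Finset.Nat.sum_antidiagonal_eq_sum_range_succ
        (fun i j => coeff i (mk fun n => N (n + 1)) * coeff j (mk A))]
    have := h (n + 1)
    rw [← Finset.Ico_succ_right_eq_Icc, Finset.sum_Ico_eq_sum_range] at this
    simp only [coeff_mk]
    push_cast at this
    rw [mul_comm, this]
    simp only [Nat.succ_eq_add_one, Order.succ_eq_add_one, Nat.add_sub_cancel]
    refine Finset.sum_congr rfl fun k _ => ?_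
    rw [add_comm 1 k, Nat.add_sub_add_right]
  have h1 : (mk fun _ => (1 : ℝ)) * (1 - X) = 1 := mk_one_mul_one_sub_eq_one ℝ
  have h2 : (mk fun n => (2 : ℝ) ^ n) * (1 - 2 * X) = 1 := by
    have : (2 : PowerSeries ℝ) = C (2 : ℝ) := (map_ofNat C 2).symm
    rw [mul_sub, mul_one, this, mul_left_comm]
    ext n
    cases n with
    | zero => simp
    | succ n =>
      rw [map_sub, coeff_C_mul, coeff_succ_mul_X, coeff_mk, coeff_mk, coeff_one]
      simp [pow_succ']
  have hE : (mk fun n => (1 + 2 ^ (n + 1) - N (n + 1) : ℝ)) =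
      (mk fun _ => (1 : ℝ)) + 2 * (mk fun n => (2 : ℝ) ^ n) - mk fun n => N (n + 1) := by
    have : (2 : PowerSeries ℝ) = C (2 : ℝ) := (map_ofNat C 2).symm
    ext n
    rw [this, map_sub, map_add, coeff_C_mul]
    simp [pow_succ']
  have hL : d⁄dX ℝ ((1 - X) * (1 - 2 * X) * mk A) =
      -((1 - X) * (1 - 2 * X) * mk A * mk fun n => (1 + 2 ^ (n + 1) - N (n + 1) : ℝ)) := by
    have h2' : d⁄dX ℝ (2 : PowerSeries ℝ) = 0 := by
      have : (2 : PowerSeries ℝ) = C (2 : ℝ) := (map_ofNat C 2).symm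
      rw [this, derivative_C]
    rw [hE]
    simp only [Derivation.leibniz, map_sub, derivative_X, smul_eq_mul, hZ, h2',
      Derivation.map_one_eq_zero]
    linear_combination (mk A * (1 - 2 * X)) * h1 + 2 * (mk A * (1 - X)) * h2
  have := congr_arg (coeff m) hL
  rw [coeff_derivative, map_neg, coeff_mul _ _ (mk fun n => (1 + 2 ^ (n + 1) - N (n + 1) : ℝ)),
    Finset.Nat.sum_antidiagonal_eq_sum_range_succ (fun i j =>
      coeff i ((1 - X) * (1 - 2 * X) * mk A) *
        coeff j (mk fun n => (1 + 2 ^ (n + 1) - N (n + 1) : ℝ)))] at this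
  rw [mul_comm, this]
  simp only [coeff_mk, Nat.succ_eq_add_one]

open PowerSeries in
theorem coeff_numerator_add_two (A : ℕ → ℝ) (n : ℕ) :
    coeff (n + 2) ((1 - X) * (1 - 2 * X) * mk A) = A (n + 2) - 3 * A (n + 1) + 2 * A n := by
  have : (1 - X) * (1 - 2 * X) * mk A = mk A - C (3 : ℝ) * (X * mk A) +
      C (2 : ℝ) * (X * (X * mk A)) := by
    have h2 : C (2 : ℝ) = (2 : PowerSeries ℝ) := map_ofNat C 2
    have h3 : C (3 : ℝ) = (3 : PowerSeries ℝ) := map_ofNat C 3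
    rw [h2, h3]
    ring
  rw [this]
  simp only [map_sub, map_add, coeff_C_mul, coeff_succ_X_mul, coeff_mk]

open PowerSeries in
theorem coeff_numerator_one (A : ℕ → ℝ) :
    coeff 1 ((1 - X) * (1 - 2 * X) * mk A) = A 1 - 3 * A 0 := by
  have : (1 - X) * (1 - 2 * X) * mk A = mk A - C (3 : ℝ) * (X * mk A) +
      C (2 : ℝ) * (X * (X * mk A)) := by
    have h2 : C (2 : ℝ) = (2 : PowerSeries ℝ) := map_ofNat C 2
    have h3 : C (3 : ℝ) = (3 : PowerSeries ℝ) := map_ofNat C 3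
    rw [h2, h3]
    ring
  rw [this]
  have h1 (φ : PowerSeries ℝ) : coeff 1 (X * φ) = coeff 0 φ := coeff_succ_X_mul 0 φ
  simp only [map_sub, map_add, coeff_C_mul, h1, coeff_mk, coeff_zero_X_mul]
  ring

open PowerSeries in
theorem coeff_numerator_zero (A : ℕ → ℝ) :
    coeff 0 ((1 - X) * (1 - 2 * X) * mk A) = A 0 := by
  simp

section ZModTwo

variable {K : Type} [Field K] [Algebra (ZMod 2) K] [ClassOne (ZMod 2) K]

theorem exists_pointCount_pos (K : Type) [Field K] [Algebra (ZMod 2) K] [ClassOne (ZMod 2) K] :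
    ∃ n₀ : ℕ, ∀ n ≥ n₀, 0 < pointCount K n := by
  obtain ⟨C, n₀, h⟩ := exists_le_pointCount K
  refine ⟨max n₀ (2 * C), fun n hn => ?_⟩
  have h1 := h n (le_trans (le_max_left _ _) hn)
  have hC : C < 2 ^ (n / 2) :=
    lt_of_le_of_lt (by have := le_trans (le_max_right _ _) hn; omega) Nat.lt_two_pow_self
  have h2 : (2 : ℤ) ^ n = 2 ^ (n / 2) * 2 ^ ((n + 1) / 2) := by
    rw [← pow_add]; congr 1; omega
  have h3 : (C : ℤ) * 2 ^ ((n + 1) / 2) < 2 ^ (n / 2) * 2 ^ ((n + 1) / 2) := by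
    gcongr
    exact_mod_cast hC
  have : (0 : ℤ) < pointCount K n := by rw [h2] at h1; linarith
  exact_mod_cast this

theorem exists_placeDegree_dvd {n : ℕ} (h : 0 < pointCount K n) :
    ∃ P : Place (ZMod 2) K, placeDegree (ZMod 2) P ∣ n := by
  by_contra! hP
  rw [pointCount, Finset.filter_false_of_mem (fun P _ => hP P), Finset.sum_empty] at h
  exact lt_irrefl _ h

/-- A function field of class number one over `𝔽₂` has a divisor of degree one. -/
theorem exists_deg_eq_one (K : Type) [Field K] [Algebra (ZMod 2) K] [ClassOne (ZMod 2) K] :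
    ∃ D : Divisor (ZMod 2) K, deg D = 1 := by
  obtain ⟨n, h⟩ := exists_pointCount_pos K
  obtain ⟨P, hP⟩ := exists_placeDegree_dvd (h n le_rfl)
  obtain ⟨P', hP'⟩ := exists_placeDegree_dvd (h (n + 1) n.le_succ)
  have hcop : Nat.Coprime (placeDegree (ZMod 2) P) (placeDegree (ZMod 2) P') :=
    Nat.Coprime.of_dvd hP hP' (by simp)
  obtain ⟨a, b, hab⟩ := Nat.isCoprime_iff_coprime.mpr hcop
  refine ⟨Finsupp.single P a + Finsupp.single P' b, ?_⟩
  rw [deg, map_add, ← deg, ← deg, deg_single, deg_single, hab]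

theorem summable_pointCount_error (K : Type) [Field K] [Algebra (ZMod 2) K]
    [ClassOne (ZMod 2) K] :
    Summable fun n : ℕ => |(1 + 2 ^ (n + 1) - pointCount K (n + 1) : ℝ)| * (7 / 10) ^ n := by
  obtain ⟨C, m, hC⟩ := exists_pointCount_le K
  obtain ⟨C', m', hC'⟩ := exists_le_pointCount K
  have hs : Real.sqrt 2 * (7 / 10) < 1 := by
    have : Real.sqrt 2 < 10 / 7 := by
      rw [Real.sqrt_lt' (by norm_num)]; norm_num
    linarith
  refine Summable.of_norm_bounded_eventually_nat
    ((summable_geometric_of_lt_one (by positivity) hs).mul_left ((1 + C + C' : ℝ) * 2)) ?_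
  filter_upwards [Filter.eventually_ge_atTop (max m m')] with n hn
  have h1 : (pointCount K (n + 1) : ℝ) ≤ 2 ^ (n + 1) + C * 2 ^ ((n + 1 + 1) / 2) := by
    exact_mod_cast hC (n + 1) (by omega)
  have h2 : (2 : ℝ) ^ (n + 1) ≤ pointCount K (n + 1) + C' * 2 ^ ((n + 1 + 1) / 2) := by
    exact_mod_cast hC' (n + 1) (by omega)
  have h3 : (1 : ℝ) ≤ 2 ^ ((n + 1 + 1) / 2) := one_le_pow₀ one_le_two
  have h4 : (2 : ℝ) ^ ((n + 1 + 1) / 2) ≤ 2 * Real.sqrt 2 ^ n := by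
    have h5 : Real.sqrt 2 ^ 2 = 2 := Real.sq_sqrt zero_le_two
    calc (2 : ℝ) ^ ((n + 1 + 1) / 2) = Real.sqrt 2 ^ (2 * ((n + 1 + 1) / 2)) := by
          rw [pow_mul, h5]
      _ ≤ Real.sqrt 2 ^ (n + 2) :=
          pow_le_pow_right₀ (Real.one_le_sqrt.mpr one_le_two) (by omega)
      _ = 2 * Real.sqrt 2 ^ n := by rw [pow_add, h5, mul_comm]
  have h6 : |(1 + 2 ^ (n + 1) - pointCount K (n + 1) : ℝ)| ≤
      (1 + C + C') * 2 ^ ((n + 1 + 1) / 2) := by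
    have hx : (0 : ℝ) ≤ C * 2 ^ ((n + 1 + 1) / 2) := by positivity
    have hy : (0 : ℝ) ≤ C' * 2 ^ ((n + 1 + 1) / 2) := by positivity
    rw [abs_le]
    constructor <;> linarith
  rw [Real.norm_eq_abs, abs_mul, abs_abs, abs_of_nonneg (by positivity : (0 : ℝ) ≤ (7 / 10) ^ n),
    mul_pow]
  calc _ ≤ (1 + C + C' : ℝ) * (2 * Real.sqrt 2 ^ n) * (7 / 10) ^ n := by
        gcongr
        exact h6.trans (by gcongr)
    _ = _ := by ring

theorem effCount_zero : effCount K 0 = 1 := by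
  have := effCount_add_one (D := (0 : Divisor (ZMod 2) K)) (n := 0) (by rw [deg, map_zero]; rfl)
  rw [ell_zero] at this
  omega

/-- The numbers of effective divisors of given degree in genus four and class number one. -/
theorem effCount_of_genus_eq_four (hg : genus (ZMod 2) K = 4) :
    effCount K 4 = 2 * effCount K 2 + 1 ∧ effCount K 5 = 4 * effCount K 1 + 3 ∧
      effCount K 6 = 15 ∧ ∀ n ≥ 7, effCount K n + 1 = 2 ^ (n - 3) := by
  obtain ⟨D, hD⟩ := exists_deg_eq_one K
  obtain ⟨W, hW⟩ := riemann_roch (F := ZMod 2) (K := K)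
  have hdeg (n : ℤ) : deg (n • D) = n := by
    rw [deg, map_zsmul, ← deg, hD, smul_eq_mul, mul_one]
  have hW4 : (ell (ZMod 2) W : ℤ) = 4 := by
    have := hW 0
    rw [ell_zero, hg, sub_zero, deg, map_zero] at this
    push_cast at this
    linarith
  have hWdeg : deg W = 6 := by
    have := hW W
    rw [hW4, sub_self, ell_zero, hg] at this
    push_cast at this
    linarith
  have hRR (n : ℤ) : (ell (ZMod 2) (n • D) : ℤ) = n - 3 + ell (ZMod 2) ((6 - n) • D) := by
    have h1 := hW (n • D)
    have h2 : ell (ZMod 2) (W - n • D) = ell (ZMod 2) ((6 - n) • D) := by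
      refine ell_eq_of_deg_eq ?_
      rw [hdeg, deg, map_sub, ← deg, ← deg, hdeg, hWdeg]
    rw [h2, hdeg, hg] at h1
    push_cast at h1
    linarith
  have hA (n : ℕ) : effCount K n + 1 = 2 ^ ell (ZMod 2) ((n : ℤ) • D) :=
    effCount_add_one (hdeg n)
  have h0 : ell (ZMod 2) ((0 : ℤ) • D) = 1 := by rw [zero_smul, ell_zero]
  refine ⟨?_, ?_, ?_, fun n hn => ?_⟩
  · have h := hRR 4
    norm_num at h
    have h4 : ell (ZMod 2) ((4 : ℤ) • D) = 1 + ell (ZMod 2) ((2 : ℤ) • D) := by exact_mod_cast h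
    have e4 := hA 4
    have e2 := hA 2
    push_cast at e4 e2
    rw [h4, pow_add, ← e2] at e4
    omega
  · have h := hRR 5
    rw [show (6 : ℤ) - 5 = 1 by norm_num, show (5 : ℤ) - 3 = 2 by norm_num] at h
    have h5 : ell (ZMod 2) ((5 : ℤ) • D) = 2 + ell (ZMod 2) ((1 : ℤ) • D) := by exact_mod_cast h
    have e5 := hA 5
    have e1 := hA 1
    push_cast at e5 e1
    rw [h5, pow_add, ← e1] at e5
    omega
  · have h := hRR 6
    rw [sub_self, h0] at h
    have h6 : ell (ZMod 2) ((6 : ℤ) • D) = 4 := by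
      push_cast at h
      exact_mod_cast h
    have e6 := hA 6
    push_cast at e6
    rw [h6] at e6
    omega
  · have h := hRR n
    rw [ell_eq_zero_of_deg_neg (D := ((6 : ℤ) - n) • D) (by rw [hdeg]; omega)] at h
    rw [hA]
    congr 1
    omega

theorem effCount_eq_zero {n : ℕ} : effCount K n = 0 ↔
    ∀ E : Divisor (ZMod 2) K, 0 ≤ E → deg E ≠ n := by
  rw [effCount, Set.ncard_eq_zero (effSet_finite n), Set.eq_empty_iff_forall_notMem]
  exact ⟨fun h E h0 hE => h E ⟨h0, hE⟩, fun h E hE => h E hE.1 hE.2⟩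

theorem placeDegree_ne_of_effCount_eq_zero {n : ℕ} (h : effCount K n = 0)
    (P : Place (ZMod 2) K) : placeDegree (ZMod 2) P ≠ n := fun hP =>
  effCount_eq_zero.mp h (Finsupp.single P 1) (Finsupp.single_nonneg.mpr zero_le_one)
    (by rw [deg_single, one_mul, hP])

theorem pointCount_eq_zero {n : ℕ} (h : ∀ P : Place (ZMod 2) K, ¬ placeDegree (ZMod 2) P ∣ n) :
    pointCount K n = 0 := by
  rw [pointCount, Finset.filter_false_of_mem (fun P _ => h P), Finset.sum_empty]

/-- If no proper divisor of `n` is the degree of a place, then the point count in degree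
`n` only sees the places of degree `n`. -/
theorem pointCount_eq_mul_card {n : ℕ}
    (h : ∀ P : Place (ZMod 2) K, placeDegree (ZMod 2) P ∣ n → placeDegree (ZMod 2) P = n) :
    pointCount K n = n * Nat.card {P : Place (ZMod 2) K // placeDegree (ZMod 2) P = n} := by
  have hset : {P : Place (ZMod 2) K | placeDegree (ZMod 2) P = n} =
      ↑((placesLE K n).filter fun P => placeDegree (ZMod 2) P ∣ n) := by
    ext P
    rw [Finset.mem_coe, Finset.mem_filter, mem_placesLE]
    exact ⟨fun hP => by
      rw [Set.mem_ofPred_eq] at hP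
      exact ⟨hP.le, hP.symm ▸ dvd_rfl⟩, fun hP => h P hP.2⟩
  have hcard : Nat.card {P : Place (ZMod 2) K // placeDegree (ZMod 2) P = n} =
      ((placesLE K n).filter fun P => placeDegree (ZMod 2) P ∣ n).card := by
    rw [← Set.ncard_coe_finset, ← hset]
    rfl
  rw [hcard, pointCount, Finset.sum_congr rfl
    (fun P hP => h P (Finset.mem_filter.mp hP).2), Finset.sum_const, smul_eq_mul, mul_comm]

/-- The numerator of the zeta function evaluated at `7 / 10` forces the low degree counts to
vanish. -/
theorem effCount_eq_zero_of_genus_eq_four (hg : genus (ZMod 2) K = 4) :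
    effCount K 1 = 0 ∧ effCount K 2 = 0 ∧ effCount K 3 = 0 := by
  obtain ⟨h4, h5, h6, h7⟩ := effCount_of_genus_eq_four hg
  obtain ⟨A, hA⟩ : ∃ A : ℕ → ℝ, ∀ n, A n = effCount K n := ⟨_, fun _ => rfl⟩
  obtain ⟨b, hb⟩ : ∃ b : ℕ → ℝ, b = fun n => PowerSeries.coeff n
    ((1 - PowerSeries.X) * (1 - 2 * PowerSeries.X) * PowerSeries.mk A) := ⟨_, rfl⟩
  have a0 : A 0 = 1 := by simp only [hA]; exact_mod_cast effCount_zero (K := K)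
  have a4 : A 4 = 2 * A 2 + 1 := by simp only [hA]; exact_mod_cast h4
  have a5 : A 5 = 4 * A 1 + 3 := by simp only [hA]; exact_mod_cast h5
  have a6 : A 6 = 15 := by simp only [hA]; exact_mod_cast h6
  have a7 (n : ℕ) : A (n + 7) = 2 ^ (n + 4) - 1 := by
    have := h7 (n + 7) (by omega)
    rw [show n + 7 - 3 = n + 4 by omega] at this
    rw [hA, eq_sub_iff_add_eq]
    exact_mod_cast this
  have b2 (n : ℕ) : b (n + 2) = A (n + 2) - 3 * A (n + 1) + 2 * A n := by
    rw [hb]; exact coeff_numerator_add_two A n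
  have b0 : b 0 = 1 := by rw [hb, ← a0]; exact coeff_numerator_zero A
  have b1 : b 1 = A 1 - 3 * A 0 := by rw [hb]; exact coeff_numerator_one A
  have hpos := sum_pos_of_recursion (d := 9) (b := b)
    (S := fun n => 1 + 2 ^ (n + 1) - pointCount K (n + 1)) (ρ := 7 / 10) b0
    (fun n hn => by
      obtain ⟨k, rfl⟩ : ∃ k, n = k + 7 + 2 := ⟨n - 9, by omega⟩
      rw [b2, a7 k, a7 (k + 1), a7 (k + 2)]
      ring)
    (fun m => by
      rw [hb]
      refine coeff_numerator_recursion (N := fun n => (pointCount K n : ℝ)) (fun n => ?_) m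
      simp only [hA]
      exact_mod_cast mul_effCount (K := K) n)
    (by norm_num) (summable_pointCount_error K)
  have a7' := a7 0
  have a8 := a7 1
  norm_num at a7' a8
  simp only [Finset.sum_range_succ, Finset.sum_range_zero, b0, b1, b2, zero_add, Nat.reduceAdd,
    a0, a4, a5, a6, a7', a8] at hpos
  simp only [hA] at hpos
  have px : (0 : ℝ) ≤ effCount K 1 := Nat.cast_nonneg _
  have py : (0 : ℝ) ≤ effCount K 2 := Nat.cast_nonneg _
  have pz : (0 : ℝ) ≤ effCount K 3 := Nat.cast_nonneg _
  norm_num at hpos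
  refine ⟨?_, ?_, ?_⟩
  all_goals
    by_contra h
    have h1 := Nat.one_le_cast (α := ℝ).mpr (Nat.one_le_iff_ne_zero.mpr h)
    linarith

theorem natCard_places_of_genus_eq_four (hg : genus (ZMod 2) K = 4) :
    Nat.card {p : Place (ZMod 2) K // placeDegree (ZMod 2) p = 1} = 0 ∧
    Nat.card {p : Place (ZMod 2) K // placeDegree (ZMod 2) p = 2} = 0 ∧
    Nat.card {p : Place (ZMod 2) K // placeDegree (ZMod 2) p = 3} = 0 ∧
    Nat.card {p : Place (ZMod 2) K // placeDegree (ZMod 2) p = 4} = 1 ∧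
    Nat.card {p : Place (ZMod 2) K // placeDegree (ZMod 2) p = 5} = 3 := by
  obtain ⟨h4, h5, -, -⟩ := effCount_of_genus_eq_four hg
  obtain ⟨h1, h2, h3⟩ := effCount_eq_zero_of_genus_eq_four hg
  have p1 := placeDegree_ne_of_effCount_eq_zero h1
  have p2 := placeDegree_ne_of_effCount_eq_zero h2
  have p3 := placeDegree_ne_of_effCount_eq_zero h3
  have p4 (P : Place (ZMod 2) K) (hP : placeDegree (ZMod 2) P ∣ 4) :
      placeDegree (ZMod 2) P = 4 := by
    have hle := Nat.le_of_dvd (by norm_num) hP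
    have := P.placeDegree_pos
    have := p1 P; have := p2 P; have := p3 P
    omega
  have p5 (P : Place (ZMod 2) K) (hP : placeDegree (ZMod 2) P ∣ 5) :
      placeDegree (ZMod 2) P = 5 :=
    ((Nat.dvd_prime Nat.prime_five).mp hP).resolve_left (p1 P)
  have n1 : pointCount K 1 = 0 := pointCount_eq_zero fun P hP => p1 P (Nat.dvd_one.mp hP)
  have n4 := pointCount_eq_mul_card p4
  have n5 := pointCount_eq_mul_card p5
  have m4 := mul_effCount (K := K) 4
  have m5 := mul_effCount (K := K) 5
  rw [h2] at h4
  rw [h1] at h5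
  simp only [← Finset.Ico_succ_right_eq_Icc, Finset.sum_Ico_eq_sum_range, Finset.sum_range_succ,
    Finset.sum_range_zero, Order.succ_eq_add_one, Nat.reduceAdd, Nat.reduceSub, h1, h2, h3, h4, h5,
    n1, n4, n5, effCount_zero, mul_zero, zero_add, mul_one] at m4 m5
  refine ⟨?_, ?_, ?_, by omega, by omega⟩
  · exact Nat.card_eq_zero.mpr (Or.inl ⟨fun P => p1 P P.2⟩)
  · exact Nat.card_eq_zero.mpr (Or.inl ⟨fun P => p2 P P.2⟩)
  · exact Nat.card_eq_zero.mpr (Or.inl ⟨fun P => p3 P P.2⟩)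

end ZModTwo

end CFF

open CFF in
/-- A congruence function field over `𝔽₂` of genus `4` and class number `1`
has no places of degree `1`, `2` or `3`, exactly one place of degree `4`, and
exactly three places of degree `5`. -/
theorem place_counts_of_genus_four_class_number_one
    (K : Type) [Field K] [Algebra (ZMod 2) K]
    (hFF : IsFunctionField (ZMod 2) K)
    (hconst : HasExactConstants (ZMod 2) K)
    (hg : genus (ZMod 2) K = 4)
    (hh : classNumber (ZMod 2) K = 1) :
    Nat.card {p : Place (ZMod 2) K // placeDegree (ZMod 2) p = 1} = 0 ∧
    Nat.card {p : Place (ZMod 2) K // placeDegree (ZMod 2) p = 2} = 0 ∧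
    Nat.card {p : Place (ZMod 2) K // placeDegree (ZMod 2) p = 3} = 0 ∧
    Nat.card {p : Place (ZMod 2) K // placeDegree (ZMod 2) p = 4} = 1 ∧
    Nat.card {p : Place (ZMod 2) K // placeDegree (ZMod 2) p = 5} = 3 := by
  have : IsFF (ZMod 2) K := ⟨hFF, hconst⟩
  have : HasGenus (ZMod 2) K := hasGenus_of_genus_ne_zero (by rw [hg]; norm_num)
  have : ClassOne (ZMod 2) K := classOne_of_classNumber hh
  exact natCard_places_of_genus_eq_four hg
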